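/- For all integers k ≥ 1, s ≥ 0, r ≥ 0 with s and r both even and s + r = k, GR_k((k−s−r)P3, sK3, rH3) = 5^(s/2)·⌊21·17^((r−2)/2)⌋ + 1, where ⌊21·17^((r−2)/2)⌋ denotes the floor of the real number 21·17^((r−2)/2) (so it equals 21·17^((r−2)/2) when r ≥ 2, and equals 1 when r = 0). -/

import Mathlib

open SimpleGraph

/-- A rainbow triangle in an edge-coloring of a complete graph: three distinct
vertices whose three pairwise edges receive three pairwise distinct colors. -/
def HasRainbowTriangle {n k : ℕ} (c : Fin n → Fin n → Fin k) : Prop :=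
  ∃ u v w : Fin n, u ≠ v ∧ u ≠ w ∧ v ≠ w ∧
    c u v ≠ c u w ∧ c u v ≠ c v w ∧ c u w ≠ c v w

/-- A Gallai `k`-coloring of `K_n`: a symmetric edge-coloring with no rainbow triangle. -/
def IsGallaiColoring {n k : ℕ} (c : Fin n → Fin n → Fin k) : Prop :=
  (∀ u v, c u v = c v u) ∧ ¬ HasRainbowTriangle c

/-- A monochromatic copy of the graph `F` in color `i`: an injection of the vertices
of `F` into the vertices of `K_n` mapping every edge of `F` to an edge colored `i`. -/
def HasMonoCopy {V : Type} (F : SimpleGraph V) {n k : ℕ}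
    (c : Fin n → Fin n → Fin k) (i : Fin k) : Prop :=
  ∃ f : V → Fin n, Function.Injective f ∧ ∀ a b, F.Adj a b → c (f a) (f b) = i

/-- The Gallai-Ramsey number `GR(F₁, …, F_k)`: the least `n` such that every Gallai
`k`-coloring of `K_n` contains, for some color `i`, a monochromatic copy of `Fᵢ`
in color `i`. -/
noncomputable def GR (k : ℕ) (F : Fin k → Σ V : Type, SimpleGraph V) : ℕ :=
  sInf {n : ℕ | ∀ c : Fin n → Fin n → Fin k, IsGallaiColoring c →
    ∃ i : Fin k, HasMonoCopy (F i).2 c i}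

/-- The triangle `K₃`. -/
def GK3 : SimpleGraph (Fin 3) := ⊤

/-- The path `P₃` on three vertices (edges 0–1 and 1–2). -/
def GP3 : SimpleGraph (Fin 3) := SimpleGraph.fromRel (fun a _ => a = 1)

/-- `H₁`: a `K₄` on `{0,1,2,3}` together with the extra vertex `4` adjacent to
exactly the vertex `3`. -/
def GH1 : SimpleGraph (Fin 5) :=
  SimpleGraph.fromRel (fun a b => (a ≠ 4 ∧ b ≠ 4) ∨ (a = 3 ∧ b = 4))

/-- `H₂`: `K₅` minus the two edges 0–1 and 1–2 of a path on three vertices. -/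
def GH2 : SimpleGraph (Fin 5) :=
  (⊤ : SimpleGraph (Fin 5)) \
    SimpleGraph.fromRel (fun a b => (a = 0 ∧ b = 1) ∨ (a = 1 ∧ b = 2))

/-- `H₃`: `K₅` minus the edge 0–1. -/
def GH3 : SimpleGraph (Fin 5) :=
  (⊤ : SimpleGraph (Fin 5)) \ SimpleGraph.fromRel (fun a b => a = 0 ∧ b = 1)
/-- The family of graphs for `GR_k((k-s-r)P₃, sK₃, rH₃)`: the graph `H₃` in each of
the first `r` colors, the triangle `K₃` in each of the next `s` colors, and the path
`P₃` in each of the remaining `k - s - r` colors. -/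
def mixPKH (k s r : ℕ) : Fin k → Σ V : Type, SimpleGraph V :=
  fun i =>
    if (i : ℕ) < r then ⟨Fin 5, GH3⟩
    else if (i : ℕ) < r + s then ⟨Fin 3, GK3⟩
    else ⟨Fin 3, GP3⟩

set_option linter.all false

namespace GRP
open scoped Classical

variable {V : Type*}

/-- `Fr t G S`: within `S` the graph `G` is: edgeless (0), P3-free (1), K3-free (2),
(K4-e)-free (3), (K5-e)-free (4 and beyond). -/
def Fr (t : ℕ) (G : SimpleGraph V) (S : Finset V) : Prop :=
  match t with
  | 0 => ∀ x ∈ S, ∀ y ∈ S, G.Adj x y → False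
  | 1 => ∀ x ∈ S, ∀ y ∈ S, ∀ z ∈ S, y ≠ z → G.Adj x y → G.Adj x z → False
  | 2 => ∀ x ∈ S, ∀ y ∈ S, ∀ z ∈ S, G.Adj x y → G.Adj x z → G.Adj y z → False
  | 3 => ∀ x ∈ S, ∀ y ∈ S, ∀ z ∈ S, ∀ w ∈ S, z ≠ w → G.Adj x y → G.Adj x z → G.Adj y z →
      G.Adj x w → G.Adj y w → False
  | _ => ∀ x ∈ S, ∀ y ∈ S, ∀ z ∈ S, ∀ p ∈ S, ∀ q ∈ S, p ≠ q → G.Adj x y → G.Adj x z →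
      G.Adj y z → G.Adj x p → G.Adj y p → G.Adj z p → G.Adj x q → G.Adj y q → G.Adj z q → False

theorem Fr.mono {t : ℕ} {G : SimpleGraph V} {S T : Finset V} (h : Fr t G S) (hT : T ⊆ S) :
    Fr t G T := by
  match t with
  | 0 => exact fun x hx y hy => h x (hT hx) y (hT hy)
  | 1 => exact fun x hx y hy z hz => h x (hT hx) y (hT hy) z (hT hz)
  | 2 => exact fun x hx y hy z hz => h x (hT hx) y (hT hy) z (hT hz)
  | 3 => exact fun x hx y hy z hz w hw => h x (hT hx) y (hT hy) z (hT hz) w (hT hw)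
  | (n+4) =>
    intro x hx y hy z hz w hw q hq
    exact h x (hT hx) y (hT hy) z (hT hz) w (hT hw) q (hT hq)

theorem Fr.one_of_zero {G : SimpleGraph V} {S : Finset V} (h : Fr 0 G S) : Fr 1 G S :=
  fun x hx y hy z hz _ h1 _ => h x hx y hy h1
theorem Fr.two_of_one {G : SimpleGraph V} {S : Finset V} (h : Fr 1 G S) : Fr 2 G S :=
  fun x hx y hy z hz h1 h2 h3 => h x hx y hy z hz h3.ne h1 h2
theorem Fr.three_of_two {G : SimpleGraph V} {S : Finset V} (h : Fr 2 G S) : Fr 3 G S :=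
  fun x hx y hy z hz w hw _ h1 h2 h3 _ _ => h x hx y hy z hz h1 h2 h3
theorem Fr.four_of_three {G : SimpleGraph V} {S : Finset V} (h : Fr 3 G S) : Fr 4 G S :=
  fun x hx y hy z hz p hp q hq hpq h1 h2 h3 h4 h5 h6 h7 h8 h9 =>
    h x hx y hy p hp q hq hpq h1 h4 h5 h7 h8

/-- Smaller graph inherits freeness. -/
theorem Fr.anti {t : ℕ} {G G' : SimpleGraph V} {S : Finset V} (h : Fr t G S)
    (hG : ∀ x ∈ S, ∀ y ∈ S, G'.Adj x y → G.Adj x y) : Fr t G' S := by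
  match t with
  | 0 => exact fun x hx y hy a => h x hx y hy (hG _ hx _ hy a)
  | 1 => exact fun x hx y hy z hz n a b => h x hx y hy z hz n (hG _ hx _ hy a) (hG _ hx _ hz b)
  | 2 =>
    intro x hx y hy z hz a b c
    exact h x hx y hy z hz (hG _ hx _ hy a) (hG _ hx _ hz b)
            (hG _ hy _ hz c)
  | 3 =>
    intro x hx y hy z hz w hw n a b c d e
    exact h x hx y hy z hz w hw n
            (hG _ hx _ hy a) (hG _ hx _ hz b) (hG _ hy _ hz c) (hG _ hx _ hw d) (hG _ hy _ hw e)
  | (n+4) =>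
    intro x hx y hy z hz p hp q hq n a b c d e f g h' i
    exact h x hx y hy z hz p hp q hq n
            (hG _ hx _ hy a) (hG _ hx _ hz b) (hG _ hy _ hz c) (hG _ hx _ hp d) (hG _ hy _ hp e)
            (hG _ hz _ hp f) (hG _ hx _ hq g) (hG _ hy _ hq h') (hG _ hz _ hq i)

/-! Joins. -/
section join
variable {G : SimpleGraph V} {S A B : Finset V}

/-- all `G`-edges between A and B are present -/
def Jn (G : SimpleGraph V) (A B : Finset V) : Prop := ∀ a ∈ A, ∀ b ∈ B, G.Adj a b

theorem Jn.symm (h : Jn G A B) : Jn G B A := fun b hb a ha => (h a ha b hb).symm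
theorem Jn.mono {A' B' : Finset V} (h : Jn G A B) (hA : A' ⊆ A) (hB : B' ⊆ B) : Jn G A' B' :=
  fun a ha b hb => h a (hA ha) b (hB hb)

theorem jn0 (hA : A ⊆ S) (hB : B ⊆ S) (j : Jn G A B) (h : Fr 0 G S) (ha : A.Nonempty) : B = ∅ := by
  obtain ⟨a, ha⟩ := ha
  rw [Finset.eq_empty_iff_forall_notMem]
  exact fun b hb => h a (hA ha) b (hB hb) (j a ha b hb)

theorem jn1 (hA : A ⊆ S) (hB : B ⊆ S) (j : Jn G A B) (h : Fr 1 G S) (ha : A.Nonempty) :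
    B.card ≤ 1 := by
  obtain ⟨a, ha⟩ := ha
  rw [Finset.card_le_one]
  intro b hb b' hb'
  by_contra hn
  exact h a (hA ha) b (hB hb) b' (hB hb') hn (j a ha b hb) (j a ha b' hb')

theorem jn2 (hA : A ⊆ S) (hB : B ⊆ S) (j : Jn G A B) (h : Fr 2 G S) (ha : A.Nonempty) :
    Fr 0 G B := by
  obtain ⟨a, ha⟩ := ha
  exact fun b hb b' hb' e => h a (hA ha) b (hB hb) b' (hB hb') (j a ha b hb) (j a ha b' hb') e

theorem jn3 (hA : A ⊆ S) (hB : B ⊆ S) (j : Jn G A B) (h : Fr 3 G S) (ha : A.Nonempty) :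
    Fr 1 G B := by
  obtain ⟨a, ha⟩ := ha
  exact fun b hb x hx y hy n e f => h a (hA ha) b (hB hb) x (hB hx) y (hB hy) n (j a ha b hb)
    (j a ha x hx) e (j a ha y hy) f

theorem jn3b (hA : A ⊆ S) (hB : B ⊆ S) (j : Jn G A B) (h : Fr 3 G S) (ha : 1 < A.card) :
    Fr 0 G B := by
  obtain ⟨a, ha, a', ha', hn⟩ := Finset.one_lt_card.1 ha
  exact fun b hb x hx e => h b (hB hb) x (hB hx) a (hA ha) a' (hA ha') hn e
    (j a ha b hb).symm (j a ha x hx).symm (j a' ha' b hb).symm (j a' ha' x hx).symm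

/-- an edge in A forces `B` to be a singleton, type 3 -/
theorem jn3c (hA : A ⊆ S) (hB : B ⊆ S) (j : Jn G A B) (h : Fr 3 G S) (ha : ¬ Fr 0 G A) :
    B.card ≤ 1 := by
  by_contra hc
  push Not at hc
  exact ha (jn3b hB hA j.symm h hc)

theorem jn4 (hA : A ⊆ S) (hB : B ⊆ S) (j : Jn G A B) (h : Fr 4 G S) (ha : A.Nonempty) :
    Fr 3 G B := by
  obtain ⟨a, ha⟩ := ha
  exact fun x hx y hy z hz w hw n h1 h2 h3 h4 h5 =>
    h a (hA ha) x (hB hx) y (hB hy) z (hB hz) w (hB hw) n (j a ha x hx) (j a ha y hy) h1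
      (j a ha z hz) h2 h3 (j a ha w hw) h4 h5

theorem jn4b (hA : A ⊆ S) (hB : B ⊆ S) (j : Jn G A B) (h : Fr 4 G S) (ha : 1 < A.card) :
    Fr 2 G B := by
  obtain ⟨a, ha, a', ha', hn⟩ := Finset.one_lt_card.1 ha
  exact fun x hx y hy z hz h1 h2 h3 =>
    h x (hB hx) y (hB hy) z (hB hz) a (hA ha) a' (hA ha') hn h1 h2 h3
      (j a ha x hx).symm (j a ha y hy).symm (j a ha z hz).symm
      (j a' ha' x hx).symm (j a' ha' y hy).symm (j a' ha' z hz).symm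

theorem jn4c (hA : A ⊆ S) (hB : B ⊆ S) (j : Jn G A B) (h : Fr 4 G S) (ha : ¬ Fr 0 G A) :
    Fr 1 G B := by
  simp only [Fr] at ha
  push Not at ha
  obtain ⟨a, ha, a', ha', e, -⟩ := ha
  exact fun x hx y hy z hz n h1 h2 =>
    h a (hA ha) a' (hA ha') x (hB hx) y (hB hy) z (hB hz) n e (j a ha x hx) (j a' ha' x hx)
      (j a ha y hy) (j a' ha' y hy) h1 (j a ha z hz) (j a' ha' z hz) h2

theorem jn4d (hA : A ⊆ S) (hB : B ⊆ S) (j : Jn G A B) (h : Fr 4 G S) (ha : ¬ Fr 1 G A) :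
    Fr 0 G B := by
  by_contra hc
  exact ha (jn4c hB hA j.symm h hc)

theorem jn4e (hA : A ⊆ S) (hB : B ⊆ S) (j : Jn G A B) (h : Fr 4 G S) (ha : ¬ Fr 2 G A) :
    B.card ≤ 1 := by
  by_contra hc
  push Not at hc
  exact ha (jn4b hB hA j.symm h hc)

end join

/-! Two-colour bounds. -/
def Cov (R B : SimpleGraph V) (S : Finset V) : Prop :=
  ∀ x ∈ S, ∀ y ∈ S, x ≠ y → R.Adj x y ∨ B.Adj x y

section two
variable {R B : SimpleGraph V} {S : Finset V}

theorem Cov.symm (h : Cov R B S) : Cov B R S := fun x hx y hy n => (h x hx y hy n).symm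
theorem Cov.mono {T : Finset V} (h : Cov R B S) (hT : T ⊆ S) : Cov R B T :=
  fun x hx y hy n => h x (hT hx) y (hT hy) n

/-- neighbourhood inside S -/
noncomputable def nb (G : SimpleGraph V) (S : Finset V) (v : V) : Finset V := S.filter (G.Adj v)

theorem nb_sub {G : SimpleGraph V} {v : V} : nb G S v ⊆ S := Finset.filter_subset _ _
theorem mem_nb {G : SimpleGraph V} {v x : V} : x ∈ nb G S v ↔ x ∈ S ∧ G.Adj v x := by
  simp [nb]
theorem jn_nb {G : SimpleGraph V} {v : V} : Jn G {v} (nb G S v) := by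
  intro a ha b hb
  rw [Finset.mem_singleton] at ha
  rw [ha]; exact (mem_nb.1 hb).2

theorem sing_sub {v : V} (hv : v ∈ S) : ({v} : Finset V) ⊆ S := by simpa using hv

theorem card_split (hc : Cov R B S) {v : V} (hv : v ∈ S) :
    S.card ≤ 1 + (nb R S v).card + (nb B S v).card := by
  have : S ⊆ {v} ∪ nb R S v ∪ nb B S v := by
    intro x hx
    by_cases h : x = v
    · simp [h]
    · have := hc v hv x hx (Ne.symm h)
      simp only [Finset.mem_union, mem_nb]
      tauto
  calc S.card ≤ _ := Finset.card_le_card this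
    _ ≤ _ := (Finset.card_union_le _ _).trans (by
      have := Finset.card_union_le {v} (nb R S v)
      simp only [Finset.card_singleton] at this
      omega)

theorem rec_bd (hc : Cov R B S) (a b : ℕ) (ha : ∀ v ∈ S, (nb R S v).card ≤ a)
    (hb : ∀ v ∈ S, (nb B S v).card ≤ b) : S.card ≤ 1 + a + b := by
  rcases S.eq_empty_or_nonempty with h | ⟨v, hv⟩
  · simp [h]
  · have := card_split hc hv; have := ha v hv; have := hb v hv; omega

theorem nb0 {G : SimpleGraph V} (h : Fr 0 G S) : ∀ v ∈ S, (nb G S v).card ≤ 0 := fun v hv => by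
  rw [jn0 (sing_sub hv) nb_sub jn_nb h (by simp)]; simp
theorem nb1 {G : SimpleGraph V} (h : Fr 1 G S) : ∀ v ∈ S, (nb G S v).card ≤ 1 := fun v hv =>
  jn1 (sing_sub hv) nb_sub jn_nb h (by simp)
theorem nb2 {G : SimpleGraph V} (h : Fr 2 G S) : ∀ v ∈ S, Fr 0 G (nb G S v) := fun v hv =>
  jn2 (sing_sub hv) nb_sub jn_nb h (by simp)
theorem nb3 {G : SimpleGraph V} (h : Fr 3 G S) : ∀ v ∈ S, Fr 1 G (nb G S v) := fun v hv =>
  jn3 (sing_sub hv) nb_sub jn_nb h (by simp)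
theorem nb4 {G : SimpleGraph V} (h : Fr 4 G S) : ∀ v ∈ S, Fr 3 G (nb G S v) := fun v hv =>
  jn4 (sing_sub hv) nb_sub jn_nb h (by simp)

theorem f00 (hc : Cov R B S) (hR : Fr 0 R S) (hB : Fr 0 B S) : S.card ≤ 1 :=
  rec_bd hc 0 0 (nb0 hR) (nb0 hB)
theorem f01 (hc : Cov R B S) (hR : Fr 0 R S) (hB : Fr 1 B S) : S.card ≤ 2 :=
  rec_bd hc 0 1 (nb0 hR) (nb1 hB)
theorem f02 (hc : Cov R B S) (hR : Fr 0 R S) (hB : Fr 2 B S) : S.card ≤ 2 :=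
  rec_bd hc 0 1 (nb0 hR) fun v hv => f00 (hc.mono nb_sub) (hR.mono nb_sub) (nb2 hB v hv)
theorem f03 (hc : Cov R B S) (hR : Fr 0 R S) (hB : Fr 3 B S) : S.card ≤ 3 :=
  rec_bd hc 0 2 (nb0 hR) fun v hv => f01 (hc.mono nb_sub) (hR.mono nb_sub) (nb3 hB v hv)
theorem f04 (hc : Cov R B S) (hR : Fr 0 R S) (hB : Fr 4 B S) : S.card ≤ 4 :=
  rec_bd hc 0 3 (nb0 hR) fun v hv => f03 (hc.mono nb_sub) (hR.mono nb_sub) (nb4 hB v hv)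
theorem f11 (hc : Cov R B S) (hR : Fr 1 R S) (hB : Fr 1 B S) : S.card ≤ 2 := by
  by_contra h
  push Not at h
  obtain ⟨a, ha, b, hb, c, hc', hab, hac, hbc⟩ := Finset.two_lt_card.1 h
  have h1 := hc a ha b hb hab
  have h2 := hc a ha c hc' hac
  have h3 := hc b hb c hc' hbc
  have r1 := hR a ha b hb c hc' hbc
  have r2 := hR b hb a ha c hc' hac
  have r3 := hR c hc' a ha b hb hab
  have b1 := hB a ha b hb c hc' hbc
  have b2 := hB b hb a ha c hc' hac
  have b3 := hB c hc' a ha b hb hab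
  rw [R.adj_comm b a] at r2
  rw [B.adj_comm b a] at b2
  rw [R.adj_comm c a, R.adj_comm c b] at r3
  rw [B.adj_comm c a, B.adj_comm c b] at b3
  tauto
theorem f12 (hc : Cov R B S) (hR : Fr 1 R S) (hB : Fr 2 B S) : S.card ≤ 4 :=
  rec_bd hc 1 2 (nb1 hR) fun v hv => f01 (hc.mono nb_sub).symm (nb2 hB v hv) (hR.mono nb_sub)
theorem f13 (hc : Cov R B S) (hR : Fr 1 R S) (hB : Fr 3 B S) : S.card ≤ 4 :=
  rec_bd hc 1 2 (nb1 hR) fun v hv => f11 (hc.mono nb_sub) (hR.mono nb_sub) (nb3 hB v hv)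
theorem f14 (hc : Cov R B S) (hR : Fr 1 R S) (hB : Fr 4 B S) : S.card ≤ 6 :=
  rec_bd hc 1 4 (nb1 hR) fun v hv => f13 (hc.mono nb_sub) (hR.mono nb_sub) (nb4 hB v hv)
theorem f22 (hc : Cov R B S) (hR : Fr 2 R S) (hB : Fr 2 B S) : S.card ≤ 5 :=
  rec_bd hc 2 2 (fun v hv => f02 (hc.mono nb_sub) (nb2 hR v hv) (hB.mono nb_sub))
    fun v hv => f02 (hc.mono nb_sub).symm (nb2 hB v hv) (hR.mono nb_sub)
theorem f33 (hc : Cov R B S) (hR : Fr 3 R S) (hB : Fr 3 B S) : S.card ≤ 9 :=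
  rec_bd hc 4 4 (fun v hv => f13 (hc.mono nb_sub) (nb3 hR v hv) (hB.mono nb_sub))
    fun v hv => f13 (hc.mono nb_sub).symm (nb3 hB v hv) (hR.mono nb_sub)
theorem f34 (hc : Cov R B S) (hR : Fr 3 R S) (hB : Fr 4 B S) : S.card ≤ 16 :=
  rec_bd hc 6 9 (fun v hv => f14 (hc.mono nb_sub) (nb3 hR v hv) (hB.mono nb_sub))
    fun v hv => f33 (hc.mono nb_sub) (hR.mono nb_sub) (nb4 hB v hv)
end two
end GRP

set_option linter.all false

namespace GRP
open scoped Classical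
variable {V : Type*}
section two
variable {R B : SimpleGraph V} {S : Finset V}

theorem compl_free {t : ℕ} (hc : Cov R B S) (hB : Fr t B S) : Fr t Rᶜ S := by
  refine hB.anti fun x hx y hy h => ?_
  rw [SimpleGraph.compl_adj] at h
  exact (hc x hx y hy h.1).resolve_left h.2

theorem cov_compl (R : SimpleGraph V) (S : Finset V) : Cov R Rᶜ S := by
  intro x _ y _ n
  rw [SimpleGraph.compl_adj]
  tauto

theorem f23 (hc : Cov R B S) (hR : Fr 2 R S) (hB : Fr 3 B S) : S.card ≤ 6 := by
  replace hB := compl_free hc hB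
  replace hc := cov_compl R S
  by_contra hlt
  push Not at hlt
  have hne : S.Nonempty := Finset.card_pos.1 (by omega)
  obtain ⟨v, hv⟩ := hne
  have hs := card_split hc hv
  have h3 : (nb R S v).card ≤ 3 := f03 (hc.mono nb_sub) (nb2 hR v hv) (hB.mono nb_sub)
  have h4 : (nb Rᶜ S v).card ≤ 4 := f12 (hc.mono nb_sub).symm (nb3 hB v hv) (hR.mono nb_sub)
  have hRN := nb2 hR v hv
  have hBN := nb3 hB v hv
  have bl : ∀ {x y : V}, x ≠ y → ¬ R.Adj x y → Rᶜ.Adj x y := fun h h' => by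
    rw [SimpleGraph.compl_adj]; exact ⟨h, h'⟩
  have nbl : ∀ {x y : V}, Rᶜ.Adj x y → ¬ R.Adj x y := fun h => by
    rw [SimpleGraph.compl_adj] at h; exact h.2
  by_cases h : (nb R S v).card = 3
  · obtain ⟨a, ha, b, hb, c, hc', hab, hac, hbc⟩ :=
      Finset.two_lt_card.1 (show 2 < (nb R S v).card by omega)
    obtain ⟨x, hx, y, hy, z, hz, hxy, hxz, hyz⟩ :=
      Finset.two_lt_card.1 (show 2 < (nb Rᶜ S v).card by omega)
    have eab := bl hab (hRN a ha b hb)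
    have eac := bl hac (hRN a ha c hc')
    have ebc := bl hbc (hRN b hb c hc')
    rw [mem_nb] at ha hb hc'
    have key : ∀ u ∈ nb Rᶜ S v, (R.Adj u a ∧ R.Adj u b) ∨ (R.Adj u a ∧ R.Adj u c) ∨
        (R.Adj u b ∧ R.Adj u c) := by
      intro u hu
      rw [mem_nb] at hu
      have nua : u ≠ a := by rintro rfl; exact nbl hu.2 ha.2
      have nub : u ≠ b := by rintro rfl; exact nbl hu.2 hb.2
      have nuc : u ≠ c := by rintro rfl; exact nbl hu.2 hc'.2
      have k1 : R.Adj u a ∨ R.Adj u b := by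
        by_contra hh; push Not at hh
        exact hB a ha.1 b hb.1 c hc'.1 u hu.1 nuc.symm eab eac ebc (bl nua hh.1).symm
          (bl nub hh.2).symm
      have k2 : R.Adj u a ∨ R.Adj u c := by
        by_contra hh; push Not at hh
        exact hB a ha.1 c hc'.1 b hb.1 u hu.1 nub.symm eac eab ebc.symm (bl nua hh.1).symm
          (bl nuc hh.2).symm
      have k3 : R.Adj u b ∨ R.Adj u c := by
        by_contra hh; push Not at hh
        exact hB b hb.1 c hc'.1 a ha.1 u hu.1 nua.symm ebc eab.symm eac.symm (bl nub hh.1).symm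
          (bl nuc hh.2).symm
      tauto
    have nored : ∀ p ∈ nb Rᶜ S v, ∀ q ∈ nb Rᶜ S v, ¬ R.Adj p q := by
      intro p hp q hq e
      have kp := key p hp
      have kq := key q hq
      have ra := hR p (nb_sub hp) q (nb_sub hq) a ha.1 e
      have rb := hR p (nb_sub hp) q (nb_sub hq) b hb.1 e
      have rc := hR p (nb_sub hp) q (nb_sub hq) c hc'.1 e
      tauto
    exact hBN x hx y hy z hz hyz (bl hxy (nored x hx y hy)) (bl hxz (nored x hx z hz))
  · have h2 : 1 < (nb R S v).card := by omega
    obtain ⟨a, ha, -⟩ := Finset.one_lt_card.1 h2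
    have h44 : (nb Rᶜ S v).card = 4 := by omega
    obtain ⟨x, y, z, w, hxy, hxz, hxw, hyz, hyw, hzw, hN⟩ := Finset.card_eq_four.1 h44
    have hx : x ∈ nb Rᶜ S v := by rw [hN]; simp
    have hy : y ∈ nb Rᶜ S v := by rw [hN]; simp
    have hz : z ∈ nb Rᶜ S v := by rw [hN]; simp
    have hw : w ∈ nb Rᶜ S v := by rw [hN]; simp
    clear hN
    -- perfect matching lemma
    have main : ∀ p ∈ nb Rᶜ S v, ∀ q ∈ nb Rᶜ S v, ∀ r ∈ nb Rᶜ S v, ∀ s ∈ nb Rᶜ S v,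
        p ≠ q → p ≠ r → p ≠ s → q ≠ r → q ≠ s → r ≠ s → R.Adj p q → R.Adj p r → False := by
      intro p hp q hq r hr s hs npq npr nps nqr nqs nrs e1 e2
      have e3 : Rᶜ.Adj q r := bl nqr fun e => hR p (nb_sub hp) q (nb_sub hq) r (nb_sub hr) e1 e2 e
      have e4 : R.Adj q s := by
        by_contra hh; exact hBN q hq r hr s hs nrs e3 (bl nqs hh)
      have e5 : R.Adj r s := by
        by_contra hh; exact hBN r hr q hq s hs nqs e3.symm (bl nrs hh)
      have e6 : Rᶜ.Adj p s := bl nps fun e => hR p (nb_sub hp) q (nb_sub hq) s (nb_sub hs) e1 e e4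
      rw [mem_nb] at ha hp hq hr hs
      have na : ∀ u, Rᶜ.Adj v u → a ≠ u := by rintro u hu rfl; exact nbl hu ha.2
      have k1 : R.Adj a p ∨ R.Adj a s := by
        by_contra hh; push Not at hh
        exact hB p hp.1 s hs.1 v hv a ha.1 ha.2.ne e6 hp.2.symm hs.2.symm
          (bl (na _ hp.2) hh.1).symm (bl (na _ hs.2) hh.2).symm
      have k2 : R.Adj a q ∨ R.Adj a r := by
        by_contra hh; push Not at hh
        exact hB q hq.1 r hr.1 v hv a ha.1 ha.2.ne e3 hq.2.symm hr.2.symm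
          (bl (na _ hq.2) hh.1).symm (bl (na _ hr.2) hh.2).symm
      have t1 := hR a ha.1 p hp.1 q hq.1
      have t2 := hR a ha.1 p hp.1 r hr.1
      have t3 := hR a ha.1 s hs.1 q hq.1
      have t4 := hR a ha.1 s hs.1 r hr.1
      rcases k1 with k1 | k1 <;> rcases k2 with k2 | k2
      · exact t1 k1 k2 e1
      · exact t2 k1 k2 e2
      · exact t3 k1 k2 e4.symm
      · exact t4 k1 k2 e5.symm
    by_cases e1 : R.Adj x y
    · by_cases e2 : R.Adj x z
      · exact main x hx y hy z hz w hw hxy hxz hxw hyz hyw hzw e1 e2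
      · by_cases e3 : R.Adj x w
        · exact main x hx y hy w hw z hz hxy hxw hxz hyw hyz hzw.symm e1 e3
        · exact hBN x hx z hz w hw hzw (bl hxz e2) (bl hxw e3)
    · by_cases e2 : R.Adj x z
      · by_cases e3 : R.Adj x w
        · exact main x hx z hz w hw y hy hxz hxw hxy hzw hyz.symm hyw.symm e2 e3
        · exact hBN x hx y hy w hw hyw (bl hxy e1) (bl hxw e3)
      · exact hBN x hx y hy z hz hyz (bl hxy e1) (bl hxz e2)

theorem f24 (hc : Cov R B S) (hR : Fr 2 R S) (hB : Fr 4 B S) : S.card ≤ 11 :=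
  rec_bd hc 4 6 (fun v hv => f04 (hc.mono nb_sub) (nb2 hR v hv) (hB.mono nb_sub))
    fun v hv => f23 (hc.mono nb_sub) (hR.mono nb_sub) (nb4 hB v hv)

/-- K4-free -/
def K4F (G : SimpleGraph V) (S : Finset V) : Prop :=
  ∀ x ∈ S, ∀ y ∈ S, ∀ z ∈ S, ∀ w ∈ S, G.Adj x y → G.Adj x z → G.Adj x w → G.Adj y z →
    G.Adj y w → G.Adj z w → False

theorem K4F.mono {G : SimpleGraph V} {T : Finset V} (h : K4F G S) (hT : T ⊆ S) : K4F G T :=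
  fun x hx y hy z hz w hw => h x (hT hx) y (hT hy) z (hT hz) w (hT hw)

theorem K4F.nb {G : SimpleGraph V} (h : K4F G S) : ∀ v ∈ S, Fr 2 G (nb G S v) := by
  intro v hv x hx y hy z hz a b c
  rw [mem_nb] at hx hy hz
  exact h v hv x hx.1 y hy.1 z hz.1 hx.2 hy.2 hz.2 a b c

theorem even_deg (G : SimpleGraph V) (S : Finset V) : Even (∑ v ∈ S, (nb G S v).card) := by
  have h : (∑ p ∈ (S ×ˢ S).filter (fun p => G.Adj p.1 p.2), (1 : ZMod 2)) = 0 := by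
    refine Finset.sum_involution (fun p _ => (p.2, p.1)) ?_ ?_ ?_ ?_
    · intro a ha; decide
    · rintro ⟨a, b⟩ ha _ h
      simp only [Finset.mem_filter] at ha
      simp only [Prod.mk.injEq] at h
      exact ha.2.ne h.2
    · rintro ⟨a, b⟩ ha
      simp only [Finset.mem_filter, Finset.mem_product] at ha ⊢
      exact ⟨⟨ha.1.2, ha.1.1⟩, ha.2.symm⟩
    · intros; rfl
  have h2 : ((S ×ˢ S).filter (fun p => G.Adj p.1 p.2)).card = ∑ v ∈ S, (nb G S v).card := by
    simp only [Finset.card_filter, Finset.sum_product, nb]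
  rw [← h2]
  rw [Finset.sum_const, nsmul_eq_mul, mul_one, ZMod.natCast_eq_zero_iff] at h
  exact even_iff_two_dvd.2 h

theorem k04 (hc : Cov R B S) (hR : Fr 0 R S) (hB : K4F B S) : S.card ≤ 3 :=
  rec_bd hc 0 2 (nb0 hR) fun v hv => f02 (hc.mono nb_sub) (hR.mono nb_sub) (hB.nb v hv)

theorem k34 (hc : Cov R B S) (hR : Fr 2 R S) (hB : K4F B S) : S.card ≤ 8 := by
  have h1 : ∀ v ∈ S, (nb R S v).card ≤ 3 := fun v hv =>
    k04 (hc.mono nb_sub) (nb2 hR v hv) (hB.mono nb_sub)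
  have h2 : ∀ v ∈ S, (nb B S v).card ≤ 5 := fun v hv =>
    f22 (hc.mono nb_sub) (hR.mono nb_sub) (hB.nb v hv)
  have h3 := rec_bd hc 3 5 h1 h2
  by_contra h
  have h9 : S.card = 9 := by omega
  have : ∀ v ∈ S, (nb R S v).card = 3 := fun v hv => by
    have := h1 v hv; have := h2 v hv; have := card_split hc hv; omega
  have he := even_deg R S
  rw [Finset.sum_congr rfl this] at he
  simp [h9] at he
  revert he; decide

theorem k44 (hc : Cov R B S) (hR : K4F R S) (hB : K4F B S) : S.card ≤ 17 :=
  rec_bd hc 8 8 (fun v hv => k34 (hc.mono nb_sub) (hR.nb v hv) (hB.mono nb_sub))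
    fun v hv => k34 (hc.mono nb_sub).symm (hB.nb v hv) (hR.mono nb_sub)
end two
end GRP

set_option linter.all false

namespace GRP
open scoped Classical
variable {V : Type*} {K : Type*}

/-- no rainbow triangle -/
def Gal (c : V → V → K) : Prop := ∀ u v w, u ≠ v → u ≠ w → v ≠ w →
  c u v = c u w ∨ c u v = c v w ∨ c u w = c v w

/-- the graph of colour d on S -/
def cg (c : V → V → K) (hs : ∀ x y, c x y = c y x) (d : K) (S : Finset V) : SimpleGraph V where
  Adj x y := x ≠ y ∧ x ∈ S ∧ y ∈ S ∧ c x y = d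
  symm := ⟨fun x y h => ⟨h.1.symm, h.2.2.1, h.2.1, (hs y x).trans h.2.2.2⟩⟩
  loopless := ⟨fun x h => h.1 rfl⟩

section
variable {c : V → V → K} (hs : ∀ x y, c x y = c y x)

def Disc (c : V → V → K) (d : K) (S : Finset V) : Prop :=
  ∃ A : Finset V, A ⊆ S ∧ A.Nonempty ∧ (S \ A).Nonempty ∧ ∀ a ∈ A, ∀ b ∈ S \ A, c a b ≠ d

theorem cg_reach_mem {d : K} {S : Finset V} {x y : V} (h : (cg c hs d S).Reachable x y) (hx : x ∈ S) :
    y ∈ S := by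
  rw [SimpleGraph.reachable_iff_reflTransGen] at h
  induction h with
  | refl => exact hx
  | tail _ h2 _ => exact h2.2.2.1

theorem cg_hom (hg : Gal c) {d : K} {S : Finset V} {x y t : V} (h : (cg c hs d S).Reachable x y)
    (hx : x ∈ S) (ht : t ∈ S) (hn : ¬ (cg c hs d S).Reachable x t) : c x t = c y t := by
  rw [SimpleGraph.reachable_iff_reflTransGen] at h
  induction h with
  | refl => rfl
  | @tail b e h1 h2 ih =>
    rw [ih]
    have hb : (cg c hs d S).Reachable x b := by
      rw [SimpleGraph.reachable_iff_reflTransGen]; exact h1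
    have he : (cg c hs d S).Reachable x e := hb.trans h2.reachable
    have hbt : b ≠ t := by rintro rfl; exact hn hb
    have het : e ≠ t := by rintro rfl; exact hn he
    have c1 : c b t ≠ d := fun h => hn (hb.trans
      (SimpleGraph.Adj.reachable (show (cg c hs d S).Adj b t from ⟨hbt, h2.2.1, ht, h⟩)))
    have c2 : c e t ≠ d := fun h => hn (he.trans
      (SimpleGraph.Adj.reachable (show (cg c hs d S).Adj e t from ⟨het, h2.2.2.1, ht, h⟩)))
    rcases hg b e t h2.1 hbt het with h | h | h
    · exact absurd (h.symm.trans h2.2.2.2) c1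
    · exact absurd (h.symm.trans h2.2.2.2) c2
    · exact h

theorem disc_reach {d : K} {S : Finset V} (h : Disc c d S) :
    ∃ a ∈ S, ∃ b ∈ S, ¬ (cg c hs d S).Reachable a b := by
  obtain ⟨A, hA, ⟨a, ha⟩, ⟨b, hb⟩, h⟩ := h
  refine ⟨a, hA ha, b, (Finset.mem_sdiff.1 hb).1, fun hr => ?_⟩
  have : b ∈ A := by
    rw [SimpleGraph.reachable_iff_reflTransGen] at hr
    clear hb
    induction hr with
    | refl => exact ha
    | @tail y z _ h2 ih =>
      by_contra hz
      exact h y ih z (Finset.mem_sdiff.2 ⟨h2.2.2.1, hz⟩) h2.2.2.2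
  exact (Finset.mem_sdiff.1 hb).2 this

include hs in
theorem gallai_L (hg : Gal c) (S : Finset V) (hS : S.Nonempty) :
    (∃ r b, ∀ x ∈ S, ∀ y ∈ S, x ≠ y → c x y = r ∨ c x y = b) ∨
    ∃ d, (∃ x ∈ S, ∃ y ∈ S, x ≠ y ∧ c x y = d) ∧ Disc c d S := by
  induction hS using Finset.Nonempty.cons_induction with
  | singleton a => exact Or.inl ⟨c a a, c a a, by simp⟩
  | cons v S' hv hS' ih =>
    rw [Finset.cons_eq_insert]
    have discv : ∀ f, (∀ x ∈ S', c v x ≠ f) → Disc c f (insert v S') := by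
      intro f hf
      refine ⟨{v}, by simp, by simp, ?_, ?_⟩
      · obtain ⟨y, hy⟩ := hS'
        refine ⟨y, ?_⟩
        have : y ≠ v := by rintro rfl; exact hv hy
        simp [hy, this]
      · intro a ha b hb
        simp only [Finset.mem_singleton] at ha
        simp only [Finset.mem_sdiff, Finset.mem_insert, Finset.mem_singleton] at hb
        rw [ha]; exact hf b (hb.1.resolve_left hb.2)
    rcases ih with ⟨r, b, h⟩ | ⟨d, hu, hd⟩
    · by_cases hv2 : ∀ x ∈ S', c v x = r ∨ c v x = b
      · left
        refine ⟨r, b, fun x hx y hy n => ?_⟩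
        rw [Finset.mem_insert] at hx hy
        rcases hx with rfl | hx <;> rcases hy with rfl | hy
        · exact absurd rfl n
        · exact hv2 y hy
        · rw [hs]; exact hv2 x hx
        · exact h x hx y hy n
      push Not at hv2
      obtain ⟨x, hx, hr, hb⟩ := hv2
      have hvx : v ≠ x := by rintro rfl; exact hv hx
      by_cases hall : ∀ y ∈ S', c v y = c v x
      · by_cases h2 : ∃ y ∈ S', ∃ z ∈ S', y ≠ z
        · right
          obtain ⟨y, hy, z, hz, n⟩ := h2
          refine ⟨c y z, ⟨y, by simp [hy], z, by simp [hz], n, rfl⟩, discv _ ?_⟩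
          intro w hw e
          rw [hall w hw] at e
          rcases h y hy z hz n with h | h <;> rw [h] at e <;> contradiction
        · left
          push Not at h2
          refine ⟨c v x, c v x, fun p hp q hq n => ?_⟩
          rw [Finset.mem_insert] at hp hq
          rcases hp with rfl | hp <;> rcases hq with rfl | hq
          · exact absurd rfl n
          · exact Or.inl (hall q hq)
          · rw [hs]; exact Or.inl (hall p hp)
          · exact absurd (h2 p hp q hq) n
      · right
        push Not at hall
        obtain ⟨y, hy, hyx⟩ := hall
        refine ⟨c v x, ⟨v, by simp, x, by simp [hx], hvx, rfl⟩, {y}, by simp [hy], by simp,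
          ⟨v, ?_⟩, ?_⟩
        · have : v ≠ y := by rintro rfl; exact hv hy
          simp [this]
        · intro a ha e he
          simp only [Finset.mem_singleton] at ha
          simp only [Finset.mem_sdiff, Finset.mem_insert, Finset.mem_singleton] at he
          rw [ha]
          rcases he.1 with h' | h'
          · rw [h', hs]; exact hyx
          · intro e'
            rcases h y hy e h' (Ne.symm he.2) with h'' | h'' <;> rw [h''] at e'
            · exact hr e'.symm
            · exact hb e'.symm
    · by_cases hD : Disc c d (insert v S')
      · right
        obtain ⟨x, hx, y, hy, n, e⟩ := hu
        exact ⟨d, ⟨x, by simp [hx], y, by simp [hy], n, e⟩, hD⟩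
      -- v has a d-edge to each component
      set H := cg c hs d S' with hH
      have hcomp : ∀ x ∈ S', ∃ y ∈ S', H.Reachable x y ∧ c v y = d := by
        intro x hx
        by_contra hno
        push Not at hno
        apply hD
        refine ⟨S'.filter (H.Reachable x), ?_, ⟨x, by simp [hx]⟩, ⟨v, by simp [hv]⟩, ?_⟩
        · intro y hy; simp at hy; simp [hy.1]
        · intro a ha b hb e
          simp only [Finset.mem_filter] at ha
          simp only [Finset.mem_sdiff, Finset.mem_insert, Finset.mem_filter, not_and] at hb
          rcases hb.1 with rfl | hb1
          · exact hno a ha.1 ha.2 (by rw [hs]; exact e)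
          · have nn : a ≠ b := by rintro rfl; exact hb.2 hb1 ha.2
            exact hb.2 hb1 (ha.2.trans (SimpleGraph.Adj.reachable
              (show H.Adj a b from ⟨nn, ha.1, hb1, e⟩)))
      have hcol : ∀ x ∈ S', ∀ z ∈ S', ¬ H.Reachable x z → c v x ≠ d → c v x = c x z := by
        intro x hx z hz hr hne
        obtain ⟨y, hy, hzy, hvy⟩ := hcomp z hz
        have hxy : ¬ H.Reachable x y := fun h => hr (h.trans hzy.symm)
        have nxy : x ≠ y := by rintro rfl; exact hxy (SimpleGraph.Reachable.refl _)
        have nvx : v ≠ x := by rintro rfl; exact hv hx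
        have nvy : v ≠ y := by rintro rfl; exact hv hy
        have e1 : c x y ≠ d := fun e => hxy (SimpleGraph.Adj.reachable
              (show H.Adj x y from ⟨nxy, hx, hy, e⟩))
        have e2 : c z x = c y x := cg_hom hs hg hzy hz hx (fun h => hr h.symm)
        rw [hs x z, e2, hs y x]
        rcases hg v x y nvx nvy nxy with h | h | h
        · exact absurd (h.trans hvy) hne
        · exact h
        · exact absurd (h.symm.trans hvy) e1
      have hsame : ∀ x ∈ S', ∀ x' ∈ S', c v x ≠ d → c v x' ≠ d → c v x = c v x' := by
        intro x hx x' hx' h1 h2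
        by_cases hr : H.Reachable x x'
        · obtain ⟨a, ha, b, hb, hab⟩ := disc_reach hs hd
          have : ∃ z ∈ S', ¬ H.Reachable x z := by
            by_contra hno
            push Not at hno
            exact hab ((hno a ha).symm.trans (hno b hb))
          obtain ⟨z, hz, hxz⟩ := this
          have hx'z : ¬ H.Reachable x' z := fun h => hxz (hr.trans h)
          rw [hcol x hx z hz hxz h1, hcol x' hx' z hz hx'z h2]
          exact cg_hom hs hg hr hx hz hxz
        · rw [hcol x hx x' hx' hr h1, hcol x' hx' x hx (fun h => hr h.symm) h2, hs]
      by_cases hex : ∃ x ∈ S', c v x ≠ d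
      · obtain ⟨x, hx, hxd⟩ := hex
        by_cases h3 : ∀ p ∈ insert v S', ∀ q ∈ insert v S', p ≠ q → c p q = d ∨ c p q = c v x
        · exact Or.inl ⟨_, _, h3⟩
        · right
          push Not at h3
          obtain ⟨p, hp, q, hq, n, h1, h2⟩ := h3
          refine ⟨c p q, ⟨p, hp, q, hq, n, rfl⟩, discv _ ?_⟩
          intro w hw e
          by_cases hwd : c v w = d
          · exact h1 (e.symm.trans hwd)
          · exact h2 (e.symm.trans (hsame w hw x hx hwd hxd))
      · push Not at hex
        by_cases h3 : ∀ p ∈ insert v S', ∀ q ∈ insert v S', p ≠ q → c p q = d ∨ c p q = d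
        · exact Or.inl ⟨_, _, h3⟩
        · right
          push Not at h3
          obtain ⟨p, hp, q, hq, n, h1, h2⟩ := h3
          refine ⟨c p q, ⟨p, hp, q, hq, n, rfl⟩, discv _ ?_⟩
          intro w hw e
          exact h1 (e.symm.trans (hex w hw))

/-- homogeneous partition with representatives -/
structure HP (c : V → V → K) (S : Finset V) (p : V → V) : Prop where
  mem : ∀ x ∈ S, p x ∈ S
  idem : ∀ x ∈ S, p (p x) = p x
  hom : ∀ x ∈ S, ∀ y ∈ S, p x ≠ p y → c x y = c (p x) (p y)
  two : 2 ≤ (S.image p).card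

include hs in
theorem gallai_partition (hg : Gal c) (S : Finset V) (hS : 2 ≤ S.card) :
    ∃ p, HP c S p ∧ ∃ r b, ∀ x ∈ S.image p, ∀ y ∈ S.image p, x ≠ y → c x y = r ∨ c x y = b := by
  have hex : ∃ n, ∃ p, HP c S p ∧ (S.image p).card = n :=
    ⟨_, id, ⟨fun x hx => hx, fun x _ => rfl, fun _ _ _ _ _ => rfl, by simpa using hS⟩, rfl⟩
  obtain ⟨p, hp, hpn⟩ := Nat.find_spec hex
  have hmin : ∀ p', HP c S p' → (S.image p).card ≤ (S.image p').card := by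
    intro p' hp'
    rw [hpn]
    exact Nat.find_min' hex ⟨p', hp', rfl⟩
  refine ⟨p, hp, ?_⟩
  have hT : (S.image p).Nonempty := Finset.card_pos.1 (by have := hp.two; omega)
  rcases gallai_L hs hg (S.image p) hT with h | ⟨d, ⟨x, hx, y, hy, n, e⟩, hd⟩
  · exact h
  exfalso
  set T := S.image p with hTdef
  set H := cg c hs d T with hH
  set q : V → V := fun x => Quot.out (H.connectedComponentMk x) with hq
  have hqr : ∀ x, H.Reachable (q x) x := fun x => by
    apply SimpleGraph.ConnectedComponent.exact
    exact Quot.out_eq _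
  have hqe : ∀ x y, H.Reachable x y → q x = q y := fun x y h => by
    simp only [hq]
    rw [SimpleGraph.ConnectedComponent.sound h]
  have hqm : ∀ x ∈ T, q x ∈ T := fun x hx => cg_reach_mem hs (hqr x).symm hx
  have hTS : T ⊆ S := by
    intro x hx
    obtain ⟨y, hy, rfl⟩ := Finset.mem_image.1 hx
    exact hp.mem y hy
  have hpT : ∀ x ∈ S, p x ∈ T := fun x hx => Finset.mem_image_of_mem _ hx
  have hpid : ∀ x ∈ T, p x = x := by
    intro x hx
    obtain ⟨y, hy, rfl⟩ := Finset.mem_image.1 hx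
    exact hp.idem y hy
  have himg : S.image (q ∘ p) = T.image q := by rw [← Finset.image_image]
  have hnew : HP c S (q ∘ p) := by
    refine ⟨fun x hx => hTS (hqm _ (hpT x hx)), fun x hx => ?_, fun x hx y hy hn => ?_, ?_⟩
    · simp only [Function.comp]
      rw [hpid _ (hqm _ (hpT x hx))]
      exact hqe _ _ (hqr _)
    · simp only [Function.comp] at hn ⊢
      have hn' : p x ≠ p y := fun h => hn (by rw [h])
      rw [hp.hom x hx y hy hn']
      have hnr : ¬ H.Reachable (p x) (p y) := fun h => hn (hqe _ _ h)
      have e1 : c (p x) (p y) = c (q (p x)) (p y) :=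
        cg_hom hs hg (hqr _).symm (hpT x hx) (hpT y hy) hnr
      have e2 : c (p y) (q (p x)) = c (q (p y)) (q (p x)) :=
        cg_hom hs hg (hqr _).symm (hpT y hy) (hqm _ (hpT x hx))
          (fun h => hnr (h.trans (hqr _)).symm)
      rw [e1, hs, e2, hs]
    · rw [himg]
      obtain ⟨a, ha, b, hb, hab⟩ := disc_reach hs hd
      have : 1 < (T.image q).card := Finset.one_lt_card.2 ⟨q a, Finset.mem_image_of_mem _ ha, q b,
        Finset.mem_image_of_mem _ hb, fun h => hab ((hqr a).symm.trans (h ▸ hqr b))⟩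
      omega
  have hlt : (T.image q).card < T.card := by
    refine lt_of_le_of_ne Finset.card_image_le fun heq => ?_
    have hinj := Finset.card_image_iff.1 heq
    exact n (hinj hx hy (hqe _ _ (SimpleGraph.Adj.reachable
      (show H.Adj x y from ⟨n, hx, hy, e⟩))))
  have := hmin _ hnew
  rw [himg] at this
  omega
end
end GRP

set_option linter.all false
namespace GRP

/-! Verified enumeration engine on bit masks. -/
def am1 (p : ℕ) : Bool := Nat.beq (Nat.land p (Nat.sub p 1)) 0

def okR (Ed I3 : List ℕ) (S m : ℕ) : Bool :=
  am1 (Nat.land S m) &&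
  ((Nat.beq (Nat.land S m) 0 || Ed.all fun E => (Nat.beq (Nat.land E (Nat.land S m)) 0 ||
      !(Nat.beq (Nat.land E (Nat.lor S m)) E))) &&
   I3.all fun T => !(Nat.beq (Nat.land T (Nat.lor S m)) 0))

def okB (Ed I3 N3 : List ℕ) (S m : ℕ) : Bool :=
  (Ed.all fun E => !(Nat.beq (Nat.land E (Nat.land S m)) E)) &&
  ((N3.all fun T => !(Nat.beq (Nat.land T (Nat.lor S m)) 0)) &&
   I3.all fun T => !(Nat.beq (Nat.land T (Nat.land S m)) 0 && am1 (Nat.land T (Nat.lor S m))))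

structure St where
  k : ℕ
  bit : ℕ
  pw : List ℕ
  Ed : List ℕ
  Ne : List ℕ
  I3 : List ℕ
  N3 : List ℕ
  C : List ℕ

def stepC (s : St) (S : ℕ) (m : ℕ) : List ℕ :=
  (bif okB s.Ed s.I3 s.N3 S m then [m] else []) ++
  (bif okR s.Ed s.I3 S m then [Nat.lor m s.bit] else [])

def step (s : St) (S : ℕ) (f : ℕ → Bool) : St where
  k := s.k + 1
  bit := Nat.mul 2 s.bit
  pw := s.bit :: s.pw
  Ed := ((s.pw.filter fun p => !(Nat.beq (Nat.land p S) 0)).map (Nat.lor s.bit)) ++ s.Ed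
  Ne := ((s.pw.filter fun p => (Nat.beq (Nat.land p S) 0)).map (Nat.lor s.bit)) ++ s.Ne
  I3 := ((s.Ne.filter fun p => (Nat.beq (Nat.land p S) 0)).map (Nat.lor s.bit)) ++ s.I3
  N3 := ((s.Ne.filter fun p => !(Nat.beq (Nat.land p S) 0) && !(Nat.beq (Nat.land p S) p)).map
          (Nat.lor s.bit)) ++
        (((s.Ed.filter fun p => (Nat.beq (Nat.land p S) 0)).map (Nat.lor s.bit)) ++ s.N3)
  C := (s.C.filter f).flatMap (stepC s S)

def popc : ℕ → ℕ → ℕ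
  | 0, _ => 0
  | n+1, m => Nat.add (Nat.land m 1) (popc n (Nat.shiftRight m 1))

def search (per PM : ℕ) : ℕ → ℕ → ℕ → St → List ℕ → List (List ℕ)
  | 0, _, need2, _, rows => bif Nat.beq need2 0 then [rows] else []
  | rem+1, need, need2, s, rows =>
    bif Nat.ble need (Nat.mul (rem+1) per) then
      s.C.flatMap fun S => search per PM rem (Nat.sub need (popc 7 (Nat.land S PM)))
        (Nat.sub need2 (popc 12 S)) (step s S fun m => Nat.ble (Nat.land S PM) (Nat.land m PM)) (S :: rows)
    else []

def st0 : St := ⟨1, 2, [1], [], [], [], [], [0]⟩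
def force (s : St) (rows : List ℕ) : St := rows.foldl (fun s S => step s S fun _ => true) s
end GRP

set_option linter.all false
namespace GRP
open scoped Classical

theorem land_tb (a b n : ℕ) : (Nat.land a b).testBit n = (a.testBit n && b.testBit n) := Nat.testBit_and a b n
theorem lor_tb (a b n : ℕ) : (Nat.lor a b).testBit n = (a.testBit n || b.testBit n) := Nat.testBit_or a b n

theorem land0 {T S : ℕ} (h : Nat.beq (Nat.land T S) 0 = true) {n : ℕ} (hn : T.testBit n = true) :
    S.testBit n = false := by
  have h1 := Nat.eq_of_beq_eq_true h
  have h2 := land_tb T S n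
  rw [h1, hn] at h2
  simpa using h2.symm
theorem landT {T S : ℕ} (h : Nat.beq (Nat.land T S) T = true) {n : ℕ} (hn : T.testBit n = true) :
    S.testBit n = true := by
  have h1 := Nat.eq_of_beq_eq_true h
  have h2 := land_tb T S n
  rw [h1, hn] at h2
  simpa using h2.symm
theorem landne {T S : ℕ} (h : Nat.beq (Nat.land T S) 0 = false) :
    ∃ n, T.testBit n = true ∧ S.testBit n = true := by
  by_contra hc
  push Not at hc
  have h1 := Nat.ne_of_beq_eq_false h
  apply h1
  apply Nat.eq_of_testBit_eq
  intro i
  rw [land_tb]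
  have := hc i
  cases h2 : T.testBit i <;> cases h3 : S.testBit i <;> simp_all
theorem landnT {T S : ℕ} (h : Nat.beq (Nat.land T S) T = false) :
    ∃ n, T.testBit n = true ∧ S.testBit n = false := by
  by_contra hc
  push Not at hc
  have h1 := Nat.ne_of_beq_eq_false h
  apply h1
  apply Nat.eq_of_testBit_eq
  intro i
  rw [land_tb]
  have := hc i
  cases h2 : T.testBit i <;> cases h3 : S.testBit i <;> simp_all

theorem am1T_aux {p i j : ℕ} (h : Nat.land p (p-1) = 0) (hi : p.testBit i = true)
    (hj : p.testBit j = true) (hij : i < j) : False := by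
  have h2 := land_tb p (p-1) j
  rw [h, hj] at h2
  simp at h2
  have h3 : (p % 2^j).testBit i = true := by rw [Nat.testBit_mod_two_pow]; simp [hij, hi]
  have h4 : p % 2^j ≠ 0 := by intro h0; rw [h0] at h3; simp at h3
  have h5 : (p-1) / 2^j = p / 2^j := by
    have h6 := Nat.div_add_mod p (2^j)
    have h7 := Nat.mod_lt p (show 0 < 2^j by positivity)
    have h8 : p - 1 = 2^j * (p/2^j) + (p % 2^j - 1) := by omega
    rw [h8, Nat.mul_add_div (by positivity), Nat.div_eq_of_lt (a := p % 2^j - 1) (by omega)]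
    omega
  rw [Nat.testBit_eq_decide_div_mod_eq, h5, ← Nat.testBit_eq_decide_div_mod_eq, hj] at h2
  simp at h2

theorem am1T {p i j : ℕ} (h : am1 p = true) (hi : p.testBit i = true)
    (hj : p.testBit j = true) : i = j := by
  have h1 : Nat.land p (p-1) = 0 := Nat.eq_of_beq_eq_true h
  rcases lt_trichotomy i j with h2 | h2 | h2
  · exact (am1T_aux h1 hi hj h2).elim
  · exact h2
  · exact (am1T_aux h1 hj hi h2).elim

theorem am1F {p : ℕ} (h : am1 p = false) : ∃ i j, i ≠ j ∧ p.testBit i = true ∧ p.testBit j = true := by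
  have h1 : Nat.land p (p-1) ≠ 0 := Nat.ne_of_beq_eq_false h
  by_contra hc
  push Not at hc
  apply h1
  by_cases hp : p = 0
  · subst hp; rfl
  obtain ⟨i, hi⟩ := Nat.exists_testBit_of_ne_zero hp
  have h2 : p = 2^i := by
    apply Nat.eq_of_testBit_eq
    intro j
    rw [Nat.testBit_two_pow]
    by_cases hij : i = j
    · subst hij; simp [hi]
    · simp [hij]; have := hc i j hij hi; simpa using this
  have h3 : p &&& (p-1) = 0 := by rw [h2, Nat.and_two_pow_sub_one_eq_mod]; simp
  exact h3

/-- complement relation -/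
def nb' (a : ℕ → ℕ → Prop) (i j : ℕ) : Prop := i ≠ j ∧ ¬ a i j

structure Adm (a : ℕ → ℕ → Prop) (N : ℕ) : Prop where
  symm : ∀ i j, a i j → a j i
  irr : ∀ i, ¬ a i i
  r3 : ∀ x < N, ∀ y < N, ∀ z < N, ∀ w < N, z ≠ w → a x y → a x z → a y z → a x w → a y w → False
  b4 : ∀ x < N, ∀ y < N, ∀ z < N, ∀ p < N, ∀ q < N, p ≠ q → nb' a x y → nb' a x z → nb' a y z →
    nb' a x p → nb' a y p → nb' a z p → nb' a x q → nb' a y q → nb' a z q → False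

noncomputable def M (a : ℕ → ℕ → Prop) (j : ℕ) : ℕ → ℕ
  | 0 => 0
  | k+1 => if a k j then Nat.lor (M a j k) (2^k) else M a j k

theorem M_tb (a : ℕ → ℕ → Prop) (j k i : ℕ) : (M a j k).testBit i = true ↔ i < k ∧ a i j := by
  induction k with
  | zero => simp [M]
  | succ k ih =>
    unfold M
    split_ifs with h
    · rw [lor_tb, Bool.or_eq_true, ih, Nat.testBit_two_pow]
      constructor
      · rintro (⟨h1, h2⟩ | h1)
        · exact ⟨by omega, h2⟩
        · have : k = i := by simpa using h1
          subst this; exact ⟨by omega, h⟩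
      · rintro ⟨h1, h2⟩
        by_cases hik : k = i
        · right; simp [hik]
        · left; exact ⟨by omega, h2⟩
    · rw [ih]
      constructor
      · rintro ⟨h1, h2⟩; exact ⟨by omega, h2⟩
      · rintro ⟨h1, h2⟩
        refine ⟨?_, h2⟩
        have : i ≠ k := by rintro rfl; exact h h2
        omega

theorem M_tbf (a : ℕ → ℕ → Prop) {j k i : ℕ} (h : (M a j k).testBit i = false) (hi : i < k) : ¬ a i j := by
  intro h1
  rw [(M_tb a j k i).2 ⟨hi, h1⟩] at h
  exact absurd h (by simp)

structure Inv (a : ℕ → ℕ → Prop) (s : St) : Prop where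
  bit : s.bit = 2^s.k
  pw : ∀ p ∈ s.pw, ∃ i < s.k, ∀ n, p.testBit n = true ↔ n = i
  Ed : ∀ p ∈ s.Ed, ∃ i < s.k, ∃ j < s.k, a i j ∧ ∀ n, p.testBit n = true ↔ n = i ∨ n = j
  Ne : ∀ p ∈ s.Ne, ∃ i < s.k, ∃ j < s.k, nb' a i j ∧ ∀ n, p.testBit n = true ↔ n = i ∨ n = j
  I3 : ∀ p ∈ s.I3, ∃ x < s.k, ∃ y < s.k, ∃ z < s.k, nb' a x y ∧ nb' a x z ∧ nb' a y z ∧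
    ∀ n, p.testBit n = true ↔ n = x ∨ n = y ∨ n = z
  N3 : ∀ p ∈ s.N3, ∃ x < s.k, ∃ y < s.k, ∃ z < s.k, a x y ∧ nb' a x z ∧ nb' a y z ∧
    ∀ n, p.testBit n = true ↔ n = x ∨ n = y ∨ n = z

variable {a : ℕ → ℕ → Prop} {N : ℕ}

theorem Adm.bs (h : Adm a N) {i j : ℕ} (hb : nb' a i j) : nb' a j i :=
  ⟨hb.1.symm, fun h1 => hb.2 (h.symm _ _ h1)⟩

theorem okR_sound (A : Adm a N) {s : St} (I : Inv a s) {j : ℕ} (hkj : s.k < j) (hj : j < N)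
    (h : a s.k j) : okR s.Ed s.I3 (M a s.k s.k) (M a j s.k) = true := by
  have ht : ∀ n, (Nat.land (M a s.k s.k) (M a j s.k)).testBit n = true →
      n < s.k ∧ a n s.k ∧ a n j := by
    intro n hn
    rw [land_tb, Bool.and_eq_true, M_tb, M_tb] at hn
    exact ⟨hn.1.1, hn.1.2, hn.2.2⟩
  have ho : ∀ n, (Nat.lor (M a s.k s.k) (M a j s.k)).testBit n = true →
      n < s.k ∧ (a n s.k ∨ a n j) := by
    intro n hn
    rw [lor_tb, Bool.or_eq_true, M_tb, M_tb] at hn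
    tauto
  have hof : ∀ n, n < s.k → (Nat.lor (M a s.k s.k) (M a j s.k)).testBit n = false →
      nb' a n s.k ∧ nb' a n j := by
    intro n hk hn
    rw [lor_tb, Bool.or_eq_false_iff] at hn
    exact ⟨⟨by omega, M_tbf a hn.1 hk⟩, ⟨by omega, M_tbf a hn.2 hk⟩⟩
  unfold okR
  rw [Bool.and_eq_true, Bool.and_eq_true, Bool.or_eq_true, List.all_eq_true, List.all_eq_true]
  refine ⟨?_, Or.inr ?_, ?_⟩
  · by_contra hc
    rw [Bool.not_eq_true] at hc
    obtain ⟨x, y, hxy, hx, hy⟩ := am1F hc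
    obtain ⟨hx1, hx2, hx3⟩ := ht x hx
    obtain ⟨hy1, hy2, hy3⟩ := ht y hy
    exact A.r3 s.k (by omega) j hj x (by omega) y (by omega) hxy h (A.symm _ _ hx2) (A.symm _ _ hx3)
      (A.symm _ _ hy2) (A.symm _ _ hy3)
  · intro E hE
    obtain ⟨x, hx, y, hy, hxy, hb⟩ := I.Ed E hE
    by_contra hc
    simp only [Bool.or_eq_true, not_or, Bool.not_eq_true, Bool.not_eq_false'] at hc
    obtain ⟨n, hn1, hn2⟩ := landne hc.1
    have hxx := ho x (landT hc.2 ((hb x).2 (Or.inl rfl)))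
    have hyy := ho y (landT hc.2 ((hb y).2 (Or.inr rfl)))
    obtain ⟨hn3, hn4, hn5⟩ := ht n hn2
    have key : ∀ x y, x < s.k → y < s.k → a x y → a x s.k → a x j → (a y s.k ∨ a y j) → False := by
      intro x y hx hy hxy h1 h2 h3
      rcases h3 with h3 | h3
      · exact A.r3 x (by omega) s.k (by omega) j hj y (by omega) (by omega) h1 h2 h hxy (A.symm _ _ h3)
      · exact A.r3 x (by omega) j (by omega) s.k (by omega) y (by omega) (by omega) h2 h1 (A.symm _ _ h) hxy (A.symm _ _ h3)
    rcases (hb n).1 hn1 with e | e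
    · subst e; exact key n y hx hy hxy hn4 hn5 hyy.2
    · subst e; exact key n x hy hx (A.symm _ _ hxy) hn4 hn5 hxx.2
  · intro T hT
    obtain ⟨x, hx, y, hy, z, hz, h1, h2, h3, hb⟩ := I.I3 T hT
    by_contra hc
    simp only [Bool.not_eq_true, Bool.not_eq_false'] at hc
    have hxx := hof x hx (land0 hc ((hb x).2 (by simp)))
    have hyy := hof y hy (land0 hc ((hb y).2 (by simp)))
    have hzz := hof z hz (land0 hc ((hb z).2 (by simp)))
    exact A.b4 x (by omega) y (by omega) z (by omega) s.k (by omega) j hj (by omega) h1 h2 h3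
      hxx.1 hyy.1 hzz.1 hxx.2 hyy.2 hzz.2

theorem okB_sound (A : Adm a N) {s : St} (I : Inv a s) {j : ℕ} (hkj : s.k < j) (hj : j < N)
    (h : ¬ a s.k j) : okB s.Ed s.I3 s.N3 (M a s.k s.k) (M a j s.k) = true := by
  have ht : ∀ n, (Nat.land (M a s.k s.k) (M a j s.k)).testBit n = true →
      n < s.k ∧ a n s.k ∧ a n j := by
    intro n hn
    rw [land_tb, Bool.and_eq_true, M_tb, M_tb] at hn
    exact ⟨hn.1.1, hn.1.2, hn.2.2⟩
  have hof : ∀ n, n < s.k → (Nat.lor (M a s.k s.k) (M a j s.k)).testBit n = false →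
      nb' a n s.k ∧ nb' a n j := by
    intro n hk hn
    rw [lor_tb, Bool.or_eq_false_iff] at hn
    exact ⟨⟨by omega, M_tbf a hn.1 hk⟩, ⟨by omega, M_tbf a hn.2 hk⟩⟩
  have hsj : nb' a s.k j := ⟨by omega, h⟩
  unfold okB
  rw [Bool.and_eq_true, Bool.and_eq_true, List.all_eq_true, List.all_eq_true, List.all_eq_true]
  refine ⟨?_, ?_, ?_⟩
  · intro E hE
    obtain ⟨x, hx, y, hy, hxy, hb⟩ := I.Ed E hE
    by_contra hc
    simp only [Bool.not_eq_true, Bool.not_eq_false'] at hc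
    obtain ⟨_, h1, h2⟩ := ht x (landT hc ((hb x).2 (Or.inl rfl)))
    obtain ⟨_, h3, h4⟩ := ht y (landT hc ((hb y).2 (Or.inr rfl)))
    exact A.r3 x (by omega) y (by omega) s.k (by omega) j hj (by omega) hxy h1 h3 h2 h4
  · intro T hT
    obtain ⟨x, hx, y, hy, z, hz, h1, h2, h3, hb⟩ := I.N3 T hT
    by_contra hc
    simp only [Bool.not_eq_true, Bool.not_eq_false'] at hc
    have hxx := hof x hx (land0 hc ((hb x).2 (by simp)))
    have hyy := hof y hy (land0 hc ((hb y).2 (by simp)))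
    have hzz := hof z hz (land0 hc ((hb z).2 (by simp)))
    have hne : x ≠ y := by rintro rfl; exact A.irr _ h1
    exact A.b4 z (by omega) s.k (by omega) j hj x (by omega) y (by omega) hne hzz.1 hzz.2 hsj
      (A.bs h2) (A.bs hxx.1) (A.bs hxx.2) (A.bs h3) (A.bs hyy.1) (A.bs hyy.2)
  · intro T hT
    obtain ⟨x, hx, y, hy, z, hz, h1, h2, h3, hb⟩ := I.I3 T hT
    by_contra hc
    simp only [Bool.not_eq_true, Bool.not_eq_false', Bool.and_eq_true] at hc
    obtain ⟨hc1, hc2⟩ := hc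
    have hne : ∀ n, n = x ∨ n = y ∨ n = z → ∀ m, m = x ∨ m = y ∨ m = z → n ≠ m → n < s.k → m < s.k →
        (nb' a n s.k ∧ nb' a n j) ∨ (nb' a m s.k ∧ nb' a m j) := by
      intro n hn m hm hnm hn' hm'
      by_contra hcc
      rw [not_or] at hcc
      apply hnm
      have : ∀ n, n = x ∨ n = y ∨ n = z → n < s.k → ¬ (nb' a n s.k ∧ nb' a n j) →
          (Nat.land T (Nat.lor (M a s.k s.k) (M a j s.k))).testBit n = true := by
        intro n hn hn' h5
        rw [land_tb, Bool.and_eq_true]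
        refine ⟨(hb n).2 hn, ?_⟩
        by_contra h6
        rw [Bool.not_eq_true] at h6
        exact h5 (hof n hn' h6)
      exact am1T hc2 (this n hn hn' hcc.1) (this m hm hm' hcc.2)
    have hone : ∀ n, n = x ∨ n = y ∨ n = z → n < s.k → nb' a n s.k ∨ nb' a n j := by
      intro n hn hk
      have h5 := land0 hc1 ((hb n).2 hn)
      rw [land_tb, Bool.and_eq_false_iff] at h5
      rcases h5 with h5 | h5
      · left; exact ⟨by omega, M_tbf a h5 hk⟩
      · right; exact ⟨by omega, M_tbf a h5 hk⟩
    -- a general finisher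
    have fin : ∀ x y z, x < s.k → y < s.k → z < s.k → nb' a x y → nb' a x z → nb' a y z →
        (nb' a x s.k ∧ nb' a x j) → (nb' a y s.k ∧ nb' a y j) → (nb' a z s.k ∨ nb' a z j) → False := by
      intro x y z hx hy hz h1 h2 h3 hxx hyy hzz
      rcases hzz with hzz | hzz
      · exact A.b4 x (by omega) y (by omega) s.k (by omega) z (by omega) j hj (by omega) h1 hxx.1 hyy.1 h2 h3
          (A.bs hzz) hxx.2 hyy.2 hsj
      · exact A.b4 x (by omega) y (by omega) j hj z (by omega) s.k (by omega) (by omega) h1 hxx.2 hyy.2 h2 h3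
          (A.bs hzz) hxx.1 hyy.1 (A.bs hsj)
    have q1 := hne x (by simp) y (by simp) h1.1 hx hy
    have q2 := hne x (by simp) z (by simp) h2.1 hx hz
    have q3 := hne y (by simp) z (by simp) h3.1 hy hz
    have o1 := hone x (by simp) hx
    have o2 := hone y (by simp) hy
    have o3 := hone z (by simp) hz
    rcases q1 with q1 | q1
    · rcases q3 with q3 | q3
      · exact fin x y z hx hy hz h1 h2 h3 q1 q3 o3
      · exact fin x z y hx hz hy h2 h1 (A.bs h3) q1 q3 o2
    · rcases q2 with q2 | q2
      · exact fin x y z hx hy hz h1 h2 h3 q2 q1 o3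
      · exact fin y z x hy hz hx h3 (A.bs h1) (A.bs h2) q1 q2 o1

theorem step_inv (A : Adm a N) {s : St} (I : Inv a s) (f : ℕ → Bool) :
    Inv a (step s (M a s.k s.k) f) := by
  have hbit : ∀ n, s.bit.testBit n = true ↔ n = s.k := by
    intro n; rw [I.bit, Nat.testBit_two_pow]; simp [eq_comm]
  have hz : ∀ {p n : ℕ}, Nat.beq (Nat.land p (M a s.k s.k)) 0 = true → p.testBit n = true → n < s.k →
      nb' a s.k n := by
    intro p n h1 h2 h3
    exact A.bs ⟨by omega, M_tbf a (land0 h1 h2) h3⟩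
  refine ⟨?_, ?_, ?_, ?_, ?_, ?_⟩
  · show Nat.mul 2 s.bit = 2^(s.k+1)
    rw [I.bit, pow_succ]; exact Nat.mul_comm _ _
  · intro p hp
    show ∃ i < s.k+1, _
    rcases List.mem_cons.1 hp with h | h
    · subst h; exact ⟨s.k, by omega, hbit⟩
    · obtain ⟨i, hi, h⟩ := I.pw p h; exact ⟨i, by omega, h⟩
  · intro p hp
    show ∃ i < s.k+1, ∃ j < s.k+1, _
    rcases List.mem_append.1 hp with h | h
    · obtain ⟨q, hq, rfl⟩ := List.mem_map.1 h
      obtain ⟨hq1, hq2⟩ := List.mem_filter.1 hq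
      obtain ⟨i, hi, hb⟩ := I.pw q hq1
      obtain ⟨n, hn1, hn2⟩ := landne (by simpa using hq2)
      have : n = i := (hb n).1 hn1
      subst this
      refine ⟨s.k, by omega, n, by omega, A.symm _ _ ((M_tb _ _ _ _).1 hn2).2, ?_⟩
      intro t; rw [lor_tb, Bool.or_eq_true, hbit, hb]
    · obtain ⟨i, hi, j, hj, h⟩ := I.Ed p h; exact ⟨i, by omega, j, by omega, h⟩
  · intro p hp
    show ∃ i < s.k+1, ∃ j < s.k+1, _
    rcases List.mem_append.1 hp with h | h
    · obtain ⟨q, hq, rfl⟩ := List.mem_map.1 h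
      obtain ⟨hq1, hq2⟩ := List.mem_filter.1 hq
      obtain ⟨i, hi, hb⟩ := I.pw q hq1
      refine ⟨s.k, by omega, i, by omega, hz hq2 ((hb i).2 rfl) hi, ?_⟩
      intro t; rw [lor_tb, Bool.or_eq_true, hbit, hb]
    · obtain ⟨i, hi, j, hj, h⟩ := I.Ne p h; exact ⟨i, by omega, j, by omega, h⟩
  · intro p hp
    show ∃ i < s.k+1, ∃ j < s.k+1, ∃ k < s.k+1, _
    rcases List.mem_append.1 hp with h | h
    · obtain ⟨q, hq, rfl⟩ := List.mem_map.1 h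
      obtain ⟨hq1, hq2⟩ := List.mem_filter.1 hq
      obtain ⟨i, hi, j, hj, hij, hb⟩ := I.Ne q hq1
      refine ⟨s.k, by omega, i, by omega, j, by omega, hz hq2 ((hb i).2 (by simp)) hi,
        hz hq2 ((hb j).2 (by simp)) hj, hij, ?_⟩
      intro t; rw [lor_tb, Bool.or_eq_true, hbit, hb]
    · obtain ⟨i, hi, j, hj, k, hk, h⟩ := I.I3 p h; exact ⟨i, by omega, j, by omega, k, by omega, h⟩
  · intro p hp
    show ∃ i < s.k+1, ∃ j < s.k+1, ∃ k < s.k+1, _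
    rcases List.mem_append.1 hp with h | h
    · obtain ⟨q, hq, rfl⟩ := List.mem_map.1 h
      obtain ⟨hq1, hq2⟩ := List.mem_filter.1 hq
      obtain ⟨i, hi, j, hj, hij, hb⟩ := I.Ne q hq1
      rw [Bool.and_eq_true, Bool.not_eq_true', Bool.not_eq_true'] at hq2
      obtain ⟨n, hn1, hn2⟩ := landne hq2.1
      obtain ⟨m, hm1, hm2⟩ := landnT hq2.2
      have hn3 := ((M_tb _ _ _ _).1 hn2).2
      have hml : m < s.k := by rcases (hb m).1 hm1 with rfl | rfl <;> assumption
      have hm3 : nb' a m s.k := ⟨by omega, M_tbf a hm2 hml⟩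
      have hmn : m ≠ n := by rintro rfl; exact hm3.2 hn3
      have hnl : n < s.k := by rcases (hb n).1 hn1 with rfl | rfl <;> assumption
      have hnm : nb' a n m := by
        rcases (hb n).1 hn1 with rfl | rfl <;> rcases (hb m).1 hm1 with rfl | rfl
        · exact absurd rfl hmn
        · exact hij
        · exact A.bs hij
        · exact absurd rfl hmn
      refine ⟨s.k, by omega, n, by omega, m, by omega, A.symm _ _ hn3, A.bs hm3, hnm, ?_⟩
      intro t; rw [lor_tb, Bool.or_eq_true, hbit, hb]
      have e1 := (hb n).1 hn1
      have e2 := (hb m).1 hm1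
      constructor <;> intro h <;> omega
    rcases List.mem_append.1 h with h | h
    · obtain ⟨q, hq, rfl⟩ := List.mem_map.1 h
      obtain ⟨hq1, hq2⟩ := List.mem_filter.1 hq
      obtain ⟨i, hi, j, hj, hij, hb⟩ := I.Ed q hq1
      refine ⟨i, by omega, j, by omega, s.k, by omega, hij, A.bs (hz hq2 ((hb i).2 (by simp)) hi),
        A.bs (hz hq2 ((hb j).2 (by simp)) hj), ?_⟩
      intro t; rw [lor_tb, Bool.or_eq_true, hbit, hb]; tauto
    · obtain ⟨i, hi, j, hj, k, hk, h⟩ := I.N3 p h; exact ⟨i, by omega, j, by omega, k, by omega, h⟩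

theorem step_C (A : Adm a N) {s : St} (I : Inv a s) (f : ℕ → Bool) {j : ℕ} (hkj : s.k < j) (hj : j < N)
    (hm : M a j s.k ∈ s.C) (hf : f (M a j s.k) = true) :
    M a j (s.k+1) ∈ (step s (M a s.k s.k) f).C := by
  show _ ∈ (s.C.filter f).flatMap (stepC s (M a s.k s.k))
  rw [List.mem_flatMap]
  refine ⟨M a j s.k, List.mem_filter.2 ⟨hm, hf⟩, ?_⟩
  unfold stepC
  rw [List.mem_append]
  by_cases h : a s.k j
  · right
    rw [okR_sound A I hkj hj h]
    simp [M, h, I.bit]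
  · left
    rw [okB_sound A I hkj hj h]
    simp [M, h]

noncomputable def RW (a : ℕ → ℕ → Prop) : ℕ → List ℕ
  | 0 => []
  | n+1 => M a n n :: RW a n

theorem land_PM {q k j : ℕ} (h : q ≤ k) : Nat.land (M a j k) (2^q-1) = M a j q := by
  apply Nat.eq_of_testBit_eq
  intro i
  rw [Bool.eq_iff_iff, land_tb, Bool.and_eq_true, M_tb, M_tb, Nat.testBit_two_pow_sub_one]
  simp
  constructor
  · rintro ⟨⟨h1, h2⟩, h3⟩; exact ⟨h3, h2⟩
  · rintro ⟨h1, h2⟩; exact ⟨⟨by omega, h2⟩, h1⟩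

theorem search_sound (A : Adm a N) (q per : ℕ)
    (hs : ∀ i j, q ≤ i → i ≤ j → j < N → M a i q ≤ M a j q)
    (hper : ∀ j, q ≤ j → j < N → popc 7 (M a j q) ≤ per) :
    ∀ (rem need need2 : ℕ) (s : St), Inv a s → q ≤ s.k → s.k + rem = N →
      (∀ j, s.k ≤ j → j < N → M a j s.k ∈ s.C) →
      need ≤ ∑ j ∈ Finset.Ico s.k N, popc 7 (M a j q) →
      need2 ≤ ∑ j ∈ Finset.Ico s.k N, popc 12 (M a j j) →
      RW a N ∈ search per (2^q-1) rem need need2 s (RW a s.k) := by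
  intro rem
  induction rem with
  | zero =>
    intro need need2 s I hq hN hC h1 h2
    have : s.k = N := by omega
    rw [this] at h2
    simp at h2
    subst h2
    rw [this]
    simp [search]
  | succ rem ih =>
    intro need need2 s I hq hN hC h1 h2
    have hb : Nat.ble need (Nat.mul (rem+1) per) = true := by
      apply Nat.ble_eq_true_of_le
      refine h1.trans ?_
      refine (Finset.sum_le_card_nsmul _ _ per ?_).trans ?_
      · intro j hj
        rw [Finset.mem_Ico] at hj
        exact hper j (by omega) hj.2
      · rw [Nat.card_Ico, smul_eq_mul]
        have : N - s.k = rem + 1 := by omega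
        rw [this]; rfl
    unfold search
    rw [hb, cond_true, List.mem_flatMap]
    refine ⟨M a s.k s.k, hC s.k le_rfl (by omega), ?_⟩
    rw [land_PM hq]
    have e := Finset.sum_eq_sum_Ico_succ_bot (show s.k < N by omega) (fun j => popc 7 (M a j q))
    have e2 := Finset.sum_eq_sum_Ico_succ_bot (show s.k < N by omega) (fun j => popc 12 (M a j j))
    refine ih _ _ (step s (M a s.k s.k) _) (step_inv A I _) ?_ ?_ ?_ ?_ ?_
    · show q ≤ s.k+1; omega
    · show s.k+1+rem = N; omega
    · intro j hj1 hj2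
      have hj1' : s.k + 1 ≤ j := hj1
      refine step_C A I _ hj1' hj2 (hC j (by omega) hj2) ?_
      rw [land_PM hq]
      exact Nat.ble_eq_true_of_le (hs _ _ hq (by omega) hj2)
    · show Nat.sub _ _ ≤ ∑ j ∈ Finset.Ico (s.k+1) N, _
      rw [e] at h1
      show need - _ ≤ _
      omega
    · show Nat.sub _ _ ≤ ∑ j ∈ Finset.Ico (s.k+1) N, _
      rw [e2] at h2
      show need2 - _ ≤ _
      omega

end GRP

set_option linter.all false
namespace GRP
open scoped Classical

theorem M_congr {a a' : ℕ → ℕ → Prop} {j j' k : ℕ} (h : ∀ i < k, (a i j ↔ a' i j')) :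
    M a j k = M a' j' k := by
  apply Nat.eq_of_testBit_eq
  intro i
  rw [Bool.eq_iff_iff, M_tb, M_tb]
  constructor
  · rintro ⟨h1, h2⟩; exact ⟨h1, (h i h1).1 h2⟩
  · rintro ⟨h1, h2⟩; exact ⟨h1, (h i h1).2 h2⟩

theorem popc_eq (n m : ℕ) : popc n m = ((Finset.range n).filter fun i => m.testBit i = true).card := by
  induction n generalizing m with
  | zero => simp [popc]
  | succ n ih =>
    rw [popc, ih, Finset.card_filter, Finset.card_filter, Finset.sum_range_succ']
    have e1 : Nat.land m 1 = if m.testBit 0 = true then 1 else 0 := by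
      have : Nat.land m 1 = m % 2 := Nat.and_one_is_mod m
      rw [this, Nat.testBit_zero]
      rcases Nat.mod_two_eq_zero_or_one m with h | h <;> simp [h]
    rw [e1]
    show (_ : ℕ) + (_ : ℕ) = _
    rw [add_comm]
    congr 1
    apply Finset.sum_congr rfl
    intro i hi
    have : (Nat.shiftRight m 1).testBit i = m.testBit (i+1) := by
      show (m >>> 1).testBit i = _
      rw [Nat.testBit_shiftRight, add_comm]
    rw [this]

theorem popc_M {a : ℕ → ℕ → Prop} {n j k : ℕ} (h : k ≤ n) :
    popc n (M a j k) = ((Finset.range k).filter fun i => a i j).card := by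
  rw [popc_eq]
  congr 1
  ext i
  simp only [Finset.mem_filter, Finset.mem_range, M_tb]
  constructor
  · rintro ⟨h1, h2, h3⟩; exact ⟨h2, h3⟩
  · rintro ⟨h1, h2⟩; exact ⟨by omega, h1, h2⟩

variable {V : Type*}
noncomputable def ed (G : SimpleGraph V) (S : Finset V) : ℕ := ∑ v ∈ S, (nb G S v).card

theorem nb_insert (G : SimpleGraph V) (S : Finset V) (x v : V) (hx : x ∉ S) :
    (nb G (insert x S) v).card = (nb G S v).card + if G.Adj v x then 1 else 0 := by
  have hsub : nb G S v ⊆ S := nb_sub ..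
  split_ifs with h
  · have : nb G (insert x S) v = insert x (nb G S v) := by
      ext y; simp only [mem_nb, Finset.mem_insert]
      constructor
      · rintro ⟨rfl | h1, h2⟩
        · left; rfl
        · right; exact ⟨h1, h2⟩
      · rintro (rfl | ⟨h1, h2⟩)
        · exact ⟨Or.inl rfl, h⟩
        · exact ⟨Or.inr h1, h2⟩
    rw [this, Finset.card_insert_of_notMem (fun h' => hx (hsub h'))]
  · have : nb G (insert x S) v = nb G S v := by
      ext y; simp only [mem_nb, Finset.mem_insert]
      constructor
      · rintro ⟨rfl | h1, h2⟩
        · exact absurd h2 h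
        · exact ⟨h1, h2⟩
      · rintro ⟨h1, h2⟩; exact ⟨Or.inr h1, h2⟩
    rw [this]; rfl

theorem ed_insert (G : SimpleGraph V) (S : Finset V) (x : V) (hx : x ∉ S) :
    ed G (insert x S) = ed G S + 2 * (nb G S x).card := by
  unfold ed
  rw [Finset.sum_insert hx, nb_insert G S x x hx]
  simp only [nb_insert G S x _ hx, Finset.sum_add_distrib]
  have : ∑ v ∈ S, (if G.Adj v x then 1 else 0) = (nb G S x).card := by
    rw [← Finset.sum_filter, ← Finset.card_eq_sum_ones]
    congr 1
    ext y; simp [mem_nb, G.adj_comm]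
  rw [this]
  simp
  omega

theorem ed_union (G : SimpleGraph V) (A B : Finset V) (h : Disjoint A B) :
    ed G (A ∪ B) = ed G A + ed G B + 2 * ∑ b ∈ B, (nb G A b).card := by
  induction B using Finset.induction_on with
  | empty => simp [ed]
  | insert x B hx ih =>
    have h1 : Disjoint A B := h.mono_right (Finset.subset_insert _ _)
    have h2 : x ∉ A := fun h' => Finset.disjoint_left.1 h h' (Finset.mem_insert_self _ _)
    rw [Finset.union_insert, ed_insert _ _ _ (by simp [h2, hx]), ih h1, ed_insert _ _ _ hx,
      Finset.sum_insert hx]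
    have : (nb G (A ∪ B) x).card = (nb G A x).card + (nb G B x).card := by
      have e : nb G (A ∪ B) x = nb G A x ∪ nb G B x := by
        ext y; simp only [mem_nb, Finset.mem_union]; tauto
      rw [e, Finset.card_union_of_disjoint]
      exact h1.mono (nb_sub ..) (nb_sub ..)
    rw [this]; ring

/-- force phase -/
theorem force_sound {a : ℕ → ℕ → Prop} {N : ℕ} (A : Adm a N) : ∀ (r : List ℕ) (s : St), Inv a s →
    (∀ i < r.length, r[i]? = some (M a (s.k+i) (s.k+i))) →
    Inv a (force s r) ∧ (force s r).k = s.k + r.length ∧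
    ∀ j, s.k + r.length ≤ j → j < N → M a j s.k ∈ s.C → M a j (s.k + r.length) ∈ (force s r).C := by
  intro r
  induction r with
  | nil => intro s I h; exact ⟨I, rfl, fun j _ _ h => h⟩
  | cons S r ih =>
    intro s I h
    have h0 := h 0 (by simp)
    simp at h0
    subst h0
    have ih' := ih (step s (M a s.k s.k) fun _ => true) (step_inv A I _) (by
      intro i hi
      have := h (i+1) (by simpa using hi)
      simp at this
      rw [this]
      show some (M a (s.k + (i+1)) _) = some (M a (s.k+1+i) (s.k+1+i))
      congr 2 <;> omega)
    have hk : (step s (M a s.k s.k) fun _ => true).k = s.k+1 := rfl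
    rw [hk] at ih'
    refine ⟨ih'.1, ?_, ?_⟩
    · show (force (step s (M a s.k s.k) fun _ => true) r).k = _
      rw [ih'.2.1]; simp; omega
    · intro j hj1 hj2 hj
      simp at hj1
      have h3 := ih'.2.2 j (by omega) hj2 (step_C A I _ (by omega) hj2 hj rfl)
      have e : s.k + (M a s.k s.k :: r).length = s.k + 1 + r.length := by simp; omega
      rw [e]; exact h3

theorem inv0 {a : ℕ → ℕ → Prop} : Inv a st0 := by
  refine ⟨rfl, ?_, ?_, ?_, ?_, ?_⟩
  · intro p hp
    simp [st0] at hp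
    subst hp
    refine ⟨0, by simp [st0], ?_⟩
    intro n
    have := Nat.testBit_two_pow (n := 0) (m := n)
    simp at this
    rw [this]; simp [eq_comm]
  all_goals (intro p hp; simp [st0] at hp)

def enumG (r : List ℕ) (N need need2 : ℕ) : List (List ℕ) :=
  search 3 (2^(r.length+1)-1) (N-(r.length+1)) need need2 (force st0 r) (r.reverse ++ [0])

theorem RW_force {a : ℕ → ℕ → Prop} : ∀ (r : List ℕ) (k : ℕ), (∀ i < r.length, r[i]? = some (M a (k+i) (k+i))) →
    RW a (k + r.length) = r.reverse ++ RW a k := by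
  intro r
  induction r with
  | nil => intro k _; rfl
  | cons S r ih =>
    intro k h
    have h0 := h 0 (by simp)
    simp at h0
    have := ih (k+1) (by
      intro i hi
      have := h (i+1) (by simpa using hi)
      simp at this
      rw [this]
      congr 2 <;> omega)
    rw [List.length_cons, List.reverse_cons, ← Nat.add_assoc, Nat.add_right_comm, this, h0]
    simp [RW]

/-- labelled enumeration soundness -/
theorem enumG_sound {a : ℕ → ℕ → Prop} {N : ℕ} (A : Adm a N) (r : List ℕ) (hN : r.length + 1 ≤ N)
    (hr : ∀ i < r.length, r[i]? = some (M a (1+i) (1+i)))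
    (h0 : ∀ j, r.length + 1 ≤ j → j < N → ¬ a 0 j)
    (hs : ∀ i j, r.length+1 ≤ i → i ≤ j → j < N → M a i (r.length+1) ≤ M a j (r.length+1))
    (hper : ∀ m ∈ (force st0 r).C, popc 7 m ≤ 3) (need need2 : ℕ)
    (h1 : need ≤ ∑ j ∈ Finset.Ico (r.length+1) N, popc 7 (M a j (r.length+1)))
    (h2 : need2 ≤ ∑ j ∈ Finset.Ico (r.length+1) N, popc 12 (M a j j)) :
    RW a N ∈ enumG r N need need2 := by
  obtain ⟨I, hk, hC⟩ := force_sound A r st0 inv0 hr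
  have hk' : (force st0 r).k = r.length + 1 := by rw [hk]; show 1 + _ = _; omega
  have hC' : ∀ j, r.length+1 ≤ j → j < N → M a j (r.length+1) ∈ (force st0 r).C := by
    intro j hj1 hj2
    have := hC j (by show 1 + _ ≤ _; omega) hj2 (by
      show M a j 1 ∈ [0]
      simp [M, h0 j hj1 hj2])
    have e : st0.k + r.length = r.length + 1 := by show 1 + _ = _; omega
    rwa [e] at this
  have := search_sound A (r.length+1) 3 hs (fun j hj1 hj2 => hper _ (hC' j hj1 hj2)) (N-(r.length+1)) need need2
    (force st0 r) I (by omega) (by omega) (by rw [hk']; exact hC') (by rw [hk']; exact h1) (by rw [hk']; exact h2)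
  rw [hk'] at this
  have e := RW_force r 1 hr
  unfold enumG
  have e2 : RW a (r.length+1) = r.reverse ++ [0] := by
    rw [add_comm, e]; rfl
  rw [← e2]; exact this

/-- labelling a set, prescribing the beginning, sorting the rest -/
theorem labelling (S : Finset V) (B : List V) (hB : B.Nodup) (hBS : ∀ x ∈ B, x ∈ S) (hne : B ≠ [])
    (key : V → ℕ) : ∃ f : ℕ → V, (∀ i < B.length, B[i]? = some (f i)) ∧ (∀ i < S.card, f i ∈ S) ∧
      (∀ i < S.card, ∀ j < S.card, f i = f j → i = j) ∧
      (∀ i j, B.length ≤ i → i ≤ j → j < S.card → key (f i) ≤ key (f j)) ∧ B.length ≤ S.card := by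
  set Q := ((S \ B.toFinset).toList.mergeSort fun x y => decide (key x ≤ key y)) with hQ
  have hperm : Q.Perm (S \ B.toFinset).toList := List.mergeSort_perm _ _
  have hmem : ∀ x, x ∈ Q ↔ x ∈ S ∧ x ∉ B := by
    intro x; rw [hperm.mem_iff]; simp
  have hnd : (B ++ Q).Nodup := by
    rw [List.nodup_append]
    refine ⟨hB, hperm.nodup_iff.2 (Finset.nodup_toList _), ?_⟩
    intro x hx y hy hxy
    subst hxy
    exact ((hmem x).1 hy).2 hx
  have htf : (B ++ Q).toFinset = S := by
    ext x; simp only [List.mem_toFinset, List.mem_append, hmem]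
    constructor
    · rintro (h | h)
      · exact hBS x h
      · exact h.1
    · intro h; by_cases hx : x ∈ B
      · exact Or.inl hx
      · exact Or.inr ⟨h, hx⟩
  have hlen : (B ++ Q).length = S.card := by
    rw [← htf, List.toFinset_card_of_nodup hnd]
  have hsort : Q.Pairwise fun x y => decide (key x ≤ key y) = true := by
    apply List.pairwise_mergeSort
    · intro a b c; simp; omega
    · intro a b; simp; omega
  obtain ⟨b0, hb0⟩ := List.exists_mem_of_ne_nil _ hne
  have hget : ∀ i < S.card, (B ++ Q)[i]? = some ((B ++ Q).getD i b0) := by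
    intro i hi
    rw [List.getD_eq_getElem?_getD, List.getElem?_eq_getElem (by omega)]; rfl
  refine ⟨fun i => (B ++ Q).getD i b0, ?_, ?_, ?_, ?_, ?_⟩
  · intro i hi
    rw [← hget i (by rw [← hlen, List.length_append]; omega), List.getElem?_append_left hi]
  · intro i hi
    have := List.mem_of_getElem? (hget i hi)
    rw [← htf]; exact List.mem_toFinset.2 this
  · intro i hi j hj hij
    have h1 := hget i hi
    have h2 := hget j hj
    have hij' : (B ++ Q).getD i b0 = (B ++ Q).getD j b0 := hij
    rw [hij', ← h2] at h1
    exact (List.getElem?_inj (by omega) hnd).1 h1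
  · intro i j h1 h2 h3
    rcases Nat.eq_or_lt_of_le h2 with h | h
    · subst h; exact le_rfl
    rw [List.length_append] at hlen
    have g : ∀ i, B.length ≤ i → (hi : i < S.card) → (B ++ Q).getD i b0 = Q[i - B.length]'(by omega) := by
      intro i hi1 hi2
      rw [List.getD_eq_getElem?_getD, List.getElem?_append_right hi1, List.getElem?_eq_getElem (by omega)]; rfl
    show key ((B ++ Q).getD i b0) ≤ key ((B ++ Q).getD j b0)
    rw [g i h1 (by omega), g j (by omega) h3]
    have := List.pairwise_iff_getElem.1 hsort (i - B.length) (j - B.length) (by omega) (by omega) (by omega)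
    simpa using this
  · rw [List.length_append] at hlen; omega

end GRP

set_option linter.all false
namespace GRP
open scoped Classical
variable {V : Type*}

theorem adm_of (R : SimpleGraph V) (S : Finset V) (hR : Fr 3 R S) (hB : Fr 4 Rᶜ S) (f : ℕ → V) (N : ℕ)
    (hf : ∀ i < N, f i ∈ S) (hi : ∀ i < N, ∀ j < N, f i = f j → i = j) :
    Adm (fun i j => R.Adj (f i) (f j)) N := by
  refine ⟨fun i j h => h.symm, fun i h => h.ne rfl, ?_, ?_⟩
  · intro x hx y hy z hz w hw hzw h1 h2 h3 h4 h5
    exact hR _ (hf x hx) _ (hf y hy) _ (hf z hz) _ (hf w hw) (fun h => hzw (hi _ hz _ hw h)) h1 h2 h3 h4 h5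
  · intro x hx y hy z hz p hp q hq hpq
    have cv : ∀ i < N, ∀ j < N, nb' (fun i j => R.Adj (f i) (f j)) i j → Rᶜ.Adj (f i) (f j) := by
      intro i h1 j h2 h3
      rw [SimpleGraph.compl_adj]
      exact ⟨fun h => h3.1 (hi _ h1 _ h2 h), h3.2⟩
    intro h1 h2 h3 h4 h5 h6 h7 h8 h9
    exact hB _ (hf x hx) _ (hf y hy) _ (hf z hz) _ (hf p hp) _ (hf q hq) (fun h => hpq (hi _ hp _ hq h))
      (cv _ hx _ hy h1) (cv _ hx _ hz h2) (cv _ hy _ hz h3) (cv _ hx _ hp h4) (cv _ hy _ hp h5) (cv _ hz _ hp h6)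
      (cv _ hx _ hq h7) (cv _ hy _ hq h8) (cv _ hz _ hq h9)

theorem nb_img (R : SimpleGraph V) (f : ℕ → V) (N k : ℕ) (hk : k ≤ N)
    (hi : ∀ i < N, ∀ j < N, f i = f j → i = j) (y : V) :
    (nb R ((Finset.range k).image f) y).card = ((Finset.range k).filter fun i => R.Adj (f i) y).card := by
  have : nb R ((Finset.range k).image f) y = ((Finset.range k).filter fun i => R.Adj (f i) y).image f := by
    ext x
    simp only [mem_nb, Finset.mem_image, Finset.mem_range, Finset.mem_filter]
    constructor
    · rintro ⟨⟨i, h1, rfl⟩, h2⟩; exact ⟨i, ⟨h1, h2.symm⟩, rfl⟩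
    · rintro ⟨i, ⟨h1, h2⟩, rfl⟩; exact ⟨⟨i, h1, rfl⟩, h2.symm⟩
  rw [this, Finset.card_image_of_injOn]
  intro i h1 j h2 h
  simp at h1 h2
  exact hi i (by omega) j (by omega) h

theorem ed_img (R : SimpleGraph V) (f : ℕ → V) (N : ℕ) (hN : N ≤ 12)
    (hi : ∀ i < N, ∀ j < N, f i = f j → i = j) (k : ℕ) (hk : k ≤ N) :
    ed R ((Finset.range k).image f) = 2 * ∑ j ∈ Finset.range k, popc 12 (M (fun i j => R.Adj (f i) (f j)) j j) := by
  induction k with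
  | zero => simp [ed]
  | succ k ih =>
    rw [Finset.range_add_one, Finset.image_insert, ed_insert, ih (by omega), Finset.sum_insert (by simp),
      popc_M (by omega), nb_img R f N k (by omega) hi]
    · ring
    · simp only [Finset.mem_image, Finset.mem_range, not_exists, not_and]
      intro i h1 h2
      have := hi i (by omega) k (by omega) h2
      omega

theorem enum_core (R : SimpleGraph V) (S : Finset V) (hR : Fr 3 R S) (hB : Fr 4 Rᶜ S) (N : ℕ) (hN : S.card = N)
    (hN2 : N ≤ 12) (emin base cap : ℕ) (he : 2 * emin ≤ ed R S) (r : List ℕ) (B : List V)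
    (hBr : B.length = r.length + 1) (hr7 : r.length + 1 ≤ 7) (hnd : B.Nodup) (hBS : ∀ x ∈ B, x ∈ S)
    (hu : ∀ u, B[0]? = some u → ∀ x ∈ S, R.Adj u x → x ∈ B)
    (hr : ∀ f : ℕ → V, (∀ i < B.length, B[i]? = some (f i)) → ∀ i < r.length,
      r[i]? = some (M (fun i j => R.Adj (f i) (f j)) (1+i) (1+i)))
    (hper : ∀ m ∈ (force st0 r).C, popc 7 m ≤ 3)
    (hbase : ∑ i ∈ Finset.range r.length, popc 12 (r.getD i 0) = base)
    (hcap : ∀ Q ⊆ S, Q.card + (r.length+1) = N → ed R Q ≤ 2 * cap) :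
    ∃ f : ℕ → V, (∀ i < N, f i ∈ S) ∧ (∀ i < N, ∀ j < N, f i = f j → i = j) ∧
      RW (fun i j => R.Adj (f i) (f j)) N ∈ enumG r N (emin - base - cap) (emin - base) := by
  have hne : B ≠ [] := by intro h; rw [h] at hBr; simp at hBr
  obtain ⟨b0, hb0⟩ := List.exists_mem_of_ne_nil _ hne
  obtain ⟨f, h1, h2, h3, h4, h5⟩ := labelling S B hnd hBS hne
    (fun y => M (fun i _ => R.Adj (B.getD i b0) y) 0 (r.length+1))
  rw [hN] at h2 h3 h4 h5
  refine ⟨f, h2, h3, ?_⟩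
  have A := adm_of R S hR hB f N h2 h3
  set q := r.length + 1 with hq
  have hrr := hr f h1
  have himg : (Finset.range N).image f = S := by
    apply Finset.eq_of_subset_of_card_le
    · intro x hx
      obtain ⟨i, hi, rfl⟩ := Finset.mem_image.1 hx
      exact h2 i (Finset.mem_range.1 hi)
    · rw [Finset.card_image_of_injOn, Finset.card_range, hN]
      intro i hi j hj h; simp at hi hj; exact h3 i hi j hj h
  have hE := ed_img R f N hN2 h3 N le_rfl
  rw [himg] at hE
  have hEq := ed_img R f N hN2 h3 q (by omega)
  have hsplit := Finset.sum_range_add_sum_Ico (fun j => popc 12 (M (fun i j => R.Adj (f i) (f j)) j j))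
    (show q ≤ N by omega)
  have hb : ∑ j ∈ Finset.range q, popc 12 (M (fun i j => R.Adj (f i) (f j)) j j) = base := by
    rw [hq, Finset.sum_range_succ', ← hbase]
    have : popc 12 (M (fun i j => R.Adj (f i) (f j)) 0 0) = 0 := by simp [M]; decide
    rw [this, add_zero]
    apply Finset.sum_congr rfl
    intro i hi
    have := hrr i (Finset.mem_range.1 hi)
    rw [List.getD_eq_getElem?_getD, this, Nat.add_comm 1 i]; rfl
  -- the cross sum
  set Q := (Finset.Ico q N).image f with hQ
  have hQc : Q.card = N - q := by
    rw [hQ, Finset.card_image_of_injOn, Nat.card_Ico]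
    intro i hi j hj h; simp at hi hj; exact h3 i (by omega) j (by omega) h
  have hQS : Q ⊆ S := by rw [← himg, hQ]; apply Finset.image_subset_image; intro i; simp
  have hdis : Disjoint ((Finset.range q).image f) Q := by
    rw [Finset.disjoint_left]
    intro x hx hx'
    obtain ⟨i, hi, rfl⟩ := Finset.mem_image.1 hx
    obtain ⟨j, hj, h⟩ := Finset.mem_image.1 hx'
    simp at hi hj
    have := h3 j (by omega) i (by omega) h
    omega
  have hun : (Finset.range q).image f ∪ Q = S := by
    rw [hQ, ← Finset.image_union, ← himg]
    congr 1
    ext i; simp; omega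
  have hU := ed_union R _ Q hdis
  rw [hun] at hU
  have hcross : ∑ b ∈ Q, (nb R ((Finset.range q).image f) b).card =
      ∑ j ∈ Finset.Ico q N, popc 7 (M (fun i j => R.Adj (f i) (f j)) j q) := by
    rw [hQ, Finset.sum_image (by intro i hi j hj h; simp at hi hj; exact h3 i (by omega) j (by omega) h)]
    apply Finset.sum_congr rfl
    intro j hj
    rw [popc_M (by omega), nb_img R f N q (by omega) h3]
  have hQcap := hcap Q hQS (by omega)
  apply enumG_sound A r (by omega) hrr
  · intro j hj1 hj2 ha
    have h00 := h1 0 (by omega)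
    have hm := hu _ h00 _ (h2 j hj2) ha
    obtain ⟨i, hi, hi2⟩ := List.mem_iff_getElem.1 hm
    have := h1 i hi
    rw [List.getElem?_eq_getElem hi, hi2] at this
    have e := h3 j hj2 i (by omega) (by simpa using this)
    omega
  · intro i j hi hij hj
    have := h4 i j (by omega) hij hj
    have cg : ∀ j, M (fun i _ => R.Adj (B.getD i b0) (f j)) 0 (r.length+1) =
        M (fun i j => R.Adj (f i) (f j)) j (r.length+1) := by
      intro j
      apply M_congr
      intro i hi
      rw [List.getD_eq_getElem?_getD, h1 i (by omega)]; rfl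
    simp only [← hq] at cg this
    rw [cg, cg] at this
    exact this
  · exact hper
  · rw [← hq]; omega
  · rw [← hq]; omega

/-- matchings in small sets -/
theorem match5 {R : SimpleGraph V} {P : Finset V} (h1 : Fr 1 R P) (h4 : Fr 4 Rᶜ P) (hc : 5 ≤ P.card) :
    ∃ a b c d, a ∈ P ∧ b ∈ P ∧ c ∈ P ∧ d ∈ P ∧ R.Adj a b ∧ R.Adj c d ∧ a ≠ c ∧ a ≠ d ∧ b ≠ c ∧ b ≠ d := by
  by_contra hcon
  push Not at hcon
  have h0 : ¬ Fr 0 R P := by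
    intro h0
    have := f04 (cov_compl R P) h0 h4
    omega
  simp only [Fr, not_forall] at h0
  obtain ⟨a, ha, b, hb, hab, _⟩ := h0
  have hcard : 3 ≤ ((P.erase a).erase b).card := by
    rw [Finset.card_erase_of_mem (by simp [hb, hab.ne.symm]), Finset.card_erase_of_mem ha]; omega
  obtain ⟨T, hT, hT3⟩ := Finset.exists_subset_card_eq hcard
  obtain ⟨x, y, z, hxy, hxz, hyz, rfl⟩ := Finset.card_eq_three.1 hT3
  have hx := hT (show x ∈ _ by simp)
  have hy := hT (show y ∈ _ by simp)
  have hz := hT (show z ∈ _ by simp)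
  simp only [Finset.mem_erase] at hx hy hz
  have nn : ∀ x y, (x ≠ b ∧ x ≠ a ∧ x ∈ P) → (y ≠ b ∧ y ≠ a ∧ y ∈ P) → x ≠ y → Rᶜ.Adj x y := by
    intro x y hx hy hne
    rw [SimpleGraph.compl_adj]
    refine ⟨hne, fun h => ?_⟩
    exact hy.1 (hcon a b x y ha hb hx.2.2 hy.2.2 hab h hx.2.1.symm hy.2.1.symm hx.1.symm).symm
  have na : ∀ x, (x ≠ b ∧ x ≠ a ∧ x ∈ P) → Rᶜ.Adj x a ∧ Rᶜ.Adj x b := by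
    intro x hx
    rw [SimpleGraph.compl_adj, SimpleGraph.compl_adj]
    refine ⟨⟨hx.2.1, fun h => ?_⟩, ⟨hx.1, fun h => ?_⟩⟩
    · exact h1 a ha b hb x hx.2.2 hx.1.symm hab h.symm
    · exact h1 b hb a ha x hx.2.2 hx.2.1.symm hab.symm h.symm
  exact h4 x hx.2.2 y hy.2.2 z hz.2.2 a ha b hb hab.ne (nn x y hx hy hxy) (nn x z hx hz hxz) (nn y z hy hz hyz)
    (na x hx).1 (na y hy).1 (na z hz).1 (na x hx).2 (na y hy).2 (na z hz).2

theorem hper5 : ∀ m ∈ (force st0 [1,3,1,9,1]).C, popc 7 m ≤ 3 := by decide +kernel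
theorem hper6 : ∀ m ∈ (force st0 [1,3,1,9,1,33]).C, popc 7 m ≤ 3 := by decide +kernel

theorem M_step {a : ℕ → ℕ → Prop} (j k : ℕ) : M a j (k+1) = if a k j then Nat.lor (M a j k) (2^k) else M a j k := rfl

theorem enum_graph (R : SimpleGraph V) (S : Finset V) (hR : Fr 3 R S) (hB : Fr 4 Rᶜ S) (N : ℕ) (hN : S.card = N)
    (hN2 : N ≤ 12) (emin c5 c6 : ℕ) (he : 2 * emin ≤ ed R S) (hav : 4 * N < 2 * emin)
    (h5 : ∀ Q ⊆ S, Q.card + 6 = N → ed R Q ≤ 2 * c5) (h6 : ∀ Q ⊆ S, Q.card + 7 = N → ed R Q ≤ 2 * c6) :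
    ∃ f : ℕ → V, (∀ i < N, f i ∈ S) ∧ (∀ i < N, ∀ j < N, f i = f j → i = j) ∧
      (RW (fun i j => R.Adj (f i) (f j)) N ∈ enumG [1,3,1,9,1] N (emin - 7 - c5) (emin - 7) ∨
       RW (fun i j => R.Adj (f i) (f j)) N ∈ enumG [1,3,1,9,1,33] N (emin - 9 - c6) (emin - 9)) := by
  have hex : ∃ u ∈ S, 5 ≤ (nb R S u).card := by
    by_contra hc
    push Not at hc
    have : ed R S ≤ S.card * 4 := by
      unfold ed
      rw [← smul_eq_mul]
      apply Finset.sum_le_card_nsmul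
      intro x hx; have := hc x hx; omega
    omega
  obtain ⟨u, hu, hu5⟩ := hex
  have hP1 : Fr 1 R (nb R S u) := jn3 (sing_sub hu) (nb_sub ..) jn_nb hR (by simp)
  have hP4 : Fr 4 Rᶜ (nb R S u) := hB.mono (nb_sub ..)
  have hP6 := f14 (cov_compl R _) hP1 hP4
  obtain ⟨p1, p2, p3, p4, m1, m2, m3, m4, e12, e34, n13, n14, n23, n24⟩ := match5 hP1 hP4 hu5
  have n12 := e12.ne
  have n34 := e34.ne
  set P := nb R S u with hPdef
  have hadj : ∀ x ∈ P, R.Adj u x := fun x hx => (mem_nb.1 hx).2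
  have hPS : ∀ x ∈ P, x ∈ S := fun x hx => (mem_nb.1 hx).1
  have huP : ∀ x ∈ P, u ≠ x := fun x hx => (hadj x hx).ne
  -- nonadjacency from the matching structure
  have no : ∀ x y z, x ∈ P → y ∈ P → z ∈ P → R.Adj x y → z ≠ y → ¬ R.Adj x z := by
    intro x y z hx hy hz h1 h2 h3
    exact hP1 x hx y hy z hz h2.symm h1 h3
  have q13 := no p1 p2 p3 m1 m2 m3 e12 n23.symm
  have q14 := no p1 p2 p4 m1 m2 m4 e12 n24.symm
  have q23 := no p2 p1 p3 m2 m1 m3 e12.symm n13.symm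
  have q24 := no p2 p1 p4 m2 m1 m4 e12.symm n14.symm
  have h4sub : ({p1, p2, p3, p4} : Finset V) ⊆ P := by
    intro x hx; simp at hx; rcases hx with rfl | rfl | rfl | rfl <;> assumption
  have h4card : ({p1, p2, p3, p4} : Finset V).card = 4 := by
    simp [n12, n13, n14, n23, n24, n34]
  have h5ex : (P \ {p1, p2, p3, p4}).Nonempty := by
    rw [← Finset.card_pos, Finset.card_sdiff_of_subset h4sub]; omega
  obtain ⟨p5, hp5⟩ := h5ex
  simp at hp5
  obtain ⟨m5, n51, n52, n53, n54⟩ := hp5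
  have q15 := no p1 p2 p5 m1 m2 m5 e12 n52
  have q25 := no p2 p1 p5 m2 m1 m5 e12.symm n51
  have q35 := no p3 p4 p5 m3 m4 m5 e34 n54
  have q45 := no p4 p3 p5 m4 m3 m5 e34.symm n53
  have h5sub : ({p1, p2, p3, p4, p5} : Finset V) ⊆ P := by
    intro x hx; simp at hx; rcases hx with rfl | rfl | rfl | rfl | rfl <;> assumption
  have h5card : ({p1, p2, p3, p4, p5} : Finset V).card = 5 := by
    simp [n12, n13, n14, n23, n24, n34, (Ne.symm n51), (Ne.symm n52), (Ne.symm n53), (Ne.symm n54)]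
  by_cases hc5 : P.card = 5
  · have hPe := Finset.eq_of_subset_of_card_le h5sub (by omega)
    obtain ⟨f, g1, g2, g3⟩ := enum_core R S hR hB N hN hN2 emin 7 c5 he [1,3,1,9,1] [u,p1,p2,p3,p4,p5] rfl
      (by simp) (by simp [n12, n13, n14, n23, n24, n34, (Ne.symm n51), (Ne.symm n52), (Ne.symm n53), (Ne.symm n54), huP p1 m1, huP p2 m2, huP p3 m3, huP p4 m4, huP p5 m5])
      (by intro x hx; simp at hx
          rcases hx with rfl | rfl | rfl | rfl | rfl | rfl
          · exact hu
          all_goals (apply hPS; assumption))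
      (by intro w hw x hx hwx
          simp at hw
          subst hw
          have : x ∈ P := mem_nb.2 ⟨hx, hwx⟩
          rw [← hPe] at this
          simp at this ⊢
          exact Or.inr this)
      (by intro f hf
          have f0 := hf 0 (by simp)
          have f1 := hf 1 (by simp)
          have f2 := hf 2 (by simp)
          have f3 := hf 3 (by simp)
          have f4 := hf 4 (by simp)
          have f5 := hf 5 (by simp)
          simp at f0 f1 f2 f3 f4 f5
          intro i hi
          simp at hi
          have a1 := hadj _ m1
          have a2 := hadj _ m2
          have a3 := hadj _ m3
          have a4 := hadj _ m4
          have a5 := hadj _ m5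
          interval_cases i <;> simp [M, ← f0, ← f1, ← f2, ← f3, ← f4, ← f5, a1, a2, a3, a4, a5, e12, e34, q13, q14, q15, q23, q24, q25, q35, q45] <;> decide)
      hper5 (by decide) (by intro Q h1 h2; exact h5 Q h1 h2)
    exact ⟨f, g1, g2, Or.inl g3⟩
  · have hc6 : P.card = 6 := by omega
    have h6ex : (P \ {p1, p2, p3, p4, p5}).Nonempty := by
      rw [← Finset.card_pos, Finset.card_sdiff_of_subset h5sub]; omega
    obtain ⟨p6, hp6⟩ := h6ex
    simp at hp6
    obtain ⟨m6, n61, n62, n63, n64, n65⟩ := hp6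
    have q16 := no p1 p2 p6 m1 m2 m6 e12 n62
    have q26 := no p2 p1 p6 m2 m1 m6 e12.symm n61
    have q36 := no p3 p4 p6 m3 m4 m6 e34 n64
    have q46 := no p4 p3 p6 m4 m3 m6 e34.symm n63
    have e56 : R.Adj p5 p6 := by
      by_contra hne
      have cc : ∀ x y, x ≠ y → ¬ R.Adj x y → Rᶜ.Adj x y := fun x y h1 h2 => by
        rw [SimpleGraph.compl_adj]; exact ⟨h1, h2⟩
      exact hP4 p1 m1 p5 m5 p6 m6 p3 m3 p4 m4 n34 (cc _ _ (Ne.symm n51) q15) (cc _ _ (Ne.symm n61) q16) (cc _ _ (Ne.symm n65) hne)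
        (cc _ _ n13 q13) (cc _ _ n53 (fun h => q35 h.symm)) (cc _ _ n63 (fun h => q36 h.symm))
        (cc _ _ n14 q14) (cc _ _ n54 (fun h => q45 h.symm)) (cc _ _ n64 (fun h => q46 h.symm))
    have h6sub : ({p1, p2, p3, p4, p5, p6} : Finset V) ⊆ P := by
      intro x hx; simp at hx; rcases hx with rfl | rfl | rfl | rfl | rfl | rfl <;> assumption
    have h6card : ({p1, p2, p3, p4, p5, p6} : Finset V).card = 6 := by
      simp [n12, n13, n14, n23, n24, n34, (Ne.symm n51), (Ne.symm n52), (Ne.symm n53), (Ne.symm n54), (Ne.symm n61), (Ne.symm n62), (Ne.symm n63), (Ne.symm n64), (Ne.symm n65)]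
    have hPe := Finset.eq_of_subset_of_card_le h6sub (by omega)
    obtain ⟨f, g1, g2, g3⟩ := enum_core R S hR hB N hN hN2 emin 9 c6 he [1,3,1,9,1,33] [u,p1,p2,p3,p4,p5,p6] rfl
      (by simp) (by simp [n12, n13, n14, n23, n24, n34, (Ne.symm n51), (Ne.symm n52), (Ne.symm n53), (Ne.symm n54), (Ne.symm n61), (Ne.symm n62), (Ne.symm n63), (Ne.symm n64), (Ne.symm n65), huP p1 m1, huP p2 m2, huP p3 m3, huP p4 m4, huP p5 m5, huP p6 m6])
      (by intro x hx; simp at hx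
          rcases hx with rfl | rfl | rfl | rfl | rfl | rfl | rfl
          · exact hu
          all_goals (apply hPS; assumption))
      (by intro w hw x hx hwx
          simp at hw
          subst hw
          have : x ∈ P := mem_nb.2 ⟨hx, hwx⟩
          rw [← hPe] at this
          simp at this ⊢
          exact Or.inr this)
      (by intro f hf
          have f0 := hf 0 (by simp)
          have f1 := hf 1 (by simp)
          have f2 := hf 2 (by simp)
          have f3 := hf 3 (by simp)
          have f4 := hf 4 (by simp)
          have f5 := hf 5 (by simp)
          have f6 := hf 6 (by simp)
          simp at f0 f1 f2 f3 f4 f5 f6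
          intro i hi
          simp at hi
          have a1 := hadj _ m1
          have a2 := hadj _ m2
          have a3 := hadj _ m3
          have a4 := hadj _ m4
          have a5 := hadj _ m5
          have a6 := hadj _ m6
          interval_cases i <;> simp [M, ← f0, ← f1, ← f2, ← f3, ← f4, ← f5, ← f6, a1, a2, a3, a4, a5, a6, e12, e34, e56, q13, q14, q15, q16, q23, q24, q25, q26, q35, q36, q45, q46] <;> decide)
      hper6 (by decide) (by intro Q h1 h2; exact h6 Q h1 h2)
    exact ⟨f, g1, g2, Or.inr g3⟩

end GRP

set_option linter.all false
namespace GRP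
open scoped Classical
variable {V : Type*}

def EB (R : SimpleGraph V) (m k : ℕ) : Prop := ∀ S : Finset V, S.card = m → Fr 3 R S → Fr 4 Rᶜ S → ed R S ≤ 2 * k

theorem ed_even (R : SimpleGraph V) (S : Finset V) : ∃ t, ed R S = 2 * t := by
  obtain ⟨t, ht⟩ := even_deg R S
  exact ⟨t, by unfold ed; omega⟩

theorem ed_erase (R : SimpleGraph V) (S : Finset V) {v : V} (hv : v ∈ S) :
    ed R (S.erase v) + 2 * (nb R S v).card = ed R S := by
  have h := ed_insert R (S.erase v) v (by simp)
  rw [Finset.insert_erase hv] at h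
  have : nb R (S.erase v) v = nb R S v := by
    ext y; simp only [mem_nb, Finset.mem_erase]
    constructor
    · rintro ⟨⟨h1, h2⟩, h3⟩; exact ⟨h2, h3⟩
    · rintro ⟨h1, h2⟩; exact ⟨⟨h2.ne.symm, h1⟩, h2⟩
  rw [this] at h; omega

theorem EB.avg {R : SimpleGraph V} {m k : ℕ} (h : EB R m k) (S : Finset V) (hS : S.card = m + 1)
    (h3 : Fr 3 R S) (h4 : Fr 4 Rᶜ S) : (m + 1) * ed R S ≤ (m + 1) * (2 * k) + 2 * ed R S := by
  have h1 : ∑ v ∈ S, (ed R (S.erase v) + 2 * (nb R S v).card) = ∑ v ∈ S, ed R S :=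
    Finset.sum_congr rfl fun v hv => ed_erase R S hv
  rw [Finset.sum_add_distrib, ← Finset.mul_sum, Finset.sum_const, smul_eq_mul, hS] at h1
  have h2 : ∑ v ∈ S, ed R (S.erase v) ≤ S.card • (2 * k) := by
    apply Finset.sum_le_card_nsmul
    intro v hv
    exact h _ (by rw [Finset.card_erase_of_mem hv, hS]; rfl) (h3.mono (Finset.erase_subset _ _)) (h4.mono (Finset.erase_subset _ _))
  rw [hS, smul_eq_mul] at h2
  have : ∑ v ∈ S, (nb R S v).card = ed R S := rfl
  rw [this] at h1
  rw [← h1]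
  omega

theorem EB3 (R : SimpleGraph V) : EB R 3 3 := by
  intro S hS _ _
  have : ed R S ≤ S.card • 2 := by
    apply Finset.sum_le_card_nsmul
    intro v hv
    have : (nb R S v).card ≤ (S.erase v).card := by
      apply Finset.card_le_card
      intro y hy
      rw [mem_nb] at hy
      exact Finset.mem_erase.2 ⟨hy.2.ne.symm, hy.1⟩
    rw [Finset.card_erase_of_mem hv, hS] at this
    exact this
  rw [hS] at this; simpa using this

theorem EB4 (R : SimpleGraph V) : EB R 4 4 := by
  intro S hS h3 _
  by_contra hc
  push Not at hc
  have : ∃ v ∈ S, 3 ≤ (nb R S v).card := by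
    by_contra hn
    push Not at hn
    have : ed R S ≤ S.card • 2 := by
      apply Finset.sum_le_card_nsmul
      intro v hv; have := hn v hv; omega
    rw [hS] at this; simp at this; omega
  obtain ⟨v, hv, hd⟩ := this
  have h1 : nb R S v ⊆ S.erase v := by
    intro y hy
    rw [mem_nb] at hy
    exact Finset.mem_erase.2 ⟨hy.2.ne.symm, hy.1⟩
  have hc3 : (S.erase v).card = 3 := by rw [Finset.card_erase_of_mem hv, hS]
  have h2 := Finset.eq_of_subset_of_card_le h1 (by omega)
  have hF : Fr 1 R (nb R S v) := jn3 (sing_sub hv) (nb_sub ..) jn_nb h3 (by simp)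
  rw [h2] at hF
  have h4 : ed R (S.erase v) ≤ (S.erase v).card • 1 := by
    apply Finset.sum_le_card_nsmul
    intro x hx
    rw [Finset.card_le_one]
    intro y hy z hz
    rw [mem_nb] at hy hz
    by_contra hyz
    exact hF x hx y hy.1 z hz.1 hyz hy.2 hz.2
  rw [hc3] at h4
  simp at h4
  obtain ⟨t, ht⟩ := ed_even R (S.erase v)
  have h5 := ed_erase R S hv
  rw [h2, hc3] at h5
  omega

theorem EB.next {R : SimpleGraph V} {m k k' : ℕ} (h : EB R m k) (hm : 2 ≤ m) (hk : (m+1) * k < (m-1) * (k'+1)) :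
    EB R (m+1) k' := by
  intro S hS h3 h4
  have h1 := h.avg S hS h3 h4
  obtain ⟨t, ht⟩ := ed_even R S
  by_contra hc
  have ht' : k' + 1 ≤ t := by omega
  rw [ht] at h1
  obtain ⟨n, rfl⟩ : ∃ n, m = n + 2 := ⟨m-2, by omega⟩
  have e : n + 2 - 1 = n + 1 := by omega
  rw [e] at hk
  nlinarith

theorem EB5 (R : SimpleGraph V) : EB R 5 6 := (EB4 R).next (by omega) (by omega)
theorem EB6 (R : SimpleGraph V) : EB R 6 9 := (EB5 R).next (by omega) (by omega)
theorem EB7 (R : SimpleGraph V) : EB R 7 12 := (EB6 R).next (by omega) (by omega)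
theorem EB8 (R : SimpleGraph V) : EB R 8 16 := (EB7 R).next (by omega) (by omega)
theorem EB9 (R : SimpleGraph V) : EB R 9 20 := (EB8 R).next (by omega) (by omega)

theorem enum10a : (enumG [1,3,1,9,1] 10 (22-7-4) (22-7)).length = 0 := by decide +kernel
theorem enum10b : (enumG [1,3,1,9,1,33] 10 (22-9-3) (22-9)).length = 0 := by decide +kernel

theorem EB10 (R : SimpleGraph V) : EB R 10 21 := by
  intro S hS h3 h4
  by_contra hc
  obtain ⟨t, ht⟩ := ed_even R S
  obtain ⟨f, h1, h2, h⟩ := enum_graph R S h3 h4 10 hS (by omega) 22 4 3 (by omega) (by omega)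
    (fun Q hQ hc => EB4 R Q (by omega) (h3.mono hQ) (h4.mono hQ))
    (fun Q hQ hc => EB3 R Q (by omega) (h3.mono hQ) (h4.mono hQ))
  rcases h with h | h
  · rw [List.length_eq_zero_iff.1 enum10a] at h; simp at h
  · rw [List.length_eq_zero_iff.1 enum10b] at h; simp at h

theorem EB11 (R : SimpleGraph V) : EB R 11 25 := (EB10 R).next (by omega) (by omega)
theorem EB12 (R : SimpleGraph V) : EB R 12 30 := (EB11 R).next (by omega) (by omega)
theorem EB13 (R : SimpleGraph V) : EB R 13 35 := (EB12 R).next (by omega) (by omega)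
theorem EB14 (R : SimpleGraph V) : EB R 14 40 := (EB13 R).next (by omega) (by omega)
theorem EB15 (R : SimpleGraph V) : EB R 15 46 := (EB14 R).next (by omega) (by omega)
theorem EB16 (R : SimpleGraph V) : EB R 16 52 := (EB15 R).next (by omega) (by omega)

/-- Goodman-type identity. -/
theorem goodman (R : SimpleGraph V) (S : Finset V) :
    ∑ v ∈ S, ((ed R (nb R S v) : ℤ) + ed Rᶜ (nb Rᶜ S v) +
      3 * (nb R S v).card * ((S.card : ℤ) - 1 - (nb R S v).card)) = S.card * (S.card - 1) * (S.card - 2) := by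
  set a : V → V → ℤ := fun x y => if R.Adj x y then 1 else 0 with ha
  set d : V → V → ℤ := fun x y => if x = y then 0 else 1 with hd
  have hcard : ∀ (G : SimpleGraph V) (T : Finset V) (v : V), ((nb G T v).card : ℤ) = ∑ x ∈ T, if G.Adj v x then 1 else 0 := by
    intro G T v
    rw [← Finset.sum_filter, Finset.sum_const, nsmul_eq_mul, mul_one]
    congr 2
  have hsum : ∀ (G : SimpleGraph V) (v : V) (g : V → ℤ), ∑ x ∈ nb G S v, g x = ∑ x ∈ S, (if G.Adj v x then 1 else 0) * g x := by
    intro G v g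
    have : nb G S v = S.filter (fun x => G.Adj v x) := by ext y; simp [mem_nb]
    rw [this, Finset.sum_filter]
    apply Finset.sum_congr rfl
    intro x _; split_ifs <;> simp
  have hed : ∀ (G : SimpleGraph V) (v : V), (ed G (nb G S v) : ℤ) = ∑ x ∈ S, ∑ y ∈ S,
      (if G.Adj v x then 1 else 0) * ((if G.Adj v y then 1 else 0) * (if G.Adj x y then 1 else 0)) := by
    intro G v
    unfold ed
    push_cast
    rw [hsum]
    apply Finset.sum_congr rfl
    intro x _
    rw [hcard, hsum, Finset.mul_sum]
  have hc : ∀ (G : SimpleGraph V), G = Rᶜ → ∀ x y, (if G.Adj x y then (1:ℤ) else 0) = d x y - a x y := by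
    intro G hG x y
    subst hG
    simp only [hd, ha, SimpleGraph.compl_adj]
    by_cases h : x = y
    · subst h; simp
    · by_cases h2 : R.Adj x y <;> simp [h, h2]
  have as : ∀ x y, a x y = a y x := by intro x y; simp only [ha, R.adj_comm]
  have ds : ∀ x y, d x y = d y x := by intro x y; simp only [hd, eq_comm]
  have ad : ∀ x y, a x y * d x y = a x y := by
    intro x y; simp only [ha, hd]
    by_cases h : x = y
    · subst h; simp
    · simp [h]
  have dd : ∀ x y, d x y * d x y = d x y := by
    intro x y; simp only [hd]; split_ifs <;> simp
  have aa : ∀ x y, a x y * a x y = a x y := by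
    intro x y; simp only [ha]; split_ifs <;> simp
  -- row sums
  have dsum : ∀ x ∈ S, ∑ y ∈ S, d x y = (S.card : ℤ) - 1 := by
    intro x hx
    rw [← Finset.add_sum_erase S _ hx]
    have : ∑ y ∈ S.erase x, d x y = ∑ y ∈ S.erase x, (1:ℤ) := by
      apply Finset.sum_congr rfl
      intro y hy
      simp [hd, (Finset.mem_erase.1 hy).1.symm]
    rw [this]
    simp [hd, Finset.card_erase_of_mem hx]
    rw [Nat.cast_sub (Finset.card_pos.2 ⟨x, hx⟩)]; simp
  -- common non-equal sums: for y≠v,  ∑ x d v x * d x y = n-2, if v = y then n-1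
  have dprod : ∀ v ∈ S, ∀ y ∈ S, ∑ x ∈ S, d v x * d x y = (S.card : ℤ) - 1 - d v y := by
    intro v hv y hy
    have : ∀ x, d v x * d x y = d v x - (if x = y then d v y else 0) := by
      intro x
      simp only [hd]
      by_cases h1 : x = y
      · subst h1; simp
      · simp [h1]
    simp only [this, Finset.sum_sub_distrib, dsum v hv]
    rw [Finset.sum_ite_eq' S y]; simp [hy]
  have deg : ∀ v, ((nb R S v).card : ℤ) = ∑ x ∈ S, a v x := fun v => hcard R S v
  -- three sums
  set n : ℤ := (S.card : ℤ) with hn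
  have T1 : ∑ v ∈ S, ∑ x ∈ S, ∑ y ∈ S, d v x * (d v y * d x y) = n * (n-1) * (n-2) := by
    have : ∀ v ∈ S, ∑ x ∈ S, ∑ y ∈ S, d v x * (d v y * d x y) = (n-1)*(n-2) := by
      intro v hv
      have h1 : ∀ x ∈ S, ∑ y ∈ S, d v x * (d v y * d x y) = d v x * (n-2) := by
        intro x hx
        rw [← Finset.mul_sum]
        have : ∑ y ∈ S, d v y * d x y = n - 1 - d v x := by
          rw [← dprod v hv x hx]; apply Finset.sum_congr rfl; intro y _; rw [ds x y]
        rw [this, mul_sub, dd]; ring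
      rw [Finset.sum_congr rfl h1, ← Finset.sum_mul, dsum v hv]
    rw [Finset.sum_congr rfl this]; simp; ring
  have T2 : ∀ v ∈ S, ∑ x ∈ S, ∑ y ∈ S, a v x * (d v y * d x y) = (∑ x ∈ S, a v x) * (n-2) := by
    intro v hv
    rw [Finset.sum_mul]
    apply Finset.sum_congr rfl
    intro x hx
    rw [← Finset.mul_sum]
    have : ∑ y ∈ S, d v y * d x y = n - 1 - d v x := by
      rw [← dprod v hv x hx]; apply Finset.sum_congr rfl; intro y _; rw [ds x y]
    rw [this, mul_sub, ad]; ring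
  have T3 : ∀ v ∈ S, ∑ x ∈ S, ∑ y ∈ S, a v x * (a v y * d x y) = (∑ x ∈ S, a v x) * ((∑ x ∈ S, a v x) - 1) := by
    intro v hv
    rw [Finset.sum_mul]
    apply Finset.sum_congr rfl
    intro x hx
    rw [← Finset.mul_sum]
    have h1 : ∀ y, a v y * d x y = a v y - (if x = y then a v x else 0) := by
      intro y; simp only [hd]; by_cases h : x = y
      · subst h; simp
      · simp [h]
    have : ∑ y ∈ S, a v y * d x y = ∑ y ∈ S, a v y - a v x := by
      simp only [h1, Finset.sum_sub_distrib]
      rw [Finset.sum_ite_eq S x]; simp [hx]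
    rw [this, mul_sub, aa]; ring
  -- cyclic symmetry
  have rot : ∀ F : V → V → V → ℤ, ∑ v ∈ S, ∑ x ∈ S, ∑ y ∈ S, F v x y = ∑ v ∈ S, ∑ x ∈ S, ∑ y ∈ S, F y v x := by
    intro F
    rw [Finset.sum_comm]
    have : ∑ v ∈ S, ∑ x ∈ S, ∑ y ∈ S, F y v x = ∑ v ∈ S, ∑ y ∈ S, ∑ x ∈ S, F y v x :=
      Finset.sum_congr rfl fun v _ => Finset.sum_comm
    rw [this]
  have key : ∑ v ∈ S, ((ed R (nb R S v) : ℤ) + ed Rᶜ (nb Rᶜ S v)) =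
      n*(n-1)*(n-2) - 3 * ∑ v ∈ S, ∑ x ∈ S, ∑ y ∈ S, a v x * (d v y * d x y)
        + 3 * ∑ v ∈ S, ∑ x ∈ S, ∑ y ∈ S, a v x * (a v y * d x y) := by
    have e0 : ∀ v x y, a v x * (a v y * a x y) + (d v x - a v x) * ((d v y - a v y) * (d x y - a x y)) =
        d v x * (d v y * d x y) - (a v x * (d v y * d x y) + a x y * (d x v * d y v) + a y v * (d y x * d v x))
          + (a v x * (a v y * d x y) + a x y * (a x v * d y v) + a y v * (a y x * d v x)) := by
      intro v x y
      rw [ds x v, ds y v, ds y x, as x v, as y v, as y x]; ring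
    have r1 := rot (fun v x y => a v x * (d v y * d x y))
    have r2 := rot (fun v x y => a y v * (d y x * d v x))
    have s1 := rot (fun v x y => a v x * (a v y * d x y))
    have s2 := rot (fun v x y => a y v * (a y x * d v x))
    have e1 : ∑ v ∈ S, ((ed R (nb R S v) : ℤ) + ed Rᶜ (nb Rᶜ S v)) = ∑ v ∈ S, ∑ x ∈ S, ∑ y ∈ S,
        (a v x * (a v y * a x y) + (d v x - a v x) * ((d v y - a v y) * (d x y - a x y))) := by
      apply Finset.sum_congr rfl
      intro v _
      rw [hed, hed]
      simp only [hc Rᶜ rfl]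
      rw [← Finset.sum_add_distrib]
      apply Finset.sum_congr rfl
      intro x _
      rw [← Finset.sum_add_distrib]
    rw [e1]
    simp only [e0, Finset.sum_add_distrib, Finset.sum_sub_distrib]
    rw [T1]
    beta_reduce at r1 r2 s1 s2
    linarith
  have fin : ∑ v ∈ S, (3 * ((nb R S v).card : ℤ) * (n - 1 - (nb R S v).card)) =
      3 * ∑ v ∈ S, ∑ x ∈ S, ∑ y ∈ S, a v x * (d v y * d x y)
        - 3 * ∑ v ∈ S, ∑ x ∈ S, ∑ y ∈ S, a v x * (a v y * d x y) := by
    rw [Finset.sum_congr rfl T2, Finset.sum_congr rfl T3, ← mul_sub, ← Finset.sum_sub_distrib, Finset.mul_sum]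
    apply Finset.sum_congr rfl
    intro v _
    rw [deg]; ring
  rw [Finset.sum_add_distrib, key, fin]
  ring

end GRP

set_option linter.all false
namespace GRP
open scoped Classical
variable {V : Type*}

/-! Canonical forms of the leaves of the enumeration. -/
def ladj (rows : List ℕ) (N i j : ℕ) : Bool :=
  bif Nat.blt i j then (rows.getD (N-1-j) 0).testBit i else
  bif Nat.blt j i then (rows.getD (N-1-i) 0).testBit j else false

def dig (c a : ℕ) : ℕ := Nat.mod (Nat.shiftRight c (Nat.mul 4 a)) 16

def chkLeaf (N : ℕ) (g : List ℕ) (c : ℕ) (rows : List ℕ) : Bool :=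
  (List.range N).all fun a => Nat.blt (dig c a) N && (List.range N).all fun b =>
    ((g.getD a 0).testBit b == ladj rows N (dig c a) (dig c b)) && (Nat.beq a b || !(Nat.beq (dig c a) (dig c b)))

def chkAll (N : ℕ) (gs : List (List ℕ)) : List (List ℕ) → List ℕ → Bool
  | [], _ => true
  | _ :: _, [] => false
  | r :: rs, c :: cs => (Nat.blt (dig c N) gs.length && chkLeaf N (gs.getD (dig c N) []) c r) && chkAll N gs rs cs

theorem RW_get {a : ℕ → ℕ → Prop} : ∀ (N j : ℕ), j < N → (RW a N).getD (N-1-j) 0 = M a j j := by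
  intro N
  induction N with
  | zero => intro j hj; omega
  | succ n ih =>
    intro j hj
    by_cases h : j = n
    · subst h; simp [RW]
    · have e : n + 1 - 1 - j = (n - 1 - j) + 1 := by omega
      rw [e, RW, List.getD_cons_succ]
      exact ih j (by omega)

theorem ladj_RW {a : ℕ → ℕ → Prop} (hs : ∀ i j, a i j → a j i) (hi : ∀ i, ¬ a i i) {N i j : ℕ} (h1 : i < N) (h2 : j < N) :
    ladj (RW a N) N i j = true ↔ a i j := by
  unfold ladj
  rw [RW_get N j h2, RW_get N i h1]
  by_cases h : i < j
  · have : Nat.blt i j = true := by simpa [Nat.blt_eq] using h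
    rw [this, cond_true, M_tb]; simp [h]
  · have : Nat.blt i j = false := by rw [← Bool.not_eq_true, Nat.blt_eq]; exact h
    rw [this, cond_false]
    by_cases h' : j < i
    · have : Nat.blt j i = true := by simpa [Nat.blt_eq] using h'
      rw [this, cond_true, M_tb]
      exact ⟨fun q => hs _ _ q.2, fun q => ⟨h', hs _ _ q⟩⟩
    · have : Nat.blt j i = false := by rw [← Bool.not_eq_true, Nat.blt_eq]; exact h'
      rw [this, cond_false]
      have e : i = j := by omega
      subst e; simp [hi]

theorem chkLeaf_sound (R : SimpleGraph V) (S : Finset V) {N : ℕ} {g : List ℕ} {c : ℕ} {f : ℕ → V}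
    (hf : ∀ i < N, f i ∈ S) (hinj : ∀ i < N, ∀ j < N, f i = f j → i = j)
    (h : chkLeaf N g c (RW (fun i j => R.Adj (f i) (f j)) N) = true) :
    ∃ f' : ℕ → V, (∀ i < N, f' i ∈ S) ∧ (∀ i < N, ∀ j < N, f' i = f' j → i = j) ∧
      ∀ i < N, ∀ j < N, ((g.getD i 0).testBit j = true ↔ R.Adj (f' i) (f' j)) := by
  unfold chkLeaf at h
  simp only [List.all_eq_true, List.mem_range, Bool.and_eq_true, Nat.blt_eq, beq_iff_eq, Bool.or_eq_true,
    Bool.not_eq_true'] at h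
  refine ⟨fun i => f (dig c i), fun i hi => hf _ (h i hi).1, ?_, ?_⟩
  · intro i hi j hj e
    have := hinj _ (h i hi).1 _ (h j hj).1 e
    rcases ((h i hi).2 j hj).2 with h1 | h1
    · exact Nat.eq_of_beq_eq_true h1
    · exact absurd this (Nat.ne_of_beq_eq_false h1)
  · intro i hi j hj
    rw [((h i hi).2 j hj).1]
    exact ladj_RW (a := fun i j => R.Adj (f i) (f j)) (fun _ _ q => q.symm) (fun _ => R.loopless.irrefl _) (h i hi).1 (h j hj).1

theorem getD_mem' {gs : List (List ℕ)} {i : ℕ} (h : i < gs.length) : gs.getD i [] ∈ gs := by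
  rw [List.getD_eq_getElem _ _ h]; exact List.getElem_mem h

theorem chkAll_sound (R : SimpleGraph V) (S : Finset V) {N : ℕ} (hN : 2 ≤ N) {gs : List (List ℕ)} {f : ℕ → V}
    (hf : ∀ i < N, f i ∈ S) (hinj : ∀ i < N, ∀ j < N, f i = f j → i = j) : ∀ (L : List (List ℕ)) (cs : List ℕ),
    chkAll N gs L cs = true → RW (fun i j => R.Adj (f i) (f j)) N ∈ L →
    ∃ g, g ∈ gs ∧ ∃ f' : ℕ → V, (∀ i < N, f' i ∈ S) ∧ (∀ i < N, ∀ j < N, f' i = f' j → i = j) ∧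
      ∀ i < N, ∀ j < N, ((g.getD i 0).testBit j = true ↔ R.Adj (f' i) (f' j)) := by
  intro L
  induction L with
  | nil => intro cs _ h; simp at h
  | cons r rs ih =>
    intro cs h hm
    cases cs with
    | nil => simp [chkAll] at h
    | cons c cs =>
      rw [chkAll, Bool.and_eq_true] at h
      rcases List.mem_cons.1 hm with h1 | h1
      · rw [← h1] at h
        rw [Bool.and_eq_true, Nat.blt_eq] at h
        exact ⟨_, getD_mem' h.1.1, chkLeaf_sound R S hf hinj h.1.2⟩
      · exact ih cs h.2 h1

def gs11 : List (List ℕ) :=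
  [[156, 356, 1539, 705, 801, 1170, 1290, 1321, 722, 1308, 740],
   [194, 1793, 616, 788, 1352, 1412, 1173, 865, 186, 1166, 626],
   [194, 1793, 840, 1412, 1376, 912, 661, 1129, 62, 1126, 666],
   [194, 1793, 840, 1412, 1376, 912, 1557, 1577, 62, 230, 218],
   [284, 612, 1155, 1345, 1569, 1298, 1546, 1796, 681, 466, 252],
   [390, 649, 1297, 1314, 676, 1560, 1920, 1107, 589, 370, 236],
   [390, 649, 1297, 1570, 1572, 408, 1920, 1123, 613, 346, 220],
   [550, 1097, 657, 1298, 396, 1409, 898, 1140, 632, 1349, 682],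
   [582, 1161, 1297, 802, 676, 1112, 1569, 1554, 1548, 473, 486],
   [610, 1409, 1128, 900, 480, 789, 1173, 602, 1082, 1193, 838],
   [1158, 777, 785, 418, 708, 1672, 1424, 121, 1102, 1078, 865],
   [1218, 1793, 1352, 1668, 1632, 1424, 405, 617, 614, 410, 63]]
def gs12 : List (List ℕ) :=
  [[60, 960, 1225, 2821, 2273, 1809, 1558, 2326, 1194, 2154, 2404, 1688],
   [62, 1221, 2819, 2257, 1801, 961, 1578, 2346, 1204, 2164, 2386, 1676],
   [240, 816, 3264, 3840, 1347, 2691, 2581, 1317, 2202, 1130, 668, 364],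
   [306, 593, 1192, 2244, 3203, 1349, 2602, 796, 2721, 1474, 2612, 1368]]
def ct11a : List ℕ :=
  [22026112082231,22026096353591,5106870785650,5038168086130,28939558222211,27840046594691,128654161376387,
   26749093451681,163862836295569,163862819518369,25649581824161,163858541328529,163858524551329,
   19835660944151,19835645215511,2839109318260,2770406618740,128662249050737,28943822780801,27844311153281,
   128658505626257,27840029816996,128653625553812,26740518189476,180940051064090,181008770540825,
   116563073374246,179840823731480,114368060922151,179772104254745,19827088831511,19827073102871,
   2907845445235,2839142745715,64391881171288,46489272673137,45389762093937,81571199133569,127105350394247,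
   109375710074386,46283382678132,126070260196487,186324322888325,80402162792324,108271853151811,
   45183872098932,56180864213653,56180595778213,187359427762565,46352370594147,45252860014947,81433240094339,
   124906325177222,107107933787956,45329362023522,36329305437222,38528295133767,62715939218008,
   205140800140386,128264990454422,39619502108982,17904146938166,17903878502966,39619233739062,17706326980646,
   17843463809351,176135036369285,37420512404247,17766473230871,17766741666071,37420244034327,17706058545446,
   17843732244551,176006218869125,79440643757714,110397895583521,63807145013593,203015060808561,
   176078678555285,176207496178325,62707633385818,202946342380401,44229851444322,36329037067302,
   38528026763847,61616427590233,205072081712226,46799695126872,46799944565592,22635025237361,22703743665521,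
   91976800495905,29206687913816,90808519060020,19336758723956,28175624259416,19405477152116,20509552117091,
   20440833688931,29206165861976,89773448722755,181549830535,314154918790,318449881990,177254867335,
   27076668237401,169610271888739,168510760265059,21539538117986,245167981735,103973098150,168308930544994,
   167337999373684,92934562478610,168381642941809,169481154565489,21470819689826,108268061350,240873018535,
   167209418921314,168437510997364,20935154737481,3869887829650,163871124244849,163866829277809,
   20935139008841,3801185130130,163871107467649,163866812500609,22026112078391,22026096349751,5106870789745,
   5038168090225,18736149316391,18736133587751,1739598739060,1670896039540,177710486275385,115458949068871,
   177641766798650,178740994262330,178809713739065,116554449893446,28935264303491,27835752675971,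
   128649882137747,26749076674466,163862835246994,163862818469794,128661980615042,25649565046946,
   163858540279954,163858523502754,28943806003586,128658237190562,27844294376066,18727577203751,
   18727561475111,1808334866035,1739632166515,63361341661528,81571199129474,127105350328967,109375710074401,
   46489004237682,45389493658482,187359426718085,81501691135619,126005835756422,108207428638516,
   46283651117667,45184140538467,45329630458977,37428817064982,38528311910727,62715955994968,205141068575841,
   128264990519702,17775046457366,17843480521031,176139314559365,39619485332022,17904130226486,17903861791286,
   39619216962102,17774778022166,17843748956231,176074937297285,36321000776487,17697753754151,17698022189351,
   36320732406567,79440643761809,110397895583506,44230119879777,37428548695062,38528043540807,61616444367193,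
   205072350147681,63807128236633,203014792373106,176009960127125,176203217988245,62707616608858,
   202946073944946,46352102154612,124970749617287,186324323932805,45252591575412,80333711751044,
   107172358301251,45769155617112,46799945548632,91976800495890,29206687852376,22634756801906,22703475230066,
   29206433248856,90872943573315,19410040554851,19341322126691,112830354055,313887531910,318182495110,
   108535390855,27076668298841,21539806553441,245435368615,172692574630,168377650021729,167342294275444,
   169605976986979,168506465363299,92934562478625,21471088125281,176987537830,241140405415,167278138398049,
   168441805899124,168312923465074,169412435088754,20436270286196,89709024209460,20504988714356,
   28175356872536,177710486271305,115458949072951,177641766794570,57276079768213,57275811332773,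
   178740994258250,178809713734985,116554449897526,57340236890533,57340505325973,20935154733641,3869887833745,
   163871123196274,163866828229234,20935139005001,3801185134225,163871106419074,163866811452034,
   27835735898276,26736224270756,128649346315172,180940051060010,181008770536745,116563073378326,
   56245289771413,56245021335973,179840823727400,114368060926231,179772104250665]
def ct11b : List ℕ :=
  [151759489292673,71031800931719,70962546811799,71096272565639,70893324026264,150659693566578,70957496873639,
   70889280705704,194233610158881,71091474289559,71086644679064,71021952717479,149552130046578,70885520381609,
   194233859597601,71018192393384,70949976225449,194238135559491,148448341281153,151759472515458,
   71031817704839,70962563584919,71096273548679,70893055591064,150659710343793,70957765308839,70889263932584,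
   194105265439521,71091475272599,71086376243864,71022221152679,149552146823793,70885503608489,
   194169687729441,71018191410344,70949975242409,194238136542531,148448324503938]
def ct12a : List ℕ :=
  [944756341966449,943656847115889,943450387875444,942350893024884,943518873388899,944618368239459,
   941389338355554,88530570818166,88530839249526,942488833206114,88599290229366,88599558660726,
   902395553942049,198368759980161,180780868903041,674772152260673,1024270059091074,177473727443076,
   1006746592523394,159885836365956,1025511036261249,1043034502828929,865016469293379,692231444932658,
   178650530529411,196238421606531,144557130584226,395526093943312,395461669433872,162145021661346,
   395525842285072,395461417775632,944756340917874,943656846067314,943450422347619,944549917198179,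
   941389339404129,88530587595126,88530856026486,942488834254689,88599307006326,88599575437686,
   943518838916724,942419344066164,918759395076129,198368759976066,180780868898946,1025506741293954,
   1043030207861634,692231461709873,177551035678851,195138926755971,144557130588321,411808633668112,
   411808885326352,162145021665441,411873058177552,411873309835792,674772135483458,881509143713859,
   1024274354058369,178573222293636,1006750887490689,160985331216516]

theorem chk11a : chkAll 11 gs11 (enumG [1,3,1,9,1] 11 11 17) ct11a = true := by decide +kernel
theorem chk11b : chkAll 11 gs11 (enumG [1,3,1,9,1,33] 11 11 15) ct11b = true := by decide +kernel
theorem chk12a : chkAll 12 gs12 (enumG [1,3,1,9,1] 12 12 21) ct12a = true := by decide +kernel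
theorem chk12b : chkAll 12 gs12 (enumG [1,3,1,9,1,33] 12 13 19) [] = true := by decide +kernel

theorem canon11 (R : SimpleGraph V) (S : Finset V) (hR : Fr 3 R S) (hB : Fr 4 Rᶜ S) (hN : S.card = 11)
    (he : 48 ≤ ed R S) : ∃ g, g ∈ gs11 ∧ ∃ f' : ℕ → V, (∀ i < 11, f' i ∈ S) ∧
      (∀ i < 11, ∀ j < 11, f' i = f' j → i = j) ∧
      ∀ i < 11, ∀ j < 11, ((g.getD i 0).testBit j = true ↔ R.Adj (f' i) (f' j)) := by
  obtain ⟨f, h1, h2, h3⟩ := enum_graph R S hR hB 11 hN (by omega) 24 6 4 (by omega) (by omega)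
    (fun Q hQ hc => EB5 R Q (by omega) (hR.mono hQ) (hB.mono hQ))
    (fun Q hQ hc => EB4 R Q (by omega) (hR.mono hQ) (hB.mono hQ))
  rcases h3 with h3 | h3
  · exact chkAll_sound R S (by omega) h1 h2 _ _ chk11a h3
  · exact chkAll_sound R S (by omega) h1 h2 _ _ chk11b h3

theorem canon12 (R : SimpleGraph V) (S : Finset V) (hR : Fr 3 R S) (hB : Fr 4 Rᶜ S) (hN : S.card = 12)
    (he : 56 ≤ ed R S) : ∃ g, g ∈ gs12 ∧ ∃ f' : ℕ → V, (∀ i < 12, f' i ∈ S) ∧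
      (∀ i < 12, ∀ j < 12, f' i = f' j → i = j) ∧
      ∀ i < 12, ∀ j < 12, ((g.getD i 0).testBit j = true ↔ R.Adj (f' i) (f' j)) := by
  obtain ⟨f, h1, h2, h3⟩ := enum_graph R S hR hB 12 hN (by omega) 28 9 6 (by omega) (by omega)
    (fun Q hQ hc => EB6 R Q (by omega) (hR.mono hQ) (hB.mono hQ))
    (fun Q hQ hc => EB5 R Q (by omega) (hR.mono hQ) (hB.mono hQ))
  rcases h3 with h3 | h3
  · exact chkAll_sound R S (by omega) h1 h2 _ _ chk12a h3
  · exact chkAll_sound R S (by omega) h1 h2 _ _ chk12b h3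
end GRP

set_option linter.all false
namespace GRP
open scoped Classical
variable {V : Type*}

/-! Cones over a fixed neighbourhood. -/
structure Cn (a : ℕ → ℕ → Prop) (u : ℕ → Prop) (N : ℕ) : Prop where
  t3 : ∀ x < N, ∀ y < N, ∀ z < N, a x y → a x z → a y z → u x → u y → u z → False
  i4 : ∀ x < N, ∀ y < N, ∀ z < N, ∀ t < N, nb' a x y → nb' a x z → nb' a y z → nb' a x t → nb' a y t →
    nb' a z t → ¬ u x → ¬ u y → ¬ u t → False
  e4 : ∀ x < N, ∀ y < N, ∀ z < N, ∀ t < N, a x y → nb' a x z → nb' a y z → nb' a x t → nb' a y t →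
    nb' a z t → ¬ u x → ¬ u y → ¬ u z → ¬ u t → False

def inOk (s : St) (S m : ℕ) : Bool :=
  (s.Ed.all fun E => !(Nat.beq (Nat.land E (Nat.land S m)) E)) &&
  (s.I3.all fun T => !(Nat.beq (Nat.land T (Nat.lor S m)) 0))
def outOk (s : St) (S m : ℕ) : Bool :=
  (s.I3.all fun T => !(Nat.beq (Nat.land T S) 0 && am1 (Nat.land T m)) &&
     !(am1 (Nat.land T S) && Nat.beq (Nat.land T m) 0)) &&
  (s.N3.all fun T => !(Nat.beq (Nat.land T (Nat.lor S m)) 0))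

def coneStep (s : St) (S m : ℕ) : List ℕ :=
  (bif outOk s S m then [m] else []) ++ (bif inOk s S m then [Nat.lor m s.bit] else [])

/-- mask of a predicate -/
noncomputable def mk (u : ℕ → Prop) (k : ℕ) : ℕ := M (fun i _ => u i) 0 k
theorem mk_tb {u : ℕ → Prop} {k i : ℕ} : (mk u k).testBit i = true ↔ i < k ∧ u i := M_tb _ _ _ _

variable {a : ℕ → ℕ → Prop} {u : ℕ → Prop} {N : ℕ}

theorem notu {k i : ℕ} (h : (mk u k).testBit i = false) (hi : i < k) : ¬ u i := by
  intro h1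
  rw [mk_tb.2 ⟨hi, h1⟩] at h; simp at h

theorem inOk_sound (A : Adm a N) (C : Cn a u N) {s : St} (I : Inv a s) (hk : s.k < N) (h : u s.k) :
    inOk s (M a s.k s.k) (mk u s.k) = true := by
  unfold inOk
  rw [Bool.and_eq_true, List.all_eq_true, List.all_eq_true]
  constructor
  · intro E hE
    rw [Bool.not_eq_true']
    by_contra hc
    rw [Bool.not_eq_false] at hc
    obtain ⟨i, hi, j, hj, hij, hb⟩ := I.Ed E hE
    have h1 := landT hc ((hb i).2 (Or.inl rfl))
    have h2 := landT hc ((hb j).2 (Or.inr rfl))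
    rw [land_tb, Bool.and_eq_true, M_tb, mk_tb] at h1 h2
    exact C.t3 i (by omega) j (by omega) s.k hk hij h1.1.2 h2.1.2 h1.2.2 h2.2.2 h
  · intro T hT
    rw [Bool.not_eq_true']
    by_contra hc
    rw [Bool.not_eq_false] at hc
    obtain ⟨x, hx, y, hy, z, hz, xy, xz, yz, hb⟩ := I.I3 T hT
    have h1 := land0 hc ((hb x).2 (by simp))
    have h2 := land0 hc ((hb y).2 (by simp))
    have h3 := land0 hc ((hb z).2 (by simp))
    rw [lor_tb, Bool.or_eq_false_iff] at h1 h2 h3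
    have bx : nb' a x s.k := ⟨by omega, M_tbf _ h1.1 hx⟩
    have by' : nb' a y s.k := ⟨by omega, M_tbf _ h2.1 hy⟩
    have bz : nb' a z s.k := ⟨by omega, M_tbf _ h3.1 hz⟩
    exact C.i4 x (by omega) y (by omega) s.k hk z (by omega) xy bx by' xz yz (A.bs bz)
      (notu h1.2 hx) (notu h2.2 hy) (notu h3.2 hz)

theorem outOk_sound (A : Adm a N) (C : Cn a u N) {s : St} (I : Inv a s) (hk : s.k < N) (h : ¬ u s.k) :
    outOk s (M a s.k s.k) (mk u s.k) = true := by
  have am : ∀ {T m x y : ℕ}, am1 (Nat.land T m) = true → x ≠ y → T.testBit x = true → T.testBit y = true →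
      m.testBit x = false ∨ m.testBit y = false := by
    intro T m x y h1 h2 h3 h4
    by_contra hc
    push Not at hc
    rw [Bool.ne_false_iff, Bool.ne_false_iff] at hc
    exact h2 (am1T h1 (by rw [land_tb, h3, hc.1]; rfl) (by rw [land_tb, h4, hc.2]; rfl))
  unfold outOk
  rw [Bool.and_eq_true, List.all_eq_true, List.all_eq_true]
  constructor
  · intro T hT
    obtain ⟨x, hx, y, hy, z, hz, xy, xz, yz, hb⟩ := I.I3 T hT
    have tx := (hb x).2 (by simp)
    have ty := (hb y).2 (by simp)
    have tz := (hb z).2 (by simp)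
    rw [Bool.and_eq_true, Bool.not_eq_true', Bool.not_eq_true']
    constructor
    · by_contra hc
      rw [Bool.not_eq_false, Bool.and_eq_true] at hc
      have bx : nb' a x s.k := ⟨by omega, M_tbf _ (land0 hc.1 tx) hx⟩
      have by' : nb' a y s.k := ⟨by omega, M_tbf _ (land0 hc.1 ty) hy⟩
      have bz : nb' a z s.k := ⟨by omega, M_tbf _ (land0 hc.1 tz) hz⟩
      have hxy : ¬ u x → ¬ u y → False := fun h1 h2 =>
        C.i4 x (by omega) y (by omega) z (by omega) s.k hk xy xz yz bx by' bz h1 h2 h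
      have hxz : ¬ u x → ¬ u z → False := fun h1 h2 =>
        C.i4 x (by omega) z (by omega) y (by omega) s.k hk xz xy (A.bs yz) bx bz by' h1 h2 h
      have hyz : ¬ u y → ¬ u z → False := fun h1 h2 =>
        C.i4 y (by omega) z (by omega) x (by omega) s.k hk yz (A.bs xy) (A.bs xz) by' bz bx h1 h2 h
      have n1 : ¬ u x ∨ ¬ u y := (am hc.2 xy.1 tx ty).imp (fun q => notu q hx) (fun q => notu q hy)
      have n2 : ¬ u x ∨ ¬ u z := (am hc.2 xz.1 tx tz).imp (fun q => notu q hx) (fun q => notu q hz)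
      have n3 : ¬ u y ∨ ¬ u z := (am hc.2 yz.1 ty tz).imp (fun q => notu q hy) (fun q => notu q hz)
      by_cases p : u x
      · exact hyz (n1.resolve_left (fun q => q p)) (n2.resolve_left (fun q => q p))
      · by_cases q : u y
        · exact hxz p (n3.resolve_left (fun r => r q))
        · exact hxy p q
    · by_contra hc
      rw [Bool.not_eq_false, Bool.and_eq_true] at hc
      have ux := notu (land0 hc.2 tx) hx
      have uy := notu (land0 hc.2 ty) hy
      have uz := notu (land0 hc.2 tz) hz
      have n1 : ¬ a x s.k ∨ ¬ a y s.k := (am hc.1 xy.1 tx ty).imp (fun q => M_tbf _ q hx) (fun q => M_tbf _ q hy)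
      have n2 : ¬ a x s.k ∨ ¬ a z s.k := (am hc.1 xz.1 tx tz).imp (fun q => M_tbf _ q hx) (fun q => M_tbf _ q hz)
      have n3 : ¬ a y s.k ∨ ¬ a z s.k := (am hc.1 yz.1 ty tz).imp (fun q => M_tbf _ q hy) (fun q => M_tbf _ q hz)
      have bx : ¬ a x s.k → nb' a x s.k := fun q => ⟨by omega, q⟩
      have by' : ¬ a y s.k → nb' a y s.k := fun q => ⟨by omega, q⟩
      have bz : ¬ a z s.k → nb' a z s.k := fun q => ⟨by omega, q⟩
      have c0 : ¬ a x s.k → ¬ a y s.k → ¬ a z s.k → False := fun h1 h2 h3 =>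
        C.i4 x (by omega) y (by omega) z (by omega) s.k hk xy xz yz (bx h1) (by' h2) (bz h3) ux uy h
      have c1 : a x s.k → ¬ a y s.k → ¬ a z s.k → False := fun h1 h2 h3 =>
        C.e4 x (by omega) s.k hk y (by omega) z (by omega) h1 xy (A.bs (by' h2)) xz (A.bs (bz h3)) yz ux h uy uz
      have c2 : a y s.k → ¬ a x s.k → ¬ a z s.k → False := fun h1 h2 h3 =>
        C.e4 y (by omega) s.k hk x (by omega) z (by omega) h1 (A.bs xy) (A.bs (bx h2)) yz (A.bs (bz h3)) xz uy h ux uz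
      have c3 : a z s.k → ¬ a x s.k → ¬ a y s.k → False := fun h1 h2 h3 =>
        C.e4 z (by omega) s.k hk x (by omega) y (by omega) h1 (A.bs xz) (A.bs (bx h2)) (A.bs yz) (A.bs (by' h3)) xy uz h ux uy
      by_cases p : a x s.k
      · exact c1 p (n1.resolve_left (fun q => q p)) (n2.resolve_left (fun q => q p))
      · by_cases q : a y s.k
        · exact c2 q p (n3.resolve_left (fun r => r q))
        · by_cases r : a z s.k
          · exact c3 r p q
          · exact c0 p q r
  · intro T hT
    rw [Bool.not_eq_true']
    by_contra hc
    rw [Bool.not_eq_false] at hc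
    obtain ⟨x, hx, y, hy, z, hz, xy, xz, yz, hb⟩ := I.N3 T hT
    have h1 := land0 hc ((hb x).2 (by simp))
    have h2 := land0 hc ((hb y).2 (by simp))
    have h3 := land0 hc ((hb z).2 (by simp))
    rw [lor_tb, Bool.or_eq_false_iff] at h1 h2 h3
    have bx : nb' a x s.k := ⟨by omega, M_tbf _ h1.1 hx⟩
    have by' : nb' a y s.k := ⟨by omega, M_tbf _ h2.1 hy⟩
    have bz : nb' a z s.k := ⟨by omega, M_tbf _ h3.1 hz⟩
    exact C.e4 x (by omega) y (by omega) z (by omega) s.k hk xy xz yz bx by' bz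
      (notu h1.2 hx) (notu h2.2 hy) (notu h3.2 hz) h

theorem coneStep_sound (A : Adm a N) (C : Cn a u N) {s : St} (I : Inv a s) (hk : s.k < N) :
    mk u (s.k+1) ∈ coneStep s (M a s.k s.k) (mk u s.k) := by
  unfold coneStep
  rw [List.mem_append]
  by_cases h : u s.k
  · right
    rw [inOk_sound A C I hk h]
    simp [mk, M, h, I.bit]
  · left
    rw [outOk_sound A C I hk h]
    simp [mk, M, h]

/-- pair tests -/
def cpth (X : ℕ) : List ℕ → ℕ → Bool
  | [], _ => false
  | r :: rs, p => (!(Nat.beq (Nat.land p X) 0) && !(am1 (Nat.land r X))) || cpth X rs (Nat.mul 2 p)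

def redBad (g I3 : List ℕ) (S T : ℕ) : Bool :=
  cpth (Nat.land S T) g 1 || I3.any fun t => Nat.beq (Nat.land t (Nat.lor S T)) 0
def blueBad (I3 N3 : List ℕ) (S T : ℕ) : Bool :=
  (I3.any fun t => Nat.beq (Nat.land t (Nat.land S T)) 0 && am1 (Nat.land t (Nat.lor S T))) ||
  N3.any fun t => Nat.beq (Nat.land t (Nat.lor S T)) 0

def allPairs (f : ℕ → ℕ → Bool) : List ℕ → Bool
  | [] => true
  | S :: L => (S :: L).all (fun T => f S T) && allPairs f L

/-- class check: type 1 = cap 1; type 2 with `z` = cap 2; type 3 = cap 3 -/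
def chkCls (g I3 N3 : List ℕ) (N : ℕ) (c : ℕ × ℕ × List ℕ) : Bool :=
  allPairs (redBad g I3) c.2.2 &&
    match c.1 with
    | 1 => allPairs (blueBad I3 N3) c.2.2
    | 2 => Nat.blt c.2.1 N && c.2.2.all fun S => !(S.testBit c.2.1)
    | 3 => true
    | _ => false

def runC (N : ℕ) (g : List ℕ) (cls : List (ℕ × ℕ × List ℕ)) : List ℕ → St → List ℕ → Bool
  | [], s, C => (C.all fun S => cls.any fun c => c.2.2.any fun T => Nat.beq S T) &&
      cls.all (chkCls g s.I3 s.N3 N)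
  | _ :: rs, s, C => 
    (fun S => runC N g cls rs (step s S fun _ => false) (C.flatMap (coneStep s S)))
      (Nat.land (g.getD s.k 0) (Nat.sub s.bit 1))

def chkC (N : ℕ) (p : List ℕ × List (ℕ × ℕ × List ℕ)) : Bool :=
  runC N p.1 p.2 (List.range (N-1)) st0 [0,1]

end GRP

set_option linter.all false
namespace GRP
def crt11 : List (List ℕ × List (ℕ × ℕ × List ℕ)) :=
  [([156, 356, 1539, 705, 801, 1170, 1290, 1321, 722, 1308, 740],
    [(1,0,[55, 79, 93, 95, 119, 183, 247, 541, 543, 567, 591, 605, 607, 631, 695, 759]),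
     (1,0,[110, 111, 122, 126, 234, 238, 250, 254, 622, 623, 634, 638, 746, 750, 762, 766]),
     (1,0,[121, 123, 125, 345, 349, 377, 381, 633, 1117, 1141, 1145, 1147, 1149, 1369, 1373, 1393, 1397, 1401, 1405, 1657]),
     (1,0,[635, 1146, 1656, 1658, 1659]),
     (1,0,[1992]),
     (2,9,[63, 127, 311, 319, 439, 1079, 1087, 1103, 1119, 1126, 1127, 1134, 1135, 1142, 1143, 1150, 1151, 1335, 1343,
       1365, 1493]),
     (2,10,[435, 573, 574, 575, 637, 639, 686, 698, 702, 942])]),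
   ([194, 1793, 616, 788, 1352, 1412, 1173, 865, 186, 1166, 626],
    [(1,0,[39, 47, 55, 61, 63, 167, 173, 175, 183, 189, 191, 1063, 1071, 1075, 1079, 1083, 1085, 1087, 1187, 1191, 1195,
       1197, 1199, 1203, 1207, 1209, 1211, 1213, 1215]),
     (1,0,[87, 93, 95, 103, 111, 119, 125, 127, 343, 359, 375, 583, 599, 615, 631, 839, 855, 871, 887]),
     (1,0,[1127, 1135, 1327]),
     (1,0,[295, 303, 367, 1319, 1383, 1391]),
     (1,0,[551, 567, 679, 695, 807, 823]),
     (1,0,[907]),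
     (1,0,[311, 1330, 1331, 1334, 1335]),
     (1,0,[1721]),
     (1,0,[1764])]),
   ([194, 1793, 840, 1412, 1376, 912, 661, 1129, 62, 1126, 666],
    [(1,0,[51, 55, 59, 61, 63, 87, 93, 95, 115, 117, 119, 123, 125, 127, 1051, 1055, 1075, 1079, 1083, 1085, 1087, 1107,
       1111, 1115, 1117, 1119, 1139, 1141, 1143, 1147, 1149, 1151]),
     (1,0,[343, 1363, 1367]),
     (1,0,[171, 173, 175, 179, 183, 185, 187, 189, 191, 427, 675, 679, 683, 685, 687, 691, 695, 697, 699, 701, 703, 931,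
       939]),
     (1,0,[627, 635]),
     (1,0,[551, 559, 563, 567, 571, 573, 575, 807, 935]),
     (1,0,[1203, 1207]),
     (1,0,[1307, 1371]),
     (1,0,[1596, 1597]),
     (1,0,[1776])]),
   ([194, 1793, 840, 1412, 1376, 912, 1557, 1577, 62, 230, 218],
    [(1,0,[343, 471]),
     (1,0,[427, 491]),
     (1,0,[527, 543, 551, 559, 563, 567, 571, 575, 627, 635, 1551, 1563, 1567, 1575, 1582, 1583, 1586, 1587, 1590, 1591,
       1594, 1595, 1598, 1599]),
     (1,0,[1039, 1051, 1055, 1071, 1075, 1079, 1083, 1087, 1203, 1207, 1566]),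
     (1,0,[1103, 1135, 1550]),
     (1,0,[655, 671]),
     (1,0,[807, 1831]),
     (1,0,[1307, 1819]),
     (1,0,[1731, 1987])]),
   ([284, 612, 1155, 1345, 1569, 1298, 1546, 1796, 681, 466, 252],
    [(1,0,[55, 63, 110, 111, 118, 119, 122, 126, 127, 182, 183, 190, 191, 207, 223, 230, 231, 238, 239, 246, 247, 250,
       254, 255, 366, 374, 378, 382, 422, 430, 438, 446, 486, 494, 502, 506, 510]),
     (1,0,[61, 93, 95, 121, 125, 157, 159, 181, 189, 221, 245, 249, 253, 573, 605, 633, 637, 661, 669, 693, 701, 725,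
       733, 757, 761, 765]),
     (1,0,[123, 251, 442]),
     (1,0,[753]),
     (1,0,[567, 575, 663, 671, 694, 695, 702, 703]),
     (1,0,[311, 375, 423, 437, 439, 487, 501, 503]),
     (1,0,[819, 823]),
     (1,0,[79, 362, 490]),
     (1,0,[601, 729])]),
   ([390, 649, 1297, 1314, 676, 1560, 1920, 1107, 589, 370, 236],
    [(1,0,[30, 94, 158, 286, 414, 542, 1054, 1566]),
     (1,0,[442, 444, 446, 474, 476, 478, 670, 798, 926, 1182, 1310, 1438, 1694, 1822, 1950]),
     (1,0,[31, 63, 95, 127, 535, 543, 599, 607, 1039, 1055, 1103, 1119, 1551, 1559, 1567, 1607, 1615, 1623, 1631]),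
     (1,0,[62, 126, 186, 190, 218, 222, 250, 254, 316, 318, 348, 350, 380, 382, 504, 505, 506, 508, 510]),
     (1,0,[722, 726, 730, 734]),
     (1,0,[811]),
     (1,0,[1205]),
     (1,0,[1356, 1358, 1372, 1374]),
     (1,0,[598, 606, 1102, 1118, 1614, 1622, 1630, 1639])]),
   ([390, 649, 1297, 1570, 1572, 408, 1920, 1123, 613, 346, 220],
    [(1,0,[59, 61, 63, 121, 123, 125, 127, 189, 249, 253, 377, 572, 573, 632, 633, 636, 637, 700, 701, 760, 761, 764,
       765, 1144, 1145]),
     (1,0,[181, 245, 693, 752, 753, 756, 757, 828, 956]),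
     (1,0,[299, 315, 363, 379, 1082, 1083, 1146, 1147, 1210, 1323, 1338, 1339, 1384, 1385, 1386, 1387, 1400, 1401, 1402,
       1403, 1466]),
     (1,0,[1656, 1657]),
     (1,0,[241, 481, 489, 497, 505]),
     (1,0,[754, 758]),
     (1,0,[361, 1388, 1390])]),
   ([550, 1097, 657, 1298, 396, 1409, 898, 1140, 632, 1349, 682],
    [(1,0,[31, 55, 63, 95, 103, 107, 111, 119, 123, 127, 235, 251, 619, 635, 747, 763]),
     (1,0,[91, 219, 587, 603, 715, 731]),
     (1,0,[99, 115, 227, 243, 311, 355, 359, 371, 375, 611, 627, 1063, 1079, 1123, 1127, 1139, 1143, 1319, 1335, 1379,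
       1383, 1395, 1399]),
     (1,0,[739, 755, 1635, 1651]),
     (1,0,[231, 239, 363, 367, 483, 487, 491, 495]),
     (1,0,[496, 497, 498, 499]),
     (1,0,[1734]),
     (1,0,[1833])]),
   ([582, 1161, 1297, 802, 676, 1112, 1569, 1554, 1548, 473, 486],
    [(1,0,[63, 107, 111, 271, 303, 575, 1087, 1599]),
     (1,0,[207, 235, 239, 335, 363, 365, 367, 399, 427, 431, 463, 491, 493, 495]),
     (1,0,[123, 186, 187, 243, 250, 251, 378, 379, 442, 443, 499, 506, 507]),
     (1,0,[117, 119, 151, 183, 215, 245, 247, 343, 373, 375, 407, 437, 439, 471, 501, 503]),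
     (1,0,[125, 252, 253, 316, 317, 380, 381, 444, 445, 508, 509]),
     (1,0,[159, 223, 287, 351, 414, 415, 478, 479]),
     (3,0,[127, 190, 191, 254, 255, 318, 319, 382, 383, 446, 447, 510, 511])]),
   ([610, 1409, 1128, 900, 480, 789, 1173, 602, 1082, 1193, 838],
    [(1,0,[15, 31, 79, 93, 95, 271, 283, 287, 335, 347, 349, 351, 527, 543, 589, 591, 605, 607, 779, 783, 795, 799, 843,
       845, 847, 857, 859, 861, 863]),
     (1,0,[47, 55, 63, 111, 117, 119, 125, 127, 175, 183, 190, 191, 1063, 1071, 1079, 1087, 1191, 1199, 1207, 1214, 1215]),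
     (1,0,[207, 239, 367, 431, 463, 495]),
     (1,0,[303, 399, 1198]),
     (1,0,[143, 158, 159, 410, 411, 414, 415, 1166, 1167, 1182, 1183]),
     (2,7,[1836, 1881]),
     (2,8,[1039, 1055, 1206, 1551, 1567, 1718, 1731])]),
   ([1158, 777, 785, 418, 708, 1672, 1424, 121, 1102, 1078, 865],
    [(2,6,[1055, 1067, 1069, 1071, 1083, 1085, 1087, 1183, 1325, 1341, 1799, 1927]),
     (2,8,[1107, 1109, 1111, 1115, 1117, 1119, 1123, 1125, 1127, 1131, 1133, 1135, 1139, 1141, 1143, 1147, 1149, 1151,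
       1249, 1251, 1253, 1255, 1619, 1627]),
     (2,10,[31, 47, 63, 87, 95, 103, 111, 119, 127, 159, 231, 327, 343, 359, 375, 455, 487, 551, 559, 615, 623, 679, 743,
       775, 807, 839, 871, 903, 935, 967, 999])]),
   ([1218, 1793, 1352, 1668, 1632, 1424, 405, 617, 614, 410, 63],
    [(2,10,[51, 55, 59, 60, 61, 62, 63, 171, 173, 175, 179, 183, 185, 187, 188, 189, 190, 191, 295, 302, 303, 307, 310,
       311, 315, 316, 317, 318, 319, 419, 423, 427, 428, 429, 430, 431, 435, 438, 439, 441, 443, 444, 445, 446, 447]),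
     (2,10,[252, 254, 599, 606, 607, 627, 629, 631, 634, 635, 636, 637, 638, 639, 691, 695, 1008]),
     (2,10,[87, 93, 95, 115, 117, 119, 123, 124, 125, 126, 127, 371, 379, 595, 603, 605]),
     (2,10,[539, 542, 543, 563, 567, 570, 571, 572, 573, 574, 575, 604, 828, 829])])]
def crt12 : List (List ℕ × List (ℕ × ℕ × List ℕ)) :=
  [([60, 960, 1225, 2821, 2273, 1809, 1558, 2326, 1194, 2154, 2404, 1688],
    [(1,0,[215]),
     (1,0,[811]),
     (1,0,[3419]),
     (1,0,[3468]),
     (1,0,[3696]),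
     (1,0,[3751])]),
   ([62, 1221, 2819, 2257, 1801, 961, 1578, 2346, 1204, 2164, 2386, 1676],
    [(1,0,[235]),
     (1,0,[821]),
     (1,0,[990]),
     (1,0,[3437]),
     (1,0,[3462]),
     (1,0,[3672]),
     (1,0,[3763])]),
   ([240, 816, 3264, 3840, 1347, 2691, 2581, 1317, 2202, 1130, 668, 364],
    [(1,0,[975]),
     (1,0,[1433]),
     (1,0,[1622]),
     (1,0,[2470]),
     (1,0,[2665]),
     (1,0,[3135])]),
   ([306, 593, 1192, 2244, 3203, 1349, 2602, 796, 2721, 1474, 2612, 1368],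
    [(1,0,[111]),
     (1,0,[1686]),
     (1,0,[2457]),
     (1,0,[3855]),
     (1,0,[3936])])]
theorem crt11_ok : crt11.all (chkC 11) = true := by decide +kernel
theorem crt12_ok : crt12.all (chkC 12) = true := by decide +kernel
theorem crt11_gs : crt11.map (fun p => p.1) = gs11 := by decide +kernel
theorem crt12_gs : crt12.map (fun p => p.1) = gs12 := by decide +kernel
theorem crt11_cap : crt11.all (fun p => Nat.ble ((p.2.map fun c => c.1).sum) 9) = true := by decide +kernel
theorem crt12_cap : crt12.all (fun p => Nat.ble ((p.2.map fun c => c.1).sum) 8) = true := by decide +kernel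
end GRP

set_option linter.all false
namespace GRP
open scoped Classical
variable {V : Type*}
variable {a : ℕ → ℕ → Prop} {u : ℕ → Prop} {N : ℕ}

theorem row_eq (A : Adm a N) {g : List ℕ} (hg : ∀ i < N, ∀ j < N, ((g.getD i 0).testBit j = true ↔ a i j)) {k : ℕ}
    (hk : k < N) : Nat.land (g.getD k 0) (Nat.sub (2^k) 1) = M a k k := by
  apply Nat.eq_of_testBit_eq
  intro i
  have e : (Nat.sub (2^k) 1) = 2^k - 1 := rfl
  rw [Bool.eq_iff_iff, land_tb, Bool.and_eq_true, M_tb, e, Nat.testBit_two_pow_sub_one, decide_eq_true_eq]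
  constructor
  · rintro ⟨h1, h2⟩; exact ⟨h2, A.symm _ _ ((hg k hk i (by omega)).1 h1)⟩
  · rintro ⟨h1, h2⟩; exact ⟨(hg k hk i (by omega)).2 (A.symm _ _ h2), h1⟩

theorem runC_sound (A : Adm a N) {g : List ℕ} (hg : ∀ i < N, ∀ j < N, ((g.getD i 0).testBit j = true ↔ a i j))
    (cls : List (ℕ × ℕ × List ℕ)) : ∀ (rs : List ℕ) (s : St) (C : List ℕ), Inv a s → s.k + rs.length = N →
    (∀ u, Cn a u N → mk u s.k ∈ C) → runC N g cls rs s C = true →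
    (∀ u, Cn a u N → ∃ c ∈ cls, mk u N ∈ c.2.2) ∧ ∃ s', Inv a s' ∧ s'.k = N ∧
      ∀ c ∈ cls, chkCls g s'.I3 s'.N3 N c = true := by
  intro rs
  induction rs with
  | nil =>
    intro s C I hk hC h
    rw [runC, Bool.and_eq_true, List.all_eq_true, List.all_eq_true] at h
    simp at hk
    refine ⟨?_, s, I, hk, h.2⟩
    intro u hu
    have := h.1 _ (hC u hu)
    rw [List.any_eq_true] at this
    obtain ⟨c, hc, h2⟩ := this
    rw [List.any_eq_true] at h2
    obtain ⟨T, hT, h3⟩ := h2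
    rw [hk] at h3
    exact ⟨c, hc, by rw [Nat.eq_of_beq_eq_true h3]; exact hT⟩
  | cons r rs ih =>
    intro s C I hk hC h
    rw [List.length_cons] at hk
    have hk' : s.k < N := by omega
    rw [runC] at h
    beta_reduce at h
    rw [I.bit, row_eq A hg hk'] at h
    refine ih _ _ (step_inv A I _) ?_ ?_ h
    · show s.k + 1 + _ = _; omega
    · intro u hu
      show mk u (s.k+1) ∈ _
      rw [List.mem_flatMap]
      exact ⟨_, hC u hu, coneStep_sound A hu I hk'⟩

theorem cpth_sound (X : ℕ) : ∀ (rs : List ℕ) (i : ℕ), cpth X rs (2^i) = true →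
    ∃ j < rs.length, X.testBit (i+j) = true ∧ am1 (Nat.land (rs.getD j 0) X) = false := by
  intro rs
  induction rs with
  | nil => intro i h; simp [cpth] at h
  | cons r rs ih =>
    intro i h
    rw [cpth, Bool.or_eq_true, Bool.and_eq_true, Bool.not_eq_true', Bool.not_eq_true'] at h
    rcases h with h | h
    · refine ⟨0, by simp, ?_, by simpa using h.2⟩
      obtain ⟨n, h1, h2⟩ := landne h.1
      rw [Nat.testBit_two_pow, decide_eq_true_eq] at h1
      subst h1; simpa using h2
    · have e : Nat.mul 2 (2^i) = 2^(i+1) := by show 2 * 2^i = _; ring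
      rw [e] at h
      obtain ⟨j, h1, h2, h3⟩ := ih (i+1) h
      exact ⟨j+1, by simpa using h1, by rwa [show i + (j+1) = i+1+j by ring], by simpa using h3⟩

theorem redBad_sound (A : Adm a N) {g : List ℕ} (hg : ∀ i < N, ∀ j < N, ((g.getD i 0).testBit j = true ↔ a i j))
    {s : St} (I : Inv a s) (hs : s.k = N) {u u' : ℕ → Prop}
    (h : redBad g s.I3 (mk u N) (mk u' N) = true)
    (h1 : ∀ x < N, ∀ y < N, ∀ z < N, y ≠ z → a x y → a x z → u x → u y → u z → u' x → u' y → u' z → False)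
    (h2 : ∀ x < N, ∀ y < N, ∀ z < N, nb' a x y → nb' a x z → nb' a y z → ¬ u x → ¬ u y → ¬ u z →
      ¬ u' x → ¬ u' y → ¬ u' z → False) : False := by
  unfold redBad at h
  rw [Bool.or_eq_true, List.any_eq_true] at h
  rcases h with h | ⟨T, hT, h⟩
  · obtain ⟨j, hj, hb, hm⟩ := cpth_sound _ g 0 h
    rw [zero_add, land_tb, Bool.and_eq_true, mk_tb, mk_tb] at hb
    obtain ⟨y, z, hyz, hy, hz⟩ := am1F hm
    rw [land_tb, land_tb, Bool.and_eq_true, Bool.and_eq_true, mk_tb, mk_tb] at hy hz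
    exact h1 j hb.1.1 y hy.2.1.1 z hz.2.1.1 hyz ((hg _ hb.1.1 _ hy.2.1.1).1 hy.1) ((hg _ hb.1.1 _ hz.2.1.1).1 hz.1)
      hb.1.2 hy.2.1.2 hz.2.1.2 hb.2.2 hy.2.2.2 hz.2.2.2
  · obtain ⟨x, hx, y, hy, z, hz, xy, xz, yz, hb⟩ := I.I3 T hT
    have b1 := land0 h ((hb x).2 (by simp))
    have b2 := land0 h ((hb y).2 (by simp))
    have b3 := land0 h ((hb z).2 (by simp))
    rw [lor_tb, Bool.or_eq_false_iff] at b1 b2 b3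
    rw [hs] at hx hy hz
    exact h2 x hx y hy z hz xy xz yz (notu b1.1 hx) (notu b2.1 hy) (notu b3.1 hz)
      (notu b1.2 hx) (notu b2.2 hy) (notu b3.2 hz)

theorem blueBad_sound (A : Adm a N) {s : St} (I : Inv a s) (hs : s.k = N) {u u' : ℕ → Prop}
    (h : blueBad s.I3 s.N3 (mk u N) (mk u' N) = true)
    (h1 : ∀ x < N, ∀ y < N, ∀ z < N, nb' a x y → nb' a x z → nb' a y z → ¬ u x → ¬ u y → ¬ u z →
      ¬ u' y → ¬ u' z → False)
    (h1' : ∀ x < N, ∀ y < N, ∀ z < N, nb' a x y → nb' a x z → nb' a y z → ¬ u' x → ¬ u' y → ¬ u' z →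
      ¬ u y → ¬ u z → False)
    (h2 : ∀ x < N, ∀ y < N, ∀ z < N, a x y → nb' a x z → nb' a y z → ¬ u x → ¬ u y → ¬ u z →
      ¬ u' x → ¬ u' y → ¬ u' z → False) : False := by
  unfold blueBad at h
  rw [Bool.or_eq_true, List.any_eq_true, List.any_eq_true] at h
  rcases h with ⟨T, hT, h⟩ | ⟨T, hT, h⟩
  · obtain ⟨x, hx, y, hy, z, hz, xy, xz, yz, hb⟩ := I.I3 T hT
    rw [hs] at hx hy hz
    rw [Bool.and_eq_true] at h
    have tx := (hb x).2 (by simp)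
    have ty := (hb y).2 (by simp)
    have tz := (hb z).2 (by simp)
    have w : ∀ i < N, T.testBit i = true → ¬ (u i ∧ u' i) := by
      intro i hi ht hu
      have := land0 h.1 ht
      rw [land_tb, mk_tb.2 ⟨hi, hu.1⟩, mk_tb.2 ⟨hi, hu.2⟩] at this
      simp at this
    have v : ∀ i < N, ∀ j < N, i ≠ j → T.testBit i = true → T.testBit j = true → (u i ∨ u' i) → (u j ∨ u' j) → False := by
      intro i hi j hj hij ti tj qi qj
      refine hij (am1T h.2 ?_ ?_)
      · rw [land_tb, ti, lor_tb, Bool.true_and, Bool.or_eq_true, mk_tb, mk_tb]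
        exact qi.imp (fun q => ⟨hi, q⟩) (fun q => ⟨hi, q⟩)
      · rw [land_tb, tj, lor_tb, Bool.true_and, Bool.or_eq_true, mk_tb, mk_tb]
        exact qj.imp (fun q => ⟨hj, q⟩) (fun q => ⟨hj, q⟩)
    -- given a vertex and two missed ones
    have fin : ∀ x < N, ∀ y < N, ∀ z < N, nb' a x y → nb' a x z → nb' a y z → T.testBit x = true → 
        ¬ (u y ∨ u' y) → ¬ (u z ∨ u' z) → False := by
      intro x hx y hy z hz xy xz yz tx ny nz
      push Not at ny nz
      by_cases q : u x
      · exact h1' x hx y hy z hz xy xz yz (fun q' => w x hx tx ⟨q, q'⟩) ny.2 nz.2 ny.1 nz.1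
      · exact h1 x hx y hy z hz xy xz yz q ny.1 nz.1 ny.2 nz.2
    by_cases qx : u x ∨ u' x
    · exact fin x hx y hy z hz xy xz yz tx (fun q => v x hx y hy xy.1 tx ty qx q) (fun q => v x hx z hz xz.1 tx tz qx q)
    · by_cases qy : u y ∨ u' y
      · exact fin y hy x hx z hz (A.bs xy) yz xz ty qx (fun q => v y hy z hz yz.1 ty tz qy q)
      · exact fin z hz x hx y hy (A.bs xz) (A.bs yz) xy tz qx qy
  · obtain ⟨x, hx, y, hy, z, hz, xy, xz, yz, hb⟩ := I.N3 T hT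
    have b1 := land0 h ((hb x).2 (by simp))
    have b2 := land0 h ((hb y).2 (by simp))
    have b3 := land0 h ((hb z).2 (by simp))
    rw [lor_tb, Bool.or_eq_false_iff] at b1 b2 b3
    rw [hs] at hx hy hz
    exact h2 x hx y hy z hz xy xz yz (notu b1.1 hx) (notu b2.1 hy) (notu b3.1 hz)
      (notu b1.2 hx) (notu b2.2 hy) (notu b3.2 hz)

theorem allPairs_sound {f : ℕ → ℕ → Bool} : ∀ {L : List ℕ}, allPairs f L = true → ∀ S ∈ L, ∀ T ∈ L,
    f S T = true ∨ f T S = true := by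
  intro L
  induction L with
  | nil => intro _ S hS; simp at hS
  | cons X L ih =>
    intro h S hS T hT
    rw [allPairs, Bool.and_eq_true, List.all_eq_true] at h
    rcases List.mem_cons.1 hS with h1 | h1
    · subst h1; left; exact h.1 T hT
    · rcases List.mem_cons.1 hT with h2 | h2
      · subst h2; right; exact h.1 S hS
      · exact ih h.2 S h1 T h2

theorem cap_sum {W : Finset V} {P : ℕ × ℕ × List ℕ → V → Prop} : ∀ (cls : List (ℕ × ℕ × List ℕ)),
    ∀ W : Finset V, (∀ w ∈ W, ∃ c ∈ cls, P c w) → (∀ c ∈ cls, ∀ Q ⊆ W, (∀ w ∈ Q, P c w) → Q.card ≤ c.1) →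
    W.card ≤ (cls.map fun c => c.1).sum := by
  intro cls
  induction cls with
  | nil =>
    intro W h _
    have : W = ∅ := by
      rw [Finset.eq_empty_iff_forall_notMem]; intro w hw
      obtain ⟨c, hc, _⟩ := h w hw; simp at hc
    simp [this]
  | cons c cls ih =>
    intro W h hc
    have h1 := ih (W.filter (fun w => ¬ P c w)) (by
      intro w hw
      rw [Finset.mem_filter] at hw
      obtain ⟨c', hc', hP⟩ := h w hw.1
      rcases List.mem_cons.1 hc' with e | e
      · subst e; exact absurd hP hw.2
      · exact ⟨c', e, hP⟩) (by
      intro c' hc' Q hQ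
      exact hc c' (List.mem_cons_of_mem _ hc') Q (hQ.trans (Finset.filter_subset _ _)))
    have h2 := hc c (by simp) (W.filter (P c)) (Finset.filter_subset _ _) (fun w hw => (Finset.mem_filter.1 hw).2)
    have h3 := Finset.card_filter_add_card_filter_not (s := W) (P c)
    simp only [List.map_cons, List.sum_cons]
    omega

theorem cone_bound (R : SimpleGraph V) (S : Finset V) (hR : Fr 4 R S) (hB : Fr 4 Rᶜ S) {v : V} (hv : v ∈ S)
    {N : ℕ} {f : ℕ → V} (hf : ∀ i < N, f i ∈ nb R S v) (hinj : ∀ i < N, ∀ j < N, f i = f j → i = j)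
    {p : List ℕ × List (ℕ × ℕ × List ℕ)} (hN : 1 ≤ N)
    (hg : ∀ i < N, ∀ j < N, ((p.1.getD i 0).testBit j = true ↔ R.Adj (f i) (f j)))
    (h : chkC N p = true) : (nb Rᶜ S v).card ≤ (p.2.map fun c => c.1).sum := by
  have hH : Fr 3 R (nb R S v) := jn4 (sing_sub hv) (nb_sub ..) jn_nb hR (by simp)
  have A : Adm (fun i j => R.Adj (f i) (f j)) N := adm_of R _ hH (hB.mono (nb_sub ..)) f N hf hinj
  set a : ℕ → ℕ → Prop := fun i j => R.Adj (f i) (f j) with ha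
  have fS : ∀ i < N, f i ∈ S := fun i hi => (mem_nb.1 (hf i hi)).1
  have fv : ∀ i < N, R.Adj v (f i) := fun i hi => (mem_nb.1 (hf i hi)).2
  have nbB : ∀ i < N, ∀ j < N, nb' a i j → Rᶜ.Adj (f i) (f j) := by
    intro i hi j hj q
    rw [SimpleGraph.compl_adj]
    exact ⟨fun e => q.1 (hinj i hi j hj e), q.2⟩
  have wS : ∀ w ∈ nb Rᶜ S v, w ∈ S := fun w hw => (mem_nb.1 hw).1
  have wv : ∀ w ∈ nb Rᶜ S v, Rᶜ.Adj v w := fun w hw => (mem_nb.1 hw).2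
  have wB : ∀ w ∈ nb Rᶜ S v, ∀ i < N, ¬ R.Adj w (f i) → Rᶜ.Adj w (f i) := by
    intro w hw i hi q
    rw [SimpleGraph.compl_adj]
    refine ⟨?_, q⟩
    intro e
    have := wv w hw
    rw [SimpleGraph.compl_adj, e] at this
    exact this.2 (fv i hi)
  have neW : ∀ w ∈ nb Rᶜ S v, ∀ i < N, w ≠ f i := by
    intro w hw i hi e
    have := wv w hw
    rw [SimpleGraph.compl_adj, e] at this
    exact this.2 (fv i hi)
  have hCn : ∀ w ∈ nb Rᶜ S v, Cn a (fun i => R.Adj w (f i)) N := by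
    intro w hw
    refine ⟨?_, ?_, ?_⟩
    · intro x hx y hy z hz xy xz yz ux uy uz
      exact hR _ (fS x hx) _ (fS y hy) _ (fS z hz) w (wS w hw) v hv (wv w hw).ne' xy xz yz ux.symm uy.symm uz.symm
        (fv x hx).symm (fv y hy).symm (fv z hz).symm
    · intro x hx y hy z hz t ht xy xz yz xt yt zt ux uy ut
      exact hB _ (fS x hx) _ (fS y hy) _ (fS t ht) w (wS w hw) _ (fS z hz) (neW w hw z hz)
        (nbB _ hx _ hy xy) (nbB _ hx _ ht xt) (nbB _ hy _ ht yt) (wB w hw x hx ux).symm (wB w hw y hy uy).symm (wB w hw t ht ut).symm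
        (nbB _ hx _ hz xz) (nbB _ hy _ hz yz) (nbB _ hz _ ht zt).symm
    · intro x hx y hy z hz t ht xy xz yz xt yt zt ux uy uz ut
      exact hB _ (fS z hz) _ (fS t ht) w (wS w hw) _ (fS x hx) _ (fS y hy) (fun e => A.irr x (by
          show R.Adj (f x) (f x); have : R.Adj (f x) (f y) := xy; rwa [← e] at this))
        (nbB _ hz _ ht zt) (wB w hw z hz uz).symm (wB w hw t ht ut).symm
        (nbB _ hx _ hz xz).symm (nbB _ hx _ ht xt).symm (wB w hw x hx ux)
        (nbB _ hy _ hz yz).symm (nbB _ hy _ ht yt).symm (wB w hw y hy uy)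
  obtain ⟨hcov, s', I, hk, hcl⟩ := runC_sound A hg p.2 (List.range (N-1)) st0 [0,1] inv0
    (by rw [List.length_range]; show 1 + (N-1) = N; omega) (by
      intro u _
      show mk u 1 ∈ _
      by_cases q : u 0
      · simp [mk, M, q]
      · simp [mk, M, q]) h
  -- red pair contradiction
  have red : ∀ w ∈ nb Rᶜ S v, ∀ w' ∈ nb Rᶜ S v, R.Adj w w' →
      redBad p.1 s'.I3 (mk (fun i => R.Adj w (f i)) N) (mk (fun i => R.Adj w' (f i)) N) = true → False := by
    intro w hw w' hw' hww hb
    refine redBad_sound A hg I hk hb ?_ ?_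
    · intro x hx y hy z hz yz xy xz ux uy uz vx vy vz
      exact hR w (wS w hw) w' (wS w' hw') _ (fS x hx) _ (fS y hy) _ (fS z hz) (fun e => yz (hinj y hy z hz e))
        hww ux vx uy vy xy uz vz xz
    · intro x hx y hy z hz xy xz yz ux uy uz vx vy vz
      exact hB _ (fS x hx) _ (fS y hy) _ (fS z hz) w (wS w hw) w' (wS w' hw') hww.ne
        (nbB _ hx _ hy xy) (nbB _ hx _ hz xz) (nbB _ hy _ hz yz)
        (wB w hw x hx ux).symm (wB w hw y hy uy).symm (wB w hw z hz uz).symm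
        (wB w' hw' x hx vx).symm (wB w' hw' y hy vy).symm (wB w' hw' z hz vz).symm
  have half : ∀ w ∈ nb Rᶜ S v, ∀ w' ∈ nb Rᶜ S v, Rᶜ.Adj w w' → ∀ x < N, ∀ y < N, ∀ z < N, nb' a x y → nb' a x z → nb' a y z →
      ¬ R.Adj w (f x) → ¬ R.Adj w (f y) → ¬ R.Adj w (f z) → ¬ R.Adj w' (f y) → ¬ R.Adj w' (f z) → False := by
    intro w hw w' hw' hww x hx y hy z hz xy xz yz ux uy uz vy vz
    exact hB _ (fS y hy) _ (fS z hz) w (wS w hw) _ (fS x hx) w' (wS w' hw') (neW w' hw' x hx).symm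
      (nbB _ hy _ hz yz) (wB w hw y hy uy).symm (wB w hw z hz uz).symm
      (nbB _ hx _ hy xy).symm (nbB _ hx _ hz xz).symm (wB w hw x hx ux)
      (wB w' hw' y hy vy).symm (wB w' hw' z hz vz).symm hww
  have blue : ∀ w ∈ nb Rᶜ S v, ∀ w' ∈ nb Rᶜ S v, Rᶜ.Adj w w' →
      blueBad s'.I3 s'.N3 (mk (fun i => R.Adj w (f i)) N) (mk (fun i => R.Adj w' (f i)) N) = true → False := by
    intro w hw w' hw' hww hb
    refine blueBad_sound A I hk hb ?_ ?_ ?_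
    · exact half w hw w' hw' hww
    · exact half w' hw' w hw hww.symm
    · intro x hx y hy z hz xy xz yz ux uy uz vx vy vz
      have xy' : R.Adj (f x) (f y) := xy
      exact hB _ (fS z hz) w (wS w hw) w' (wS w' hw') _ (fS x hx) _ (fS y hy) xy'.ne
        (wB w hw z hz uz).symm (wB w' hw' z hz vz).symm hww
        (nbB _ hx _ hz xz).symm (wB w hw x hx ux) (wB w' hw' x hx vx)
        (nbB _ hy _ hz yz).symm (wB w hw y hy uy) (wB w' hw' y hy vy)
  refine cap_sum (W := ∅) (P := fun c w => mk (fun i => R.Adj w (f i)) N ∈ c.2.2) p.2 _ ?_ ?_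
  · intro w hw; exact hcov _ (hCn w hw)
  · intro c hc Q hQW hQP
    have hk' := hcl c hc
    unfold chkCls at hk'
    rw [Bool.and_eq_true] at hk'
    obtain ⟨hr, ht⟩ := hk'
    have hr' := allPairs_sound hr
    have hQm : ∀ w ∈ Q, w ∈ nb Rᶜ S v ∧ mk (fun i => R.Adj w (f i)) N ∈ c.2.2 := fun w hw => ⟨hQW hw, hQP w hw⟩
    have allB : ∀ w ∈ Q, ∀ w' ∈ Q, w ≠ w' → Rᶜ.Adj w w' := by
      intro w hw w' hw' hne
      rw [SimpleGraph.compl_adj]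
      refine ⟨hne, fun had => ?_⟩
      rcases hr' _ (hQm w hw).2 _ (hQm w' hw').2 with q | q
      · exact red w (hQm w hw).1 w' (hQm w' hw').1 had q
      · exact red w' (hQm w' hw').1 w (hQm w hw).1 had.symm q
    split at ht
    · rename_i e
      rw [e]
      by_contra hc1
      push Not at hc1
      obtain ⟨w, hw, w', hw', hne⟩ := Finset.one_lt_card.1 hc1
      have had := allB w hw w' hw' hne
      rcases allPairs_sound ht _ (hQm w hw).2 _ (hQm w' hw').2 with q | q
      · exact blue w (hQm w hw).1 w' (hQm w' hw').1 had q
      · exact blue w' (hQm w' hw').1 w (hQm w hw).1 had.symm q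
    · rename_i e
      rw [e]
      rw [Bool.and_eq_true, Nat.blt_eq, List.all_eq_true] at ht
      by_contra hc1
      push Not at hc1
      obtain ⟨x, y, z, hx, hy, hz, xy, xz, yz⟩ := Finset.two_lt_card_iff.1 hc1
      have m : ∀ w ∈ Q, Rᶜ.Adj w (f c.2.1) := by
        intro w hw
        apply wB w (hQm w hw).1 _ ht.1
        intro q
        have := ht.2 _ (hQm w hw).2
        rw [Bool.not_eq_true', mk_tb.2 ⟨ht.1, q⟩] at this
        simp at this
      exact hB x (wS x (hQm x hx).1) y (wS y (hQm y hy).1) z (wS z (hQm z hz).1) _ (fS _ ht.1) v hv (fv _ ht.1).ne'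
        (allB x hx y hy xy) (allB x hx z hz xz) (allB y hy z hz yz) (m x hx) (m y hy) (m z hz)
        (wv x (hQm x hx).1).symm (wv y (hQm y hy).1).symm (wv z (hQm z hz).1).symm
    · rename_i e
      rw [e]
      by_contra hc1
      push Not at hc1
      obtain ⟨x, hx⟩ : Q.Nonempty := Finset.card_pos.1 (by omega)
      have h2 : 2 < (Q.erase x).card := by rw [Finset.card_erase_of_mem hx]; omega
      obtain ⟨y, z, t, hy, hz, ht', yz, yt, zt⟩ := Finset.two_lt_card_iff.1 h2
      rw [Finset.mem_erase] at hy hz ht'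
      exact hB x (wS x (hQm x hx).1) y (wS y (hQm y hy.2).1) z (wS z (hQm z hz.2).1) t (wS t (hQm t ht'.2).1) v hv
        (wv t (hQm t ht'.2).1).ne'
        (allB x hx y hy.2 hy.1.symm) (allB x hx z hz.2 hz.1.symm) (allB y hy.2 z hz.2 yz)
        (allB x hx t ht'.2 ht'.1.symm) (allB y hy.2 t ht'.2 yt) (allB z hz.2 t ht'.2 zt)
        (wv x (hQm x hx).1).symm (wv y (hQm y hy.2).1).symm (wv z (hQm z hz.2).1).symm
    · simp at ht
end GRP

set_option linter.all false
namespace GRP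
open scoped Classical
variable {V : Type*}

theorem no11 (R : SimpleGraph V) (S : Finset V) (hR : Fr 4 R S) (hB : Fr 4 Rᶜ S) (hS : S.card = 22) {v : V}
    (hv : v ∈ S) (hd : (nb R S v).card = 11) (he : 48 ≤ ed R (nb R S v)) : False := by
  have hH : Fr 3 R (nb R S v) := jn4 (sing_sub hv) (nb_sub ..) jn_nb hR (by simp)
  obtain ⟨g, hg, f, h1, h2, h3⟩ := canon11 R _ hH (hB.mono (nb_sub ..)) hd he
  rw [← crt11_gs, List.mem_map] at hg
  obtain ⟨p, hp, rfl⟩ := hg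
  have a1 := List.all_eq_true.1 crt11_ok p hp
  have a2 := List.all_eq_true.1 crt11_cap p hp
  have := cone_bound R S hR hB hv h1 h2 (by omega) h3 a1
  have h5 := Nat.le_of_ble_eq_true a2
  have := card_split (cov_compl R S) hv
  omega

theorem no12 (R : SimpleGraph V) (S : Finset V) (hR : Fr 4 R S) (hB : Fr 4 Rᶜ S) (hS : S.card = 22) {v : V}
    (hv : v ∈ S) (hd : (nb R S v).card = 12) (he : 56 ≤ ed R (nb R S v)) : False := by
  have hH : Fr 3 R (nb R S v) := jn4 (sing_sub hv) (nb_sub ..) jn_nb hR (by simp)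
  obtain ⟨g, hg, f, h1, h2, h3⟩ := canon12 R _ hH (hB.mono (nb_sub ..)) hd he
  rw [← crt12_gs, List.mem_map] at hg
  obtain ⟨p, hp, rfl⟩ := hg
  have a1 := List.all_eq_true.1 crt12_ok p hp
  have a2 := List.all_eq_true.1 crt12_cap p hp
  have := cone_bound R S hR hB hv h1 h2 (by omega) h3 a1
  have h5 := Nat.le_of_ble_eq_true a2
  have := card_split (cov_compl R S) hv
  omega

theorem half22 (R : SimpleGraph V) (S : Finset V) (hR : Fr 4 R S) (hB : Fr 4 Rᶜ S) (hS : S.card = 22) {v : V}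
    (hv : v ∈ S) (d : ℕ) (hd : (nb R S v).card = d) (hd' : (nb Rᶜ S v).card + d = 21) (h11 : 11 ≤ d)
    (he : 420 ≤ (ed R (nb R S v) : ℤ) + ed Rᶜ (nb Rᶜ S v) + 3 * d * (21 - d)) : False := by
  have hH : Fr 3 R (nb R S v) := jn4 (sing_sub hv) (nb_sub ..) jn_nb hR (by simp)
  have hH4 := hB.mono (nb_sub (G := Rᶜ) (S := S) (v := v))
  have hH5 : Fr 4 Rᶜ (nb R S v) := hB.mono (nb_sub ..)
  have hK : Fr 3 Rᶜ (nb Rᶜ S v) := jn4 (sing_sub hv) (nb_sub ..) jn_nb hB (by simp)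
  have hK5 : Fr 4 Rᶜᶜ (nb Rᶜ S v) := by rw [compl_compl]; exact hR.mono (nb_sub ..)
  have h16 := f34 (cov_compl R _) hH hH5
  have E1 := ed_even R (nb R S v)
  by_cases c11 : d = 11
  · subst c11
    have b1 := EB10 Rᶜ (nb Rᶜ S v) (by omega) hK hK5
    push_cast at he
    exact no11 R S hR hB hS hv hd (by omega)
  by_cases c12 : d = 12
  · subst c12
    have b1 := EB9 Rᶜ (nb Rᶜ S v) (by omega) hK hK5
    push_cast at he
    exact no12 R S hR hB hS hv hd (by omega)
  have : d = 13 ∨ d = 14 ∨ d = 15 ∨ d = 16 := by omega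
  rcases this with h | h | h | h
  · subst h
    have b1 := EB8 Rᶜ (nb Rᶜ S v) (by omega) hK hK5
    have b2 := EB13 R (nb R S v) (by omega) hH hH5
    push_cast at he; omega
  · subst h
    have b1 := EB7 Rᶜ (nb Rᶜ S v) (by omega) hK hK5
    have b2 := EB14 R (nb R S v) (by omega) hH hH5
    push_cast at he; omega
  · subst h
    have b1 := EB6 Rᶜ (nb Rᶜ S v) (by omega) hK hK5
    have b2 := EB15 R (nb R S v) (by omega) hH hH5
    push_cast at he; omega
  · subst h
    have b1 := EB5 Rᶜ (nb Rᶜ S v) (by omega) hK hK5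
    have b2 := EB16 R (nb R S v) (by omega) hH hH5
    push_cast at he; omega

theorem f44 {R B : SimpleGraph V} {S : Finset V} (hc : Cov R B S) (hR : Fr 4 R S) (hB : Fr 4 B S) : S.card ≤ 21 := by
  by_contra hcon
  obtain ⟨T, hTS, hT⟩ := Finset.exists_subset_card_eq (show 22 ≤ S.card by omega)
  have hR' := hR.mono hTS
  have hB' : Fr 4 Rᶜ T := compl_free (hc.mono hTS) (hB.mono hTS)
  have hgd := goodman R T
  rw [hT] at hgd
  have : ∃ v ∈ T, 420 ≤ ((ed R (nb R T v) : ℤ) + ed Rᶜ (nb Rᶜ T v) +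
      3 * (nb R T v).card * (((22:ℕ) : ℤ) - 1 - (nb R T v).card)) := by
    by_contra hn
    push Not at hn
    have := Finset.sum_le_card_nsmul T _ 419 (fun v hv => Int.le_of_lt_add_one (hn v hv))
    rw [hgd, hT] at this
    norm_num at this
  obtain ⟨v, hv, h⟩ := this
  have hs := card_split (cov_compl R T) hv
  have hd : (nb R T v).card + (nb Rᶜ T v).card ≤ 21 := by
    rw [← Finset.card_union_of_disjoint]
    · have : nb R T v ∪ nb Rᶜ T v ⊆ T.erase v := by
        intro x hx
        rw [Finset.mem_union, mem_nb, mem_nb] at hx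
        rw [Finset.mem_erase]
        rcases hx with hx | hx
        · exact ⟨hx.2.ne', hx.1⟩
        · exact ⟨hx.2.ne', hx.1⟩
      have := Finset.card_le_card this
      rw [Finset.card_erase_of_mem hv] at this
      omega
    · rw [Finset.disjoint_left]
      intro x hx hx'
      rw [mem_nb] at hx hx'
      rw [SimpleGraph.compl_adj] at hx'
      exact hx'.2.2 hx.2
  by_cases h11 : 11 ≤ (nb R T v).card
  · refine half22 R T hR' hB' hT hv _ rfl (by omega) h11 ?_
    push_cast at h ⊢
    linarith
  · have e2 : (nb Rᶜᶜ T v) = nb R T v := by rw [compl_compl]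
    have e3 : ed Rᶜᶜ (nb Rᶜᶜ T v) = ed R (nb R T v) := by rw [compl_compl]
    refine half22 Rᶜ T hB' (by rw [compl_compl]; exact hR') hT hv _ rfl (by rw [e2]; omega) (by omega) ?_
    rw [e3]
    have e4 : ((nb Rᶜ T v).card : ℤ) = 21 - (nb R T v).card := by omega
    rw [e4]
    push_cast at h
    linarith
end GRP

set_option linter.all false

namespace GRP
open scoped Classical
variable {V : Type*}

noncomputable def bt (t : ℕ) : ℝ :=
  match t with
  | 0 => 1 | 1 => 2 | 2 => 1 | 3 => 9/5 | _ => 21/17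
noncomputable def wt (t : ℕ) : ℝ :=
  match t with
  | 0 => 1 | 1 => 1 | 2 => √5 | 3 => √5 | _ => √17

noncomputable def gg (β W : ℝ) (x y : ℕ) : ℝ := max (bt x) (max (bt y) β) * (wt x * wt y) * W

theorem gg_comm (β W : ℝ) (x y : ℕ) : gg β W x y = gg β W y x := by
  unfold gg
  rw [max_left_comm, mul_comm (wt x)]

structure Nm (β W : ℝ) : Prop where
  hβ : β = 1 ∨ β = 21/17 ∨ β = 9/5 ∨ β = 2
  hW : 1 ≤ W

theorem sq5 : (2.236 : ℝ) ≤ √5 ∧ √5 ≤ (2.2361 : ℝ) := by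
  constructor
  · apply Real.le_sqrt_of_sq_le; norm_num
  · rw [Real.sqrt_le_left (by norm_num)]; norm_num
theorem sq17 : (4.1231 : ℝ) ≤ √17 ∧ √17 ≤ (4.1232 : ℝ) := by
  constructor
  · apply Real.le_sqrt_of_sq_le; norm_num
  · rw [Real.sqrt_le_left (by norm_num)]; norm_num
theorem sq85 : (9.2195 : ℝ) ≤ √5 * √17 ∧ √5 * √17 ≤ (9.2196 : ℝ) := by
  rw [← Real.sqrt_mul (by norm_num)]
  constructor
  · apply Real.le_sqrt_of_sq_le; norm_num
  · rw [Real.sqrt_le_left (by norm_num)]; norm_num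

theorem Nm.b {β W : ℝ} (h : Nm β W) : 1 ≤ W ∧ (2.236 : ℝ) * W ≤ √5 * W ∧ √5 * W ≤ 2.2361 * W ∧
    4.1231 * W ≤ √17 * W ∧ √17 * W ≤ 4.1232 * W ∧ 9.2195 * W ≤ √5 * √17 * W ∧
    √5 * √17 * W ≤ 9.2196 * W ∧ √5 ^ 2 * W = 5 * W ∧ √17 ^ 2 * W = 17 * W := by
  have h1 := h.hW
  have h0 : 0 ≤ W := by linarith
  refine ⟨h1, ?_, ?_, ?_, ?_, ?_, ?_, ?_, ?_⟩
  · exact mul_le_mul_of_nonneg_right sq5.1 h0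
  · exact mul_le_mul_of_nonneg_right sq5.2 h0
  · exact mul_le_mul_of_nonneg_right sq17.1 h0
  · exact mul_le_mul_of_nonneg_right sq17.2 h0
  · exact mul_le_mul_of_nonneg_right sq85.1 h0
  · exact mul_le_mul_of_nonneg_right sq85.2 h0
  · rw [Real.sq_sqrt (by norm_num)]
  · rw [Real.sq_sqrt (by norm_num)]

section
variable {β W : ℝ} (h : Nm β W)
include h

theorem n_single : 2 ≤ gg β W 1 1 ∧ 4 ≤ gg β W 1 2 ∧ 4 ≤ gg β W 1 3 ∧ 6 ≤ gg β W 1 4 ∧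
    5 ≤ gg β W 2 2 ∧ 6 ≤ gg β W 2 3 ∧ 9 ≤ gg β W 3 3 ∧ 11 ≤ gg β W 2 4 ∧ 16 ≤ gg β W 3 4 ∧
    21 ≤ gg β W 4 4 ∧ 1 ≤ gg β W 0 0 := by
  obtain ⟨h1, h2, h3, h4, h5, h6, h7, h8, h9⟩ := h.b
  refine ⟨?_, ?_, ?_, ?_, ?_, ?_, ?_, ?_, ?_, ?_, ?_⟩ <;>
  rcases h.hβ with rfl | rfl | rfl | rfl <;> norm_num [gg, bt, wt, max_def] <;> linarith

theorem n_one : 2 ≤ gg β W 1 0 ∧ 2 * gg β W 0 0 ≤ gg β W 2 0 ∧ 2 * gg β W 0 0 ≤ gg β W 3 0 ∧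
    1 + gg β W 1 0 ≤ gg β W 3 0 ∧ 1 + gg β W 3 0 ≤ gg β W 4 0 ∧ 2 * gg β W 1 0 ≤ gg β W 4 0 ∧
    gg β W 0 0 + gg β W 2 0 ≤ gg β W 4 0 := by
  obtain ⟨h1, h2, h3, h4, h5, h6, h7, h8, h9⟩ := h.b
  refine ⟨?_, ?_, ?_, ?_, ?_, ?_, ?_⟩ <;>
  rcases h.hβ with rfl | rfl | rfl | rfl <;> norm_num [gg, bt, wt, max_def] <;> linarith

theorem n_2 : 5 * gg β W 0 0 ≤ gg β W 2 2 ∧ gg β W 0 1 + 1 + gg β W 0 3 ≤ gg β W 2 3 ∧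
    5 * gg β W 0 0 ≤ gg β W 2 3 ∧ gg β W 1 1 + 1 + gg β W 3 0 ≤ gg β W 3 3 ∧
    5 * gg β W 0 0 ≤ gg β W 3 3 ∧
    gg β W 0 3 + 1 + gg β W 0 4 ≤ gg β W 2 4 ∧
    gg β W 0 2 + gg β W 2 0 + gg β W 0 4 ≤ gg β W 2 4 ∧
    gg β W 0 1 + 2 * gg β W 0 1 + gg β W 0 4 ≤ gg β W 2 4 ∧
    9 * gg β W 0 0 ≤ gg β W 2 4 := by
  obtain ⟨h1, h2, h3, h4, h5, h6, h7, h8, h9⟩ := h.b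
  refine ⟨?_, ?_, ?_, ?_, ?_, ?_, ?_, ?_, ?_⟩ <;>
  rcases h.hβ with rfl | rfl | rfl | rfl <;> norm_num [gg, bt, wt, max_def] <;> linarith

theorem n_3 : gg β W 1 3 + 1 + gg β W 3 2 ≤ gg β W 3 4 ∧
    gg β W 0 3 + 1 + gg β W 0 4 ≤ gg β W 3 4 ∧
    gg β W 0 2 + gg β W 3 0 + gg β W 0 4 ≤ gg β W 3 4 ∧
    gg β W 0 1 + gg β W 3 1 + gg β W 0 4 ≤ gg β W 3 4 ∧
    9 * gg β W 0 0 ≤ gg β W 3 4 ∧ gg β W 0 1 = 2 * W ∧ 2 ≤ gg β W 0 1 ∧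
    gg β W 1 3 + 2 ≤ gg β W 1 1 + gg β W 1 2 ∧
    gg β W 1 0 + gg β W 1 2 ≤ gg β W 1 1 + gg β W 1 2 ∧
    2 * gg β W 1 1 ≤ gg β W 1 1 + gg β W 1 2 ∧ 17 * gg β W 0 0 ≤ gg β W 4 4 := by
  obtain ⟨h1, h2, h3, h4, h5, h6, h7, h8, h9⟩ := h.b
  refine ⟨?_, ?_, ?_, ?_, ?_, ?_, ?_, ?_, ?_, ?_, ?_⟩ <;>
  rcases h.hβ with rfl | rfl | rfl | rfl <;> norm_num [gg, bt, wt, max_def] <;> linarith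

end
/-- bound for a neighbourhood of a part with given level, type 4 -/
noncomputable def nr (β W : ℝ) (t : ℕ) : ℝ :=
  match t with
  | 0 => gg β W 2 4 | 1 => gg β W 1 1 + gg β W 1 2 | 2 => gg β W 0 4 | _ => 1

theorem n_4 {β W : ℝ} (h : Nm β W) (t b : ℕ) (ht : t ≤ 3) (hb : b ≤ 3) (hn : ¬ (t = 0 ∧ b = 0)) :
    gg β W t b + nr β W t + nr β W b ≤ gg β W 4 4 := by
  obtain ⟨h1, h2, h3, h4, h5, h6, h7, h8, h9⟩ := h.b
  interval_cases t <;> interval_cases b <;> first | (exfalso; revert hn; decide) | skip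
  all_goals
  rcases h.hβ with rfl | rfl | rfl | rfl <;> norm_num [gg, bt, wt, nr, max_def] <;> linarith
end GRP

set_option linter.all false

namespace GRP
open scoped Classical
variable {V : Type*}

structure Ctx (R B : SimpleGraph V) (S : Finset V) (p : V → V) (β W : ℝ) : Prop where
  nm : Nm β W
  mem : ∀ x ∈ S, p x ∈ S
  idem : ∀ x ∈ S, p (p x) = p x
  homR : ∀ x ∈ S, ∀ y ∈ S, p x ≠ p y → R.Adj (p x) (p y) → R.Adj x y
  homB : ∀ x ∈ S, ∀ y ∈ S, p x ≠ p y → B.Adj (p x) (p y) → B.Adj x y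
  cov : Cov R B (S.image p)
  red : ∀ a ∈ S.image p, ∃ b ∈ S.image p, R.Adj a b
  blu : ∀ a ∈ S.image p, ∃ b ∈ S.image p, B.Adj a b
  IH : ∀ Q, Q ⊂ S → ∀ x y, x ≤ 4 → y ≤ 4 → Fr x R Q → Fr y B Q → (Q.card : ℝ) ≤ gg β W x y

/-- union of the parts with representative in Q -/
noncomputable def UU (S : Finset V) (p : V → V) (Q : Finset V) : Finset V := S.filter (fun x => p x ∈ Q)

variable {R B : SimpleGraph V} {S : Finset V} {p : V → V} {β W : ℝ}

theorem Ctx.symm (c : Ctx R B S p β W) : Ctx B R S p β W :=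
  ⟨c.nm, c.mem, c.idem, c.homB, c.homR, c.cov.symm, c.blu, c.red, fun Q hQ x y hx hy h1 h2 => by
    rw [gg_comm]; exact c.IH Q hQ y x hy hx h2 h1⟩

theorem mem_UU {Q : Finset V} {x : V} : x ∈ UU S p Q ↔ x ∈ S ∧ p x ∈ Q := by simp [UU]
theorem UU_sub {Q : Finset V} : UU S p Q ⊆ S := Finset.filter_subset _ _
theorem UU_mono {Q Q' : Finset V} (h : Q ⊆ Q') : UU S p Q ⊆ UU S p Q' := by
  intro x hx
  rw [mem_UU] at *
  exact ⟨hx.1, h hx.2⟩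

theorem card_UU_le (Q : Finset V) (u : ℝ) (h : ∀ a ∈ Q, ((UU S p {a}).card : ℝ) ≤ u) :
    ((UU S p Q).card : ℝ) ≤ Q.card * u := by
  have : (UU S p Q).card = ∑ a ∈ Q, (UU S p {a}).card := by
    rw [Finset.card_eq_sum_card_fiberwise (f := p) (t := Q)]
    · apply Finset.sum_congr rfl
      intro a ha
      congr 1
      ext x
      rw [Finset.mem_filter, mem_UU, mem_UU, Finset.mem_singleton]
      constructor
      · rintro ⟨⟨h1, h2⟩, h3⟩; exact ⟨h1, h3⟩
      · rintro ⟨h1, h2⟩; exact ⟨⟨h1, by rw [h2]; exact ha⟩, h2⟩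
    · intro x hx
      have := Finset.mem_coe.1 hx
      rw [mem_UU] at this
      exact this.2
  rw [this]
  push_cast
  calc _ ≤ ∑ a ∈ Q, u := Finset.sum_le_sum h
    _ = _ := by simp

theorem card_UU_single (Q : Finset V) (h : ∀ a ∈ Q, (UU S p {a}).card ≤ 1) :
    (UU S p Q).card ≤ Q.card := by
  have := card_UU_le (S := S) (p := p) Q 1 (fun a ha => by exact_mod_cast h a ha)
  rw [mul_one] at this
  exact_mod_cast this

namespace Ctx
variable (c : Ctx R B S p β W)
include c

theorem T_sub : S.image p ⊆ S := by
  intro x hx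
  obtain ⟨y, hy, rfl⟩ := Finset.mem_image.1 hx
  exact c.mem y hy

theorem pT {a : V} (ha : a ∈ S.image p) : p a = a := by
  obtain ⟨y, hy, rfl⟩ := Finset.mem_image.1 ha
  exact c.idem y hy

theorem sub_UU {Q : Finset V} (hQ : Q ⊆ S.image p) : Q ⊆ UU S p Q := by
  intro x hx
  rw [mem_UU, c.pT (hQ hx)]
  exact ⟨c.T_sub (hQ hx), hx⟩

theorem UU_T : UU S p (S.image p) = S := by
  ext x
  rw [mem_UU]
  exact ⟨fun h => h.1, fun h => ⟨h, Finset.mem_image_of_mem _ h⟩⟩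

theorem ssub {Q : Finset V} {a : V} (ha : a ∈ S.image p) (h : a ∉ Q) : UU S p Q ⊂ S := by
  rw [Finset.ssubset_iff_of_subset UU_sub]
  refine ⟨a, c.T_sub ha, fun hx => h ?_⟩
  rw [mem_UU, c.pT ha] at hx
  exact hx.2

theorem jR {Q Q' : Finset V} (h : Jn R Q Q') : Jn R (UU S p Q) (UU S p Q') := by
  intro a ha b hb
  rw [mem_UU] at ha hb
  have := h _ ha.2 _ hb.2
  exact c.homR a ha.1 b hb.1 this.ne this

theorem jB {Q Q' : Finset V} (h : Jn B Q Q') : Jn B (UU S p Q) (UU S p Q') := c.symm.jR h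

theorem ne {a : V} (ha : a ∈ S.image p) : (UU S p {a}).Nonempty :=
  ⟨a, c.sub_UU (by simpa using ha) (by simp)⟩

/-- splitting a union of parts -/
theorem split {Q : Finset V} (hQ : Q ⊆ S.image p) {q : V} (hq : q ∈ Q) :
    (UU S p Q).card ≤ (UU S p {q}).card + (UU S p (nb R Q q)).card + (UU S p (nb B Q q)).card := by
  have : UU S p Q ⊆ UU S p {q} ∪ UU S p (nb R Q q) ∪ UU S p (nb B Q q) := by
    intro x hx
    rw [mem_UU] at hx
    simp only [Finset.mem_union, mem_UU, mem_nb, Finset.mem_singleton]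
    by_cases h : p x = q
    · tauto
    · have := c.cov q (hQ hq) (p x) (hQ hx.2) (Ne.symm h)
      tauto
  calc _ ≤ _ := Finset.card_le_card this
    _ ≤ _ := (Finset.card_union_le _ _).trans (by
      have := Finset.card_union_le (UU S p {q}) (UU S p (nb R Q q))
      omega)

theorem splitS {q : V} (hq : q ∈ S.image p) :
    (S.card : ℝ) ≤ (UU S p {q}).card + (UU S p (nb R (S.image p) q)).card
      + (UU S p (nb B (S.image p) q)).card := by
  have := c.split (Finset.Subset.refl _) hq
  rw [c.UU_T] at this
  exact_mod_cast this

theorem jnR {Q : Finset V} {q : V} : Jn R (UU S p {q}) (UU S p (nb R Q q)) := c.jR jn_nb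
theorem jnB {Q : Finset V} {q : V} : Jn B (UU S p {q}) (UU S p (nb B Q q)) := c.jB jn_nb

theorem nbR_ne {a : V} (ha : a ∈ S.image p) : (UU S p (nb R (S.image p) a)).Nonempty := by
  obtain ⟨b, hb, h⟩ := c.red a ha
  refine ⟨b, c.sub_UU nb_sub (mem_nb.2 ⟨hb, h⟩)⟩

theorem nbB_ne {a : V} (ha : a ∈ S.image p) : (UU S p (nb B (S.image p) a)).Nonempty :=
  c.symm.nbR_ne ha

theorem ssR {a : V} (ha : a ∈ S.image p) {Q : Finset V} : UU S p (nb R Q a) ⊂ S :=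
  c.ssub ha (fun h => (mem_nb.1 h).2.ne rfl)
theorem ssB {a : V} (ha : a ∈ S.image p) {Q : Finset V} : UU S p (nb B Q a) ⊂ S :=
  c.symm.ssR ha
theorem ssP {a : V} (ha : a ∈ S.image p) : UU S p {a} ⊂ S := by
  obtain ⟨b, hb, h⟩ := c.red a ha
  exact c.ssub hb (by simpa using h.ne')

/-- all parts single: S is its own set of reps -/
theorem all_single (h : ∀ a ∈ S.image p, (UU S p {a}).card ≤ 1) : S.card ≤ (S.image p).card := by
  have := card_UU_single (S := S) (p := p) (S.image p) h
  rwa [c.UU_T] at this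

/-- either all singles or a big part -/
theorem big_or : S.card ≤ (S.image p).card ∨ ∃ a ∈ S.image p, 1 < (UU S p {a}).card := by
  by_cases h : ∃ a ∈ S.image p, 1 < (UU S p {a}).card
  · exact Or.inr h
  · push Not at h
    exact Or.inl (c.all_single h)

/-! descend of types in parts -/
theorem pR2 (hR : Fr 2 R S) {a : V} (ha : a ∈ S.image p) : Fr 0 R (UU S p {a}) :=
  jn2 UU_sub UU_sub (c.jnR.symm) hR (c.nbR_ne ha)
theorem pR3 (hR : Fr 3 R S) {a : V} (ha : a ∈ S.image p) : Fr 1 R (UU S p {a}) :=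
  jn3 UU_sub UU_sub (c.jnR.symm) hR (c.nbR_ne ha)
theorem pR4 (hR : Fr 4 R S) {a : V} (ha : a ∈ S.image p) : Fr 3 R (UU S p {a}) :=
  jn4 UU_sub UU_sub (c.jnR.symm) hR (c.nbR_ne ha)

theorem no0 (hne : S.Nonempty) (hR : Fr 0 R S) : False := by
  obtain ⟨x, hx⟩ := hne
  have ha := Finset.mem_image_of_mem p hx
  have := jn0 UU_sub UU_sub (c.jnR (Q := S.image p)) hR (c.ne ha)
  have h2 := c.nbR_ne ha
  rw [this] at h2
  simp at h2

theorem one_single (hR : Fr 1 R S) : S.card ≤ (S.image p).card := by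
  refine c.all_single fun a ha => ?_
  exact jn1 UU_sub UU_sub (c.jnR.symm) hR (c.nbR_ne ha)

theorem case1 {y : ℕ} (hy0 : y ≠ 0) (hy : y ≤ 4) (hR : Fr 1 R S) (hB : Fr y B S) :
    (S.card : ℝ) ≤ gg β W 1 y := by
  have h1 := c.one_single hR
  have hR := hR.mono c.T_sub
  have hB := hB.mono c.T_sub
  obtain ⟨n1, n2, n3, n4, -⟩ := n_single c.nm
  have : ∀ n : ℕ, (S.image p).card ≤ n → (S.card : ℝ) ≤ n := fun n hn => by
    exact_mod_cast h1.trans hn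
  interval_cases y
  · exact absurd rfl hy0
  · exact (this _ (f11 c.cov hR hB)).trans (by exact_mod_cast n1)
  · exact (this _ (f12 c.cov hR hB)).trans (by exact_mod_cast n2)
  · exact (this _ (f13 c.cov hR hB)).trans (by exact_mod_cast n3)
  · exact (this _ (f14 c.cov hR hB)).trans (by exact_mod_cast n4)

theorem p00 {a : V} (ha : a ∈ S.image p) (h1 : Fr 0 R (UU S p {a})) (h2 : Fr 0 B (UU S p {a})) :
    ((UU S p {a}).card : ℝ) ≤ gg β W 0 0 :=
  c.IH _ (c.ssP ha) 0 0 (by norm_num) (by norm_num) h1 h2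

theorem case22 (hR : Fr 2 R S) (hB : Fr 2 B S) : (S.card : ℝ) ≤ gg β W 2 2 := by
  have := card_UU_le (S := S) (p := p) (S.image p) (gg β W 0 0) fun a ha =>
    c.p00 ha (c.pR2 hR ha) (c.symm.pR2 hB ha)
  rw [c.UU_T] at this
  have h5 : ((S.image p).card : ℝ) ≤ 5 := by
    exact_mod_cast f22 c.cov (hR.mono c.T_sub) (hB.mono c.T_sub)
  have h1 := (n_single c.nm).2.2.2.2.2.2.2.2.2.2
  have := (n_2 c.nm).1
  nlinarith

/-- part with all (0,0) parts: bounds by number of reps -/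
theorem reps {Q : Finset V} (hQ : Q ⊆ S.image p)
    (h0 : ∀ a ∈ S.image p, Fr 0 R (UU S p {a}) ∧ Fr 0 B (UU S p {a})) (n : ℕ) (hn : Q.card ≤ n) :
    ((UU S p Q).card : ℝ) ≤ n * gg β W 0 0 := by
  have := card_UU_le (S := S) (p := p) Q (gg β W 0 0) fun a ha =>
    c.p00 (hQ ha) (h0 a (hQ ha)).1 (h0 a (hQ ha)).2
  have h1 := (n_single c.nm).2.2.2.2.2.2.2.2.2.2
  have h3 : (Q.card : ℝ) ≤ n := by exact_mod_cast hn
  nlinarith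

/-- if there's a big part of type (0,0), u≥2 -/
theorem u2 {a : V} (ha : a ∈ S.image p) (h1 : Fr 0 R (UU S p {a})) (h2 : Fr 0 B (UU S p {a}))
    (hb : 1 < (UU S p {a}).card) : 2 ≤ gg β W 0 0 :=
  le_trans (by exact_mod_cast hb) (c.p00 ha h1 h2)

end Ctx
end GRP

set_option linter.all false

namespace GRP
open scoped Classical
variable {V : Type*}
variable {R B : SimpleGraph V} {S : Finset V} {p : V → V} {β W : ℝ}

theorem big_of_not0 {G : SimpleGraph V} {A : Finset V} (h : ¬ Fr 0 G A) : 1 < A.card := by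
  by_contra hc
  push Not at hc
  rw [Finset.card_le_one] at hc
  exact h fun x hx y hy e => e.ne (hc x hx y hy)

namespace Ctx
variable (c : Ctx R B S p β W)
include c

/-- IH with real cast, applied to neighbourhoods -/
theorem ihP {a : V} (ha : a ∈ S.image p) {x y : ℕ} (hx : x ≤ 4) (hy : y ≤ 4)
    (h1 : Fr x R (UU S p {a})) (h2 : Fr y B (UU S p {a})) :
    ((UU S p {a}).card : ℝ) ≤ gg β W x y := c.IH _ (c.ssP ha) x y hx hy h1 h2
theorem ihR {a : V} (ha : a ∈ S.image p) {Q : Finset V} {x y : ℕ} (hx : x ≤ 4) (hy : y ≤ 4)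
    (h1 : Fr x R (UU S p (nb R Q a))) (h2 : Fr y B (UU S p (nb R Q a))) :
    ((UU S p (nb R Q a)).card : ℝ) ≤ gg β W x y := c.IH _ (c.ssR ha) x y hx hy h1 h2
theorem ihB {a : V} (ha : a ∈ S.image p) {Q : Finset V} {x y : ℕ} (hx : x ≤ 4) (hy : y ≤ 4)
    (h1 : Fr x R (UU S p (nb B Q a))) (h2 : Fr y B (UU S p (nb B Q a))) :
    ((UU S p (nb B Q a)).card : ℝ) ≤ gg β W x y := c.IH _ (c.ssB ha) x y hx hy h1 h2

theorem nrb3 (hB : Fr 3 B S) {Q : Finset V} (hQ : Q ⊆ S.image p) (h0R : Fr 0 R Q)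
    (h0 : ∀ a ∈ S.image p, Fr 0 R (UU S p {a}) ∧ Fr 0 B (UU S p {a})) (hu : 2 ≤ gg β W 0 0) :
    ((UU S p Q).card : ℝ) ≤ 2 * gg β W 0 0 := by
  have hQS : Q ⊆ S := hQ.trans c.T_sub
  by_cases hb : ∃ q ∈ Q, 1 < (UU S p {q}).card
  · obtain ⟨q, hq, hb⟩ := hb
    have h1 := card_split (c.cov.mono hQ) hq
    have h2 := nb0 h0R q hq
    have h3 := jn3b UU_sub UU_sub (c.jnB (Q := Q)) hB hb
    have h4 := f00 (c.cov.mono (nb_sub.trans hQ)) (h0R.mono (nb_sub (G := B) (v := q)))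
      (h3.mono (c.sub_UU (nb_sub.trans hQ)))
    exact_mod_cast c.reps hQ h0 2 (by omega)
  · push Not at hb
    have h1 := card_UU_single (S := S) (p := p) Q hb
    have h2 := f03 (c.cov.mono hQ) h0R (hB.mono hQS)
    have : ((UU S p Q).card : ℝ) ≤ 3 := by exact_mod_cast h1.trans h2
    linarith

theorem nrb4 (hB : Fr 4 B S) {Q : Finset V} (hQ : Q ⊆ S.image p) (h0R : Fr 0 R Q)
    (h0 : ∀ a ∈ S.image p, Fr 0 R (UU S p {a}) ∧ Fr 0 B (UU S p {a})) (hu : 2 ≤ gg β W 0 0) :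
    ((UU S p Q).card : ℝ) ≤ 3 * gg β W 0 0 := by
  have hQS : Q ⊆ S := hQ.trans c.T_sub
  by_cases hb : ∃ q ∈ Q, 1 < (UU S p {q}).card
  · obtain ⟨q, hq, hb⟩ := hb
    have h1 := card_split (c.cov.mono hQ) hq
    have h2 := nb0 h0R q hq
    have h3 := jn4b UU_sub UU_sub (c.jnB (Q := Q)) hB hb
    have h4 := f02 (c.cov.mono (nb_sub.trans hQ)) (h0R.mono (nb_sub (G := B) (v := q)))
      (h3.mono (c.sub_UU (nb_sub.trans hQ)))
    exact_mod_cast c.reps hQ h0 3 (by omega)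
  · push Not at hb
    have h1 := card_UU_single (S := S) (p := p) Q hb
    have h2 := f04 (c.cov.mono hQ) h0R (hB.mono hQS)
    have : ((UU S p Q).card : ℝ) ≤ 4 := by exact_mod_cast h1.trans h2
    linarith

theorem case23 (hR : Fr 2 R S) (hB : Fr 3 B S) : (S.card : ℝ) ≤ gg β W 2 3 := by
  obtain ⟨-, n1, n2, -⟩ := n_2 c.nm
  by_cases h : ∃ a ∈ S.image p, ¬ Fr 0 B (UU S p {a})
  · obtain ⟨a, ha, h⟩ := h
    have e1 := c.ihP ha (by norm_num) (by norm_num) (c.pR2 hR ha) (c.symm.pR3 hB ha)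
    have e2 : ((UU S p (nb B (S.image p) a)).card : ℝ) ≤ 1 := by
      exact_mod_cast jn3c UU_sub UU_sub c.jnB hB h
    have e3 := c.ihR ha (by norm_num) (by norm_num)
      (jn2 UU_sub UU_sub (c.jnR (Q := S.image p)) hR (c.ne ha)) (hB.mono UU_sub)
    have := c.splitS ha
    linarith
  · push Not at h
    have h0 : ∀ a ∈ S.image p, Fr 0 R (UU S p {a}) ∧ Fr 0 B (UU S p {a}) :=
      fun a ha => ⟨c.pR2 hR ha, h a ha⟩
    rcases c.big_or with hb | ⟨a, ha, hb⟩
    · have h1 := f23 c.cov (hR.mono c.T_sub) (hB.mono c.T_sub)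
      have : (S.card : ℝ) ≤ 6 := by exact_mod_cast hb.trans h1
      linarith [(n_single c.nm).2.2.2.2.2.1]
    · have hu := c.u2 ha (h0 a ha).1 (h0 a ha).2 hb
      have e1 := c.p00 ha (h0 a ha).1 (h0 a ha).2
      have r0 := jn2 UU_sub UU_sub (c.jnR (Q := S.image p)) hR (c.ne ha)
      have e2 := c.nrb3 hB nb_sub (r0.mono (c.sub_UU nb_sub)) h0 hu
      have b0 := jn3b UU_sub UU_sub (c.jnB (Q := S.image p)) hB hb
      have e3 := c.reps (nb_sub (G := B) (v := a)) h0 2 (f02 (c.cov.symm.mono nb_sub)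
        (b0.mono (c.sub_UU nb_sub)) (hR.mono (nb_sub.trans c.T_sub)))
      have := c.splitS ha
      push_cast at e3
      linarith

theorem case33a (hR : Fr 3 R S) (hB : Fr 3 B S) {a : V} (ha : a ∈ S.image p)
    (h : ¬ Fr 0 R (UU S p {a})) : (S.card : ℝ) ≤ gg β W 3 3 := by
  obtain ⟨-, -, -, n1, -⟩ := n_2 c.nm
  have e1 := c.ihP ha (by norm_num) (by norm_num) (c.pR3 hR ha) (c.symm.pR3 hB ha)
  have e2 : ((UU S p (nb R (S.image p) a)).card : ℝ) ≤ 1 := by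
    exact_mod_cast jn3c UU_sub UU_sub c.jnR hR h
  have e3 := c.ihB ha (by norm_num) (by norm_num) (hR.mono UU_sub)
    (jn3b UU_sub UU_sub (c.jnB (Q := S.image p)) hB (big_of_not0 h))
  have := c.splitS ha
  linarith

theorem case33 (hR : Fr 3 R S) (hB : Fr 3 B S) : (S.card : ℝ) ≤ gg β W 3 3 := by
  by_cases h : ∃ a ∈ S.image p, ¬ Fr 0 R (UU S p {a})
  · obtain ⟨a, ha, h⟩ := h
    exact c.case33a hR hB ha h
  by_cases h' : ∃ a ∈ S.image p, ¬ Fr 0 B (UU S p {a})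
  · obtain ⟨a, ha, h⟩ := h'
    exact c.symm.case33a hB hR ha h
  push Not at h h'
  have h0 : ∀ a ∈ S.image p, Fr 0 R (UU S p {a}) ∧ Fr 0 B (UU S p {a}) :=
      fun a ha => ⟨h a ha, h' a ha⟩
  rcases c.big_or with hb | ⟨a, ha, hb⟩
  · have h1 := f33 c.cov (hR.mono c.T_sub) (hB.mono c.T_sub)
    have : (S.card : ℝ) ≤ 9 := by exact_mod_cast hb.trans h1
    linarith [(n_single c.nm).2.2.2.2.2.2.1]
  · have hu := c.u2 ha (h0 a ha).1 (h0 a ha).2 hb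
    have e1 := c.p00 ha (h0 a ha).1 (h0 a ha).2
    have r0 := jn3b UU_sub UU_sub (c.jnR (Q := S.image p)) hR hb
    have e2 := c.nrb3 hB nb_sub (r0.mono (c.sub_UU nb_sub)) h0 hu
    have b0 := jn3b UU_sub UU_sub (c.jnB (Q := S.image p)) hB hb
    have e3 := c.symm.nrb3 hR nb_sub (b0.mono (c.sub_UU nb_sub)) (fun a ha => (h0 a ha).symm) hu
    have := c.splitS ha
    linarith [(n_2 c.nm).2.2.2.2.1]

theorem L21 {Q : Finset V} (hQ : Q ⊆ S.image p) (h2 : Fr 2 R (UU S p Q)) (h1 : Fr 1 B (UU S p Q))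
    (h0 : ∀ a ∈ S.image p, Fr 0 R (UU S p {a})) : ((UU S p Q).card : ℝ) ≤ 2 * gg β W 0 1 := by
  have n2 := (n_3 c.nm).2.2.2.2.2.2.1
  rcases Q.eq_empty_or_nonempty with rfl | ⟨q, hq⟩
  · have : UU S p ∅ = ∅ := by simp [UU]
    rw [this]; simp; linarith
  have hP : UU S p {q} ⊆ UU S p Q := UU_mono (by simpa using hq)
  have hr : UU S p (nb R Q q) ⊆ UU S p Q := UU_mono nb_sub
  have hb : UU S p (nb B Q q) ⊆ UU S p Q := UU_mono nb_sub
  have e1 := c.ihR (hQ hq) (by norm_num) (by norm_num)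
    (jn2 hP hr (c.jnR (Q := Q)) h2 (c.ne (hQ hq))) (h1.mono hr)
  have hs : ((UU S p Q).card : ℝ) ≤ (UU S p {q}).card + (UU S p (nb R Q q)).card
    + (UU S p (nb B Q q)).card := by exact_mod_cast c.split hQ hq
  rcases (UU S p (nb B Q q)).eq_empty_or_nonempty with he | hne
  · have e2 := c.ihP (hQ hq) (by norm_num) (by norm_num) (h0 q (hQ hq)) (h1.mono hP)
    rw [he] at hs
    simp at hs
    linarith
  · have e2 : ((UU S p {q}).card : ℝ) ≤ 1 := by
      exact_mod_cast jn1 hb hP (c.jnB (Q := Q)).symm h1 hne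
    have e3 : ((UU S p (nb B Q q)).card : ℝ) ≤ 1 := by
      exact_mod_cast jn1 hP hb (c.jnB (Q := Q)) h1 (c.ne (hQ hq))
    linarith

theorem case24 (hR : Fr 2 R S) (hB : Fr 4 B S) : (S.card : ℝ) ≤ gg β W 2 4 := by
  obtain ⟨-, -, -, -, -, n1, n2, n3, n4⟩ := n_2 c.nm
  have r0 : ∀ a ∈ S.image p, Fr 0 R (UU S p (nb R (S.image p) a)) := fun a ha =>
    jn2 UU_sub UU_sub (c.jnR (Q := S.image p)) hR (c.ne ha)
  have eR : ∀ a ∈ S.image p, ((UU S p (nb R (S.image p) a)).card : ℝ) ≤ gg β W 0 4 := fun a ha =>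
    c.ihR ha (by norm_num) (by norm_num) (r0 a ha) (hB.mono UU_sub)
  by_cases h2 : ∃ a ∈ S.image p, ¬ Fr 2 B (UU S p {a})
  · obtain ⟨a, ha, h⟩ := h2
    have e1 := c.ihP ha (by norm_num) (by norm_num) (c.pR2 hR ha) (c.symm.pR4 hB ha)
    have e2 : ((UU S p (nb B (S.image p) a)).card : ℝ) ≤ 1 := by
      exact_mod_cast jn4e UU_sub UU_sub c.jnB hB h
    linarith [eR a ha, c.splitS ha]
  push Not at h2
  by_cases h1 : ∃ a ∈ S.image p, ¬ Fr 1 B (UU S p {a})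
  · obtain ⟨a, ha, h⟩ := h1
    have e1 := c.ihP ha (by norm_num) (by norm_num) (c.pR2 hR ha) (h2 a ha)
    have e2 := c.ihB ha (by norm_num) (by norm_num) (hR.mono UU_sub)
      (jn4d UU_sub UU_sub (c.jnB (Q := S.image p)) hB h)
    linarith [eR a ha, c.splitS ha]
  push Not at h1
  by_cases h : ∃ a ∈ S.image p, ¬ Fr 0 B (UU S p {a})
  · obtain ⟨a, ha, h⟩ := h
    have e1 := c.ihP ha (by norm_num) (by norm_num) (c.pR2 hR ha) (h1 a ha)
    have e2 := c.L21 nb_sub (hR.mono UU_sub)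
      (jn4c UU_sub UU_sub (c.jnB (Q := S.image p)) hB h) (fun a ha => c.pR2 hR ha)
    linarith [eR a ha, c.splitS ha]
  push Not at h
  have h0 : ∀ a ∈ S.image p, Fr 0 R (UU S p {a}) ∧ Fr 0 B (UU S p {a}) :=
      fun a ha => ⟨c.pR2 hR ha, h a ha⟩
  rcases c.big_or with hb | ⟨a, ha, hb⟩
  · have h1 := f24 c.cov (hR.mono c.T_sub) (hB.mono c.T_sub)
    have : (S.card : ℝ) ≤ 11 := by exact_mod_cast hb.trans h1
    linarith [(n_single c.nm).2.2.2.2.2.2.2.1]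
  · have hu := c.u2 ha (h0 a ha).1 (h0 a ha).2 hb
    have e1 := c.p00 ha (h0 a ha).1 (h0 a ha).2
    have e2 := c.nrb4 hB nb_sub ((r0 a ha).mono (c.sub_UU nb_sub)) h0 hu
    have b0 := jn4b UU_sub UU_sub (c.jnB (Q := S.image p)) hB hb
    have e3 := c.reps (nb_sub (G := B) (v := a)) h0 5 (f22 (c.cov.mono nb_sub)
      (hR.mono (nb_sub.trans c.T_sub)) (b0.mono (c.sub_UU nb_sub)))
    have := c.splitS ha
    push_cast at e3
    linarith

theorem case34 (hR : Fr 3 R S) (hB : Fr 4 B S) : (S.card : ℝ) ≤ gg β W 3 4 := by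
  obtain ⟨n0, n1, n2, n3, n4, -⟩ := n_3 c.nm
  by_cases h : ∃ a ∈ S.image p, ¬ Fr 0 R (UU S p {a})
  · obtain ⟨a, ha, h⟩ := h
    have e1 := c.ihP ha (by norm_num) (by norm_num) (c.pR3 hR ha) (c.symm.pR4 hB ha)
    have e2 : ((UU S p (nb R (S.image p) a)).card : ℝ) ≤ 1 := by
      exact_mod_cast jn3c UU_sub UU_sub c.jnR hR h
    have e3 := c.ihB ha (by norm_num) (by norm_num) (hR.mono UU_sub)
      (jn4b UU_sub UU_sub (c.jnB (Q := S.image p)) hB (big_of_not0 h))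
    linarith [c.splitS ha]
  push Not at h
  have r0 : ∀ a ∈ S.image p, 1 < (UU S p {a}).card → Fr 0 R (UU S p (nb R (S.image p) a)) :=
    fun a ha hb => jn3b UU_sub UU_sub (c.jnR (Q := S.image p)) hR hb
  have eR : ∀ a ∈ S.image p, ¬ Fr 0 B (UU S p {a}) →
      ((UU S p (nb R (S.image p) a)).card : ℝ) ≤ gg β W 0 4 := fun a ha hb =>
    c.ihR ha (by norm_num) (by norm_num) (r0 a ha (big_of_not0 hb)) (hB.mono UU_sub)
  by_cases h2 : ∃ a ∈ S.image p, ¬ Fr 2 B (UU S p {a})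
  · obtain ⟨a, ha, h2⟩ := h2
    have e1 := c.ihP ha (by norm_num) (by norm_num) (h a ha) (c.symm.pR4 hB ha)
    have e2 : ((UU S p (nb B (S.image p) a)).card : ℝ) ≤ 1 := by
      exact_mod_cast jn4e UU_sub UU_sub c.jnB hB h2
    linarith [eR a ha (fun h => h2 h.one_of_zero.two_of_one), c.splitS ha]
  push Not at h2
  by_cases h1 : ∃ a ∈ S.image p, ¬ Fr 1 B (UU S p {a})
  · obtain ⟨a, ha, h1⟩ := h1
    have e1 := c.ihP ha (by norm_num) (by norm_num) (h a ha) (h2 a ha)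
    have e2 := c.ihB ha (by norm_num) (by norm_num) (hR.mono UU_sub)
      (jn4d UU_sub UU_sub (c.jnB (Q := S.image p)) hB h1)
    linarith [eR a ha (fun h => h1 h.one_of_zero), c.splitS ha]
  push Not at h1
  by_cases h' : ∃ a ∈ S.image p, ¬ Fr 0 B (UU S p {a})
  · obtain ⟨a, ha, h'⟩ := h'
    have e1 := c.ihP ha (by norm_num) (by norm_num) (h a ha) (h1 a ha)
    have e2 := c.ihB ha (by norm_num) (by norm_num) (hR.mono UU_sub)
      (jn4c UU_sub UU_sub (c.jnB (Q := S.image p)) hB h')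
    linarith [eR a ha h', c.splitS ha]
  push Not at h'
  have h0 : ∀ a ∈ S.image p, Fr 0 R (UU S p {a}) ∧ Fr 0 B (UU S p {a}) :=
      fun a ha => ⟨h a ha, h' a ha⟩
  rcases c.big_or with hb | ⟨a, ha, hb⟩
  · have h1 := f34 c.cov (hR.mono c.T_sub) (hB.mono c.T_sub)
    have : (S.card : ℝ) ≤ 16 := by exact_mod_cast hb.trans h1
    linarith [(n_single c.nm).2.2.2.2.2.2.2.2.1]
  · have hu := c.u2 ha (h0 a ha).1 (h0 a ha).2 hb
    have e1 := c.p00 ha (h0 a ha).1 (h0 a ha).2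
    have e2 := c.nrb4 hB nb_sub ((r0 a ha hb).mono (c.sub_UU nb_sub)) h0 hu
    have b0 := jn4b UU_sub UU_sub (c.jnB (Q := S.image p)) hB hb
    have e3 : ((UU S p (nb B (S.image p) a)).card : ℝ) ≤ 5 * gg β W 0 0 := by
      have hQ : nb B (S.image p) a ⊆ S.image p := nb_sub
      have bQ : Fr 2 B (nb B (S.image p) a) := b0.mono (c.sub_UU nb_sub)
      generalize nb B (S.image p) a = Q at hQ bQ
      have rQ : Fr 3 R Q := hR.mono (hQ.trans c.T_sub)
      by_cases h5 : Q.card ≤ 5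
      · exact_mod_cast c.reps hQ h0 5 h5
      have h6 := f23 (c.cov.symm.mono hQ) bQ rQ
      have hn : ¬ Fr 2 R Q := fun hh => h5 (f22 (c.cov.mono hQ) hh bQ)
      simp only [Fr] at hn
      push Not at hn
      obtain ⟨x, hx, y, hy, z, hz, xy, xz, yz, -⟩ := hn
      have sg : ∀ x ∈ Q, ∀ y ∈ Q, ∀ z ∈ Q, R.Adj x y → R.Adj x z → R.Adj y z →
          (UU S p {x}).card ≤ 1 := by
        intro x hx y hy z hz xy xz yz
        by_contra hc
        push Not at hc
        have := (jn3b UU_sub UU_sub (c.jnR (Q := S.image p)) hR hc).mono (c.sub_UU nb_sub)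
        exact this y (mem_nb.2 ⟨hQ hy, xy⟩) z (mem_nb.2 ⟨hQ hz, xz⟩) yz
      have hxyz : ({x, y, z} : Finset V) ⊆ Q := by
        intro t ht
        simp only [Finset.mem_insert, Finset.mem_singleton] at ht
        rcases ht with rfl | rfl | rfl <;> assumption
      have h3 : ({x, y, z} : Finset V).card = 3 := by
        rw [Finset.card_eq_three]; exact ⟨x, y, z, xy.ne, xz.ne, yz.ne, rfl⟩
      have c1 := card_UU_single (S := S) (p := p) {x, y, z} (by
        intro t ht
        simp only [Finset.mem_insert, Finset.mem_singleton] at ht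
        rcases ht with rfl | rfl | rfl
        · exact sg _ hx _ hy _ hz xy xz yz
        · exact sg _ hy _ hx _ hz xy.symm yz xz
        · exact sg _ hz _ hx _ hy xz.symm yz.symm xy)
      have c2 := c.reps (Q := Q \ {x, y, z}) (Finset.sdiff_subset.trans hQ) h0 3 (by
        rw [Finset.card_sdiff_of_subset hxyz]; omega)
      have c3 : UU S p Q ⊆ UU S p {x, y, z} ∪ UU S p (Q \ {x, y, z}) := by
        intro t ht
        rw [Finset.mem_union, mem_UU, mem_UU, Finset.mem_sdiff]
        rw [mem_UU] at ht
        tauto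
      have c4 := (Finset.card_le_card c3).trans (Finset.card_union_le _ _)
      have c5 : ((UU S p Q).card : ℝ) ≤ (UU S p {x, y, z}).card + (UU S p (Q \ {x, y, z})).card := by
        exact_mod_cast c4
      have c6 : ((UU S p {x, y, z}).card : ℝ) ≤ 3 := by
        rw [h3] at c1; exact_mod_cast c1
      push_cast at c2
      linarith
    have := c.splitS ha
    linarith

end Ctx
end GRP

set_option linter.all false

namespace GRP
open scoped Classical
variable {V : Type*}
variable {R B : SimpleGraph V} {S : Finset V} {p : V → V} {β W : ℝ}

theorem lev {G : SimpleGraph V} {A : Finset V} (h : Fr 3 G A) :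
    ∃ t ≤ 3, Fr t G A ∧ ∀ s < t, ¬ Fr s G A := by
  have hex : ∃ t, Fr t G A := ⟨3, h⟩
  exact ⟨Nat.find hex, Nat.find_min' hex h, Nat.find_spec hex, fun s hs => Nat.find_min hex hs⟩

namespace Ctx
variable (c : Ctx R B S p β W)
include c

theorem L14 (hBS : Fr 4 B S) {Q : Finset V} (hQ : Q ⊆ S.image p) (h1 : Fr 1 R (UU S p Q)) :
    ((UU S p Q).card : ℝ) ≤ gg β W 1 1 + gg β W 1 2 := by
  obtain ⟨-, -, -, -, -, -, -, n1, n2, n3, -⟩ := n_3 c.nm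
  have n4 := (n_single c.nm).1
  have n5 := (n_single c.nm).2.1
  rcases Q.eq_empty_or_nonempty with rfl | ⟨q, hq⟩
  · have : UU S p ∅ = ∅ := by simp [UU]
    rw [this]; simp; linarith
  have h4 : Fr 4 B (UU S p Q) := hBS.mono UU_sub
  have hP : UU S p {q} ⊆ UU S p Q := UU_mono (by simpa using hq)
  have hr : UU S p (nb R Q q) ⊆ UU S p Q := UU_mono nb_sub
  have hb : UU S p (nb B Q q) ⊆ UU S p Q := UU_mono nb_sub
  have hs : ((UU S p Q).card : ℝ) ≤ (UU S p {q}).card + (UU S p (nb R Q q)).card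
    + (UU S p (nb B Q q)).card := by exact_mod_cast c.split hQ hq
  by_cases hbig : (UU S p {q}).card ≤ 1
  · have e1 : ((UU S p {q}).card : ℝ) ≤ 1 := by exact_mod_cast hbig
    have e2 := c.ihB (hQ hq) (by norm_num) (by norm_num) (h1.mono hb)
      (jn4 hP hb (c.jnB (Q := Q)) h4 (c.ne (hQ hq)))
    have e3 : ((UU S p (nb R Q q)).card : ℝ) ≤ 1 := by
      exact_mod_cast jn1 hP hr (c.jnR (Q := Q)) h1 (c.ne (hQ hq))
    linarith
  push Not at hbig
  have he : UU S p (nb R Q q) = ∅ := by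
    by_contra hne
    have := jn1 hr hP (c.jnR (Q := Q)).symm h1 (Finset.nonempty_iff_ne_empty.2 hne)
    omega
  rw [he] at hs
  simp at hs
  by_cases hz : (UU S p (nb B Q q)).card ≤ 1
  · have e1 : ((UU S p (nb B Q q)).card : ℝ) ≤ 1 := by exact_mod_cast hz
    have e2 := c.ihP (hQ hq) (by norm_num) (by norm_num) (h1.mono hP) (c.symm.pR4 hBS (hQ hq))
    linarith
  push Not at hz
  have z2 := jn4b hP hb (c.jnB (Q := Q)) h4 hbig
  have p2 := jn4b hb hP (c.jnB (Q := Q)).symm h4 hz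
  by_cases hz0 : Fr 0 B (UU S p (nb B Q q))
  · have e1 := c.ihB (hQ hq) (by norm_num) (by norm_num) (h1.mono hb) hz0
    have e2 := c.ihP (hQ hq) (by norm_num) (by norm_num) (h1.mono hP) p2
    linarith
  by_cases hp0 : Fr 0 B (UU S p {q})
  · have e1 := c.ihB (hQ hq) (by norm_num) (by norm_num) (h1.mono hb) z2
    have e2 := c.ihP (hQ hq) (by norm_num) (by norm_num) (h1.mono hP) hp0
    linarith
  have e1 := c.ihB (hQ hq) (by norm_num) (by norm_num) (h1.mono hb) (jn4c hP hb (c.jnB (Q := Q)) h4 hp0)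
  have e2 := c.ihP (hQ hq) (by norm_num) (by norm_num) (h1.mono hP)
    (jn4c hb hP (c.jnB (Q := Q)).symm h4 hz0)
  linarith

theorem nrbd (hR : Fr 4 R S) (hB : Fr 4 B S) {a : V} (ha : a ∈ S.image p)
    (hbig : 1 < (UU S p {a}).card) {t : ℕ} (ht : t ≤ 3) (hn : ∀ s < t, ¬ Fr s R (UU S p {a})) :
    ((UU S p (nb R (S.image p) a)).card : ℝ) ≤ nr β W t := by
  interval_cases t
  · exact c.ihR ha (by norm_num) (by norm_num)
      (jn4b UU_sub UU_sub (c.jnR (Q := S.image p)) hR hbig) (hB.mono UU_sub)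
  · exact c.L14 hB nb_sub (jn4c UU_sub UU_sub (c.jnR (Q := S.image p)) hR (hn 0 (by norm_num)))
  · exact c.ihR ha (by norm_num) (by norm_num)
      (jn4d UU_sub UU_sub (c.jnR (Q := S.image p)) hR (hn 1 (by norm_num))) (hB.mono UU_sub)
  · have := jn4e UU_sub UU_sub (c.jnR (Q := S.image p)) hR (hn 2 (by norm_num))
    simp only [nr]
    exact_mod_cast this

theorem case44a (hR : Fr 4 R S) (hB : Fr 4 B S) {a : V} (ha : a ∈ S.image p)
    (h : ¬ (Fr 0 R (UU S p {a}) ∧ Fr 0 B (UU S p {a}))) : (S.card : ℝ) ≤ gg β W 4 4 := by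
  have hbig : 1 < (UU S p {a}).card := by
    by_cases h1 : Fr 0 R (UU S p {a})
    · exact big_of_not0 (fun h2 => h ⟨h1, h2⟩)
    · exact big_of_not0 h1
  obtain ⟨t, ht, ht1, ht2⟩ := lev (c.pR4 hR ha)
  obtain ⟨b, hb, hb1, hb2⟩ := lev (c.symm.pR4 hB ha)
  have e1 := c.ihP ha (by omega) (by omega) ht1 hb1
  have e2 := c.nrbd hR hB ha hbig ht ht2
  have e3 := c.symm.nrbd hB hR ha hbig hb hb2
  have e4 := n_4 c.nm t b ht hb (by rintro ⟨rfl, rfl⟩; exact h ⟨ht1, hb1⟩)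
  linarith [c.splitS ha]

/-- vertex of a mono K4 of reps is single -/
theorem k4s (hR : Fr 4 R S) {x y z w : V} (hx : x ∈ S.image p) (hy : y ∈ S.image p)
    (hz : z ∈ S.image p) (hw : w ∈ S.image p) (xy : R.Adj x y) (xz : R.Adj x z) (xw : R.Adj x w)
    (yz : R.Adj y z) (yw : R.Adj y w) (zw : R.Adj z w) : (UU S p {x}).card ≤ 1 := by
  by_contra hc
  push Not at hc
  have := (jn4b UU_sub UU_sub (c.jnR (Q := S.image p)) hR hc).mono (c.sub_UU nb_sub)
  exact this y (mem_nb.2 ⟨hy, xy⟩) z (mem_nb.2 ⟨hz, xz⟩) w (mem_nb.2 ⟨hw, xw⟩) yz yw zw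

/-- mono K4 among E ⊆ T: four distinct singles -/
theorem k4set (hR : Fr 4 R S) {E : Finset V} (hE : E ⊆ S.image p) (h : ¬ K4F R E) :
    ∃ F ⊆ E, F.card = 4 ∧ (∀ x ∈ F, (UU S p {x}).card ≤ 1) ∧ ∀ x ∈ F, ∀ y ∈ F, x ≠ y → R.Adj x y := by
  simp only [K4F] at h
  push Not at h
  obtain ⟨x, hx, y, hy, z, hz, w, hw, xy, xz, xw, yz, yw, zw, -⟩ := h
  refine ⟨{x, y, z, w}, ?_, ?_, ?_, ?_⟩
  · intro t ht
    simp only [Finset.mem_insert, Finset.mem_singleton] at ht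
    rcases ht with rfl | rfl | rfl | rfl <;> assumption
  · rw [Finset.card_insert_of_notMem, Finset.card_insert_of_notMem, Finset.card_insert_of_notMem,
      Finset.card_singleton]
    · simpa using zw.ne
    · simpa using ⟨yz.ne, yw.ne⟩
    · simpa using ⟨xy.ne, xz.ne, xw.ne⟩
  · have hx := hE hx
    have hy := hE hy
    have hz := hE hz
    have hw := hE hw
    intro t ht
    simp only [Finset.mem_insert, Finset.mem_singleton] at ht
    rcases ht with rfl | rfl | rfl | rfl
    · exact c.k4s hR hx hy hz hw xy xz xw yz yw zw
    · exact c.k4s hR hy hx hz hw xy.symm yz yw xz xw zw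
    · exact c.k4s hR hz hx hy hw xz.symm yz.symm zw xy xw yw
    · exact c.k4s hR hw hx hy hz xw.symm yw.symm zw.symm xy xz yz
  · intro t ht s hs hn
    simp only [Finset.mem_insert, Finset.mem_singleton] at ht hs
    have := xy.symm
    have := xz.symm
    have := xw.symm
    have := yz.symm
    have := yw.symm
    have := zw.symm
    rcases ht with rfl | rfl | rfl | rfl <;> rcases hs with rfl | rfl | rfl | rfl <;>
      first | assumption | exact absurd rfl hn

/-- any 18 reps contain a mono K4 of singles -/
theorem k18 (hR : Fr 4 R S) (hB : Fr 4 B S) {E : Finset V} (hE : E ⊆ S.image p) (h : 18 ≤ E.card) :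
    ∃ F ⊆ E, F.card = 4 ∧ (∀ x ∈ F, (UU S p {x}).card ≤ 1) ∧
      ((∀ x ∈ F, ∀ y ∈ F, x ≠ y → R.Adj x y) ∨ (∀ x ∈ F, ∀ y ∈ F, x ≠ y → ¬ R.Adj x y)) := by
  by_cases h1 : K4F R E
  · have h2 : ¬ K4F Rᶜ E := fun h2 => by
      have := k44 (cov_compl R E) h1 h2
      omega
    have h3 : ∃ x ∈ E, ∃ y ∈ E, ∃ z ∈ E, ∃ w ∈ E, Rᶜ.Adj x y ∧ Rᶜ.Adj x z ∧ Rᶜ.Adj x w ∧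
      Rᶜ.Adj y z ∧ Rᶜ.Adj y w ∧ Rᶜ.Adj z w := by
      simp only [K4F] at h2
      push Not at h2
      obtain ⟨x, hx, y, hy, z, hz, w, hw, xy, xz, xw, yz, yw, zw, -⟩ := h2
      exact ⟨x, hx, y, hy, z, hz, w, hw, xy, xz, xw, yz, yw, zw⟩
    obtain ⟨x, hx, y, hy, z, hz, w, hw, xy, xz, xw, yz, yw, zw⟩ := h3
    have hE4 : ({x, y, z, w} : Finset V) ⊆ E := by
      intro t ht
      simp only [Finset.mem_insert, Finset.mem_singleton] at ht
      rcases ht with rfl | rfl | rfl | rfl <;> assumption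
    have cb : ∀ u ∈ E, ∀ v ∈ E, Rᶜ.Adj u v → B.Adj u v := fun u hu v hv e => by
      rw [SimpleGraph.compl_adj] at e
      exact (c.cov u (hE hu) v (hE hv) e.1).resolve_left e.2
    obtain ⟨F, hF, hF4, hFs, hFB⟩ := c.symm.k4set hB (hE4.trans hE) (fun hk =>
      hk x (by simp) y (by simp) z (by simp) w (by simp) (cb _ hx _ hy xy) (cb _ hx _ hz xz)
        (cb _ hx _ hw xw) (cb _ hy _ hz yz) (cb _ hy _ hw yw) (cb _ hz _ hw zw))
    refine ⟨F, hF.trans hE4, hF4, hFs, Or.inr ?_⟩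
    intro u hu v hv hn
    have hu := hF hu
    have hv := hF hv
    simp only [Finset.mem_insert, Finset.mem_singleton] at hu hv
    rw [SimpleGraph.compl_adj] at xy xz xw yz yw zw
    have c1 := fun h : R.Adj y x => xy.2 h.symm
    have c2 := fun h : R.Adj z x => xz.2 h.symm
    have c3 := fun h : R.Adj w x => xw.2 h.symm
    have c4 := fun h : R.Adj z y => yz.2 h.symm
    have c5 := fun h : R.Adj w y => yw.2 h.symm
    have c6 := fun h : R.Adj w z => zw.2 h.symm
    rcases hu with rfl | rfl | rfl | rfl <;> rcases hv with rfl | rfl | rfl | rfl <;>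
      first | exact absurd rfl hn | tauto
  · obtain ⟨F, hF, hF4, hFs, hFB⟩ := c.k4set hR hE h1
    exact ⟨F, hF, hF4, hFs, Or.inl hFB⟩

theorem case44b (hR : Fr 4 R S) (hB : Fr 4 B S)
    (h0 : ∀ a ∈ S.image p, Fr 0 R (UU S p {a}) ∧ Fr 0 B (UU S p {a})) (hu : 2 ≤ gg β W 0 0) :
    (S.card : ℝ) ≤ 17 * gg β W 0 0 := by
  have hT := f44 c.cov (hR.mono c.T_sub) (hB.mono c.T_sub)
  by_cases h17 : (S.image p).card ≤ 17
  · have := c.reps (Finset.Subset.refl _) h0 17 h17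
    rw [c.UU_T] at this
    exact_mod_cast this
  push Not at h17
  set T := S.image p with hTd
  set Bg := T.filter (fun a => 1 < (UU S p {a}).card) with hBg
  set Sg := T.filter (fun a => ¬ 1 < (UU S p {a}).card) with hSg
  have hcard : Bg.card + Sg.card = T.card := Finset.card_filter_add_card_filter_not _
  have hBT : Bg ⊆ T := Finset.filter_subset _ _
  have hST : Sg ⊆ T := Finset.filter_subset _ _
  have hdis : Disjoint Bg Sg := Finset.disjoint_filter_filter_not _ _ _
  have hsum : (S.card : ℝ) ≤ Bg.card * gg β W 0 0 + Sg.card := by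
    have e1 := c.reps hBT h0 Bg.card le_rfl
    have e2 := card_UU_single (S := S) (p := p) Sg (fun a ha => by
      have := (Finset.mem_filter.1 ha).2; omega)
    have e3 : S ⊆ UU S p Bg ∪ UU S p Sg := by
      intro x hx
      have hpx : p x ∈ T := Finset.mem_image_of_mem _ hx
      rw [Finset.mem_union, mem_UU, mem_UU, hBg, hSg, Finset.mem_filter, Finset.mem_filter]
      tauto
    have e4 := (Finset.card_le_card e3).trans (Finset.card_union_le _ _)
    have e5 : (S.card : ℝ) ≤ (UU S p Bg).card + (UU S p Sg).card := by exact_mod_cast e4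
    have e6 : ((UU S p Sg).card : ℝ) ≤ Sg.card := by exact_mod_cast e2
    linarith
  -- any set Bg ∪ X with X ⊆ Sg with ≥ 18 elements contains mono K4 inside X
  have key : ∀ X ⊆ Sg, 18 ≤ Bg.card + X.card → ∃ F ⊆ X, F.card = 4 ∧
      ((∀ x ∈ F, ∀ y ∈ F, x ≠ y → R.Adj x y) ∨ (∀ x ∈ F, ∀ y ∈ F, x ≠ y → ¬ R.Adj x y)) := by
    intro X hX hc
    obtain ⟨F, hF, hF4, hFs, hFF⟩ := c.k18 hR hB (E := Bg ∪ X)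
      (Finset.union_subset hBT (hX.trans hST))
      (by rw [Finset.card_union_of_disjoint (hdis.mono_right hX)]; exact hc)
    refine ⟨F, fun x hx => ?_, hF4, hFF⟩
    rcases Finset.mem_union.1 (hF hx) with h | h
    · have h1 := (Finset.mem_filter.1 h).2
      have h2 := hFs x hx
      omega
    · exact h
  have hm : Bg.card ≤ 14 := by
    by_contra hm
    obtain ⟨X, hX, hXc⟩ := Finset.exists_subset_card_eq (Nat.min_le_right 3 Sg.card)
    obtain ⟨F, hF, hF4, -⟩ := key X hX (by omega)
    have := Finset.card_le_card hF
    omega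
  have hcase : Bg.card ≤ 13 ∨ (Bg.card = 14 ∧ Sg.card ≤ 6) := by
    by_contra hcon
    have h14 : Bg.card = 14 := by omega
    have hs5 : 5 ≤ Sg.card := by omega
    obtain ⟨X, hX, hX5⟩ := Finset.exists_subset_card_eq hs5
    have k4 : ∀ F ⊆ X, F.card = 4 →
      ((∀ x ∈ F, ∀ y ∈ F, x ≠ y → R.Adj x y) ∨ (∀ x ∈ F, ∀ y ∈ F, x ≠ y → ¬ R.Adj x y)) := by
      intro F hF hF4
      obtain ⟨F', hF', hF4', h⟩ := key F (hF.trans hX) (by omega)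
      rwa [Finset.eq_of_subset_of_card_le hF' (by omega)] at h
    obtain ⟨a, ha⟩ : X.Nonempty := Finset.card_pos.1 (by omega)
    -- all edges in X have the same colour
    have hall : (∀ x ∈ X, ∀ y ∈ X, x ≠ y → R.Adj x y) ∨ (∀ x ∈ X, ∀ y ∈ X, x ≠ y → ¬ R.Adj x y) := by
      have hF0 := k4 (X.erase a) (Finset.erase_subset _ _) (by rw [Finset.card_erase_of_mem ha]; omega)
      have hX4 : (X.erase a).card = 4 := by rw [Finset.card_erase_of_mem ha]; omega
      -- for x y in X, pick u v in X.erase a distinct, avoiding ...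
      have main : ∀ x ∈ X, ∀ y ∈ X, x ≠ y → ∃ u ∈ X.erase a, ∃ v ∈ X.erase a, u ≠ v ∧
          (R.Adj x y ↔ R.Adj u v) := by
        intro x hx y hy hn
        have : 1 < ((X.erase a) \ {x, y}).card := by
          have h1 := Finset.le_card_sdiff {x, y} (X.erase a)
          have h2 : ({x, y} : Finset V).card ≤ 2 := Finset.card_le_two
          omega
        obtain ⟨u, hu, v, hv, huv⟩ := Finset.one_lt_card.1 this
        simp only [Finset.mem_sdiff, Finset.mem_insert, Finset.mem_singleton, not_or] at hu hv
        refine ⟨u, hu.1, v, hv.1, huv, ?_⟩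
        have hF4 : ({x, y, u, v} : Finset V).card = 4 := by
          rw [Finset.card_insert_of_notMem, Finset.card_insert_of_notMem,
            Finset.card_insert_of_notMem, Finset.card_singleton]
          · simpa using huv
          · simpa using ⟨Ne.symm hu.2.2, Ne.symm hv.2.2⟩
          · simpa using ⟨hn, Ne.symm hu.2.1, Ne.symm hv.2.1⟩
        have hFX : ({x, y, u, v} : Finset V) ⊆ X := by
          intro t ht
          simp only [Finset.mem_insert, Finset.mem_singleton] at ht
          rcases ht with rfl | rfl | rfl | rfl
          · exact hx
          · exact hy
          · exact Finset.mem_of_mem_erase hu.1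
          · exact Finset.mem_of_mem_erase hv.1
        rcases k4 _ hFX hF4 with h | h
        · exact iff_of_true (h x (by simp) y (by simp) hn) (h u (by simp) v (by simp) huv)
        · exact iff_of_false (h x (by simp) y (by simp) hn) (h u (by simp) v (by simp) huv)
      rcases hF0 with h | h
      · left
        intro x hx y hy hn
        obtain ⟨u, hu, v, hv, huv, e⟩ := main x hx y hy hn
        exact e.2 (h u hu v hv huv)
      · right
        intro x hx y hy hn
        obtain ⟨u, hu, v, hv, huv, e⟩ := main x hx y hy hn
        exact fun e' => h u hu v hv huv (e.1 e')
    have hXT : X ⊆ T := hX.trans hST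
    rcases hall with h | h
    · have := f04 (R := (⊥ : SimpleGraph V)) (B := R) (S := X) (fun x hx y hy n => Or.inr (h x hx y hy n))
        (fun x _ y _ e => by simp at e) (hR.mono (hXT.trans c.T_sub))
      omega
    · have := f04 (R := (⊥ : SimpleGraph V)) (B := B) (S := X) (fun x hx y hy n => Or.inr
          ((c.cov x (hXT hx) y (hXT hy) n).resolve_left (h x hx y hy n)))
        (fun x _ y _ e => by simp at e) (hB.mono (hXT.trans c.T_sub))
      omega
  rcases hcase with h | ⟨h14, h6⟩
  · have h1 : (Bg.card : ℝ) ≤ 13 := by exact_mod_cast h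
    have h2 : (Bg.card : ℝ) + Sg.card ≤ 21 := by exact_mod_cast hcard.le.trans hT
    nlinarith
  · rw [h14] at hsum
    have h1 : (Sg.card : ℝ) ≤ 6 := by exact_mod_cast h6
    push_cast at hsum
    linarith

theorem case44 (hR : Fr 4 R S) (hB : Fr 4 B S) : (S.card : ℝ) ≤ gg β W 4 4 := by
  by_cases h : ∃ a ∈ S.image p, ¬ (Fr 0 R (UU S p {a}) ∧ Fr 0 B (UU S p {a}))
  · obtain ⟨a, ha, h⟩ := h
    exact c.case44a hR hB ha h
  have h0 : ∀ a ∈ S.image p, (Fr 0 R (UU S p {a}) ∧ Fr 0 B (UU S p {a})) := fun a ha => by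
    by_contra hh
    exact h ⟨a, ha, hh⟩
  rcases c.big_or with hb | ⟨a, ha, hb⟩
  · have h1 := f44 c.cov (hR.mono c.T_sub) (hB.mono c.T_sub)
    have : (S.card : ℝ) ≤ 21 := by exact_mod_cast hb.trans h1
    linarith [(n_single c.nm).2.2.2.2.2.2.2.2.2.1]
  · exact (c.case44b hR hB h0 (c.u2 ha (h0 a ha).1 (h0 a ha).2 hb)).trans
      (n_3 c.nm).2.2.2.2.2.2.2.2.2.2

theorem two_le (hne : S.Nonempty) {x y : ℕ} (hxy : x ≤ y) (hy : y ≤ 4) (hR : Fr x R S)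
    (hB : Fr y B S) : (S.card : ℝ) ≤ gg β W x y := by
  have hx : x ≤ 4 := hxy.trans hy
  interval_cases x
  · exact (c.no0 hne hR).elim
  · exact c.case1 (by omega) hy hR hB
  · interval_cases y
    · exact c.case22 hR hB
    · exact c.case23 hR hB
    · exact c.case24 hR hB
  · interval_cases y
    · exact c.case33 hR hB
    · exact c.case34 hR hB
  · interval_cases y
    exact c.case44 hR hB

theorem two (hne : S.Nonempty) {x y : ℕ} (hx : x ≤ 4) (hy : y ≤ 4) (hR : Fr x R S)
    (hB : Fr y B S) : (S.card : ℝ) ≤ gg β W x y := by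
  rcases le_total x y with h | h
  · exact c.two_le hne h hy hR hB
  · rw [gg_comm]
    exact c.symm.two_le hne h hx hB hR

end Ctx
end GRP

set_option linter.all false

namespace GRP
open scoped Classical
variable {V : Type*} {K : Type*}

theorem one_col {β W : ℝ} (nm : Nm β W) {G : SimpleGraph V} {S A B : Finset V} (hA : A ⊂ S)
    (hB : B ⊂ S) (hAn : A.Nonempty) (hBn : B.Nonempty) (hS : S.card ≤ A.card + B.card)
    (j : Jn G A B) {x : ℕ} (hx : x ≤ 4) (h : Fr x G S)
    (IH : ∀ Q, Q ⊂ S → ∀ x' ≤ 4, Fr x' G Q → (Q.card : ℝ) ≤ gg β W x' 0) :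
    (S.card : ℝ) ≤ gg β W x 0 := by
  obtain ⟨n1, n2, n3, n4, n5, n6, n7⟩ := n_one nm
  have hS' : (S.card : ℝ) ≤ A.card + B.card := by exact_mod_cast hS
  have hA' := hA.subset
  have hB' := hB.subset
  have sing : ∀ {P : Finset V}, ¬ 1 < P.card → (P.card : ℝ) ≤ 1 := fun hc => by
    push Not at hc; exact_mod_cast hc
  interval_cases x
  · have := jn0 hA' hB' j h hAn
    rw [this] at hBn; simp at hBn
  · have e1 := jn1 hA' hB' j h hAn
    have e2 := jn1 hB' hA' j.symm h hBn
    have : (S.card : ℝ) ≤ 2 := by exact_mod_cast (by omega : S.card ≤ 2)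
    linarith
  · have e1 := IH B hB 0 (by norm_num) (jn2 hA' hB' j h hAn)
    have e2 := IH A hA 0 (by norm_num) (jn2 hB' hA' j.symm h hBn)
    linarith
  · by_cases ha : 1 < A.card
    · have e1 := IH B hB 0 (by norm_num) (jn3b hA' hB' j h ha)
      by_cases hb : 1 < B.card
      · have e2 := IH A hA 0 (by norm_num) (jn3b hB' hA' j.symm h hb)
        linarith
      · have e2 := IH A hA 1 (by norm_num) (jn3 hB' hA' j.symm h hBn)
        have := sing hb
        linarith
    · have e1 := IH B hB 1 (by norm_num) (jn3 hA' hB' j h hAn)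
      have := sing ha
      linarith
  · by_cases ha : 1 < A.card
    · by_cases hb : 1 < B.card
      · have b2 := jn4b hA' hB' j h ha
        have a2 := jn4b hB' hA' j.symm h hb
        by_cases ha0 : Fr 0 G A
        · have e1 := IH A hA 0 (by norm_num) ha0
          have e2 := IH B hB 2 (by norm_num) b2
          linarith
        by_cases hb0 : Fr 0 G B
        · have e1 := IH B hB 0 (by norm_num) hb0
          have e2 := IH A hA 2 (by norm_num) a2
          linarith
        have e1 := IH B hB 1 (by norm_num) (jn4c hA' hB' j h ha0)
        have e2 := IH A hA 1 (by norm_num) (jn4c hB' hA' j.symm h hb0)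
        linarith
      · have e2 := IH A hA 3 (by norm_num) (jn4 hB' hA' j.symm h hBn)
        have := sing hb
        linarith
    · have e1 := IH B hB 3 (by norm_num) (jn4 hA' hB' j h hAn)
      have := sing ha
      linarith

/-- graph of colour d -/
def cgd (c : V → V → K) (hs : ∀ x y, c x y = c y x) (d : K) : SimpleGraph V where
  Adj x y := x ≠ y ∧ c x y = d
  symm := ⟨fun x y h => ⟨h.1.symm, (hs y x).trans h.2⟩⟩
  loopless := ⟨fun x h => h.1 rfl⟩

noncomputable def bf (s : Finset K) (t : K → ℕ) : ℝ := s.fold max 1 (fun i => bt (t i))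
noncomputable def wf (s : Finset K) (t : K → ℕ) : ℝ := ∏ i ∈ s, wt (t i)

theorem bt_vals (n : ℕ) : bt n = 1 ∨ bt n = 21/17 ∨ bt n = 9/5 ∨ bt n = 2 := by
  match n with
  | 0 => simp [bt]
  | 1 => simp [bt]
  | 2 => simp [bt]
  | 3 => simp [bt]
  | (n+4) => simp [bt]
theorem wt_one (n : ℕ) : 1 ≤ wt n := by
  have h5 := sq5.1
  have h17 := sq17.1
  match n with
  | 0 => simp [wt]
  | 1 => simp [wt]
  | 2 => simp only [wt]; linarith
  | 3 => simp only [wt]; linarith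
  | (n+4) => simp only [wt]; linarith

theorem nm_bw (s : Finset K) (t : K → ℕ) : Nm (bf s t) (wf s t) := by
  constructor
  · unfold bf
    induction s using Finset.induction_on with
    | empty => simp
    | insert a s ha ih =>
      rw [Finset.fold_insert ha]
      rcases max_choice (bt (t a)) (Finset.fold max 1 (fun i => bt (t i)) s) with h | h
      · rw [h]; exact bt_vals _
      · rw [h]; exact ih
  · unfold wf
    induction s using Finset.induction_on with
    | empty => simp
    | insert a s ha ih =>
      rw [Finset.prod_insert ha]
      exact one_le_mul_of_one_le_of_one_le (wt_one _) ih

theorem bf_one (s : Finset K) (t : K → ℕ) : 1 ≤ bf s t := by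
  rcases (nm_bw s t).hβ with h | h | h | h <;> rw [h] <;> norm_num

theorem bf_congr {s : Finset K} {t t' : K → ℕ} (h : ∀ i ∈ s, t i = t' i) : bf s t = bf s t' :=
  Finset.fold_congr fun i hi => by rw [h i hi]
theorem wf_congr {s : Finset K} {t t' : K → ℕ} (h : ∀ i ∈ s, t i = t' i) : wf s t = wf s t' :=
  Finset.prod_congr rfl fun i hi => by rw [h i hi]

variable [Fintype K]
noncomputable def Phi (t : K → ℕ) : ℝ := bf Finset.univ t * wf Finset.univ t

theorem phi1 (t : K → ℕ) (r : K) : Phi t = gg (bf (Finset.univ.erase r) t)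
    (wf (Finset.univ.erase r) t) (t r) 0 := by
  have h1 : bf Finset.univ t = max (bt (t r)) (bf (Finset.univ.erase r) t) := by
    conv_lhs => rw [← Finset.insert_erase (Finset.mem_univ r)]
    unfold bf
    rw [Finset.fold_insert (Finset.notMem_erase _ _)]
  have h2 : wf Finset.univ t = wt (t r) * (wf (Finset.univ.erase r) t) :=
    (Finset.mul_prod_erase _ _ (Finset.mem_univ r)).symm
  have h3 := bf_one (Finset.univ.erase r) t
  unfold Phi gg
  have e1 : bt 0 = 1 := rfl
  have e2 : wt 0 = 1 := rfl
  rw [h1, h2, e1, e2, max_eq_right h3]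
  ring

theorem phi2 (t : K → ℕ) (r b : K) (hrb : r ≠ b) : Phi t =
    gg (bf ((Finset.univ.erase r).erase b) t) (wf ((Finset.univ.erase r).erase b) t) (t r) (t b) := by
  have hb : b ∈ Finset.univ.erase r := by simp [hrb.symm]
  have h1 : bf (Finset.univ.erase r) t = max (bt (t b)) (bf ((Finset.univ.erase r).erase b) t) := by
    conv_lhs => rw [← Finset.insert_erase hb]
    unfold bf
    rw [Finset.fold_insert (Finset.notMem_erase _ _)]
  have h2 : wf (Finset.univ.erase r) t = wt (t b) * (wf ((Finset.univ.erase r).erase b) t) :=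
    (Finset.mul_prod_erase _ _ hb).symm
  rw [phi1 t r]
  have h3 := bf_one (Finset.univ.erase r) t
  unfold gg
  have e1 : bt 0 = 1 := rfl
  have e2 : wt 0 = 1 := rfl
  rw [e1, e2, max_eq_right h3, h1, h2]
  ring

theorem phi_one (t : K → ℕ) : 1 ≤ Phi t :=
  one_le_mul_of_one_le_of_one_le (bf_one _ _) (nm_bw _ _).hW

theorem main_bound (c : V → V → K) (hs : ∀ x y, c x y = c y x) (hg : Gal c) :
    ∀ n : ℕ, ∀ S : Finset V, S.card = n → ∀ t : K → ℕ, (∀ i, t i ≤ 4) →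
      (∀ i, Fr (t i) (cgd c hs i) S) → (S.card : ℝ) ≤ Phi t := by
  intro n
  induction n using Nat.strong_induction_on with
  | _ n ih =>
  intro S hSn t ht hF
  by_cases h2 : 2 ≤ S.card
  swap
  · have : (S.card : ℝ) ≤ 1 := by exact_mod_cast (by omega : S.card ≤ 1)
    exact this.trans (phi_one t)
  have ih' : ∀ Q, Q ⊂ S → ∀ t : K → ℕ, (∀ i, t i ≤ 4) →
      (∀ i, Fr (t i) (cgd c hs i) Q) → (Q.card : ℝ) ≤ Phi t := fun Q hQ t =>
    ih Q.card (by rw [← hSn]; exact Finset.card_lt_card hQ) Q rfl t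
  obtain ⟨p, hp, r, b, hrb⟩ := gallai_partition hs hg S h2
  have hT2 := hp.two
  have hTS : ∀ a ∈ S.image p, a ∈ S := by
    intro a ha
    obtain ⟨x, hx, rfl⟩ := Finset.mem_image.1 ha
    exact hp.mem x hx
  have hpT : ∀ a ∈ S.image p, p a = a := by
    intro a ha
    obtain ⟨x, hx, rfl⟩ := Finset.mem_image.1 ha
    exact hp.idem x hx
  by_cases hone : ∃ d, ∃ a ∈ S.image p, ∀ a' ∈ S.image p, a' ≠ a → c a a' = d
  · obtain ⟨d, a, ha, hd⟩ := hone
    obtain ⟨a', ha', hne⟩ := Finset.exists_mem_ne (by omega : 1 < (S.image p).card) a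
    rw [phi1 t d]
    have hcd : ((S.filter (fun x => p x = a)).card + (S.filter (fun x => ¬ p x = a)).card) = S.card :=
      Finset.card_filter_add_card_filter_not _
    have hAn : a ∈ S.filter (fun x => p x = a) := by simp [hTS a ha, hpT a ha]
    have hBn : a' ∈ S.filter (fun x => ¬ p x = a) := by simp [hTS a' ha', hpT a' ha', hne]
    refine one_col (nm_bw _ _) (G := cgd c hs d) (A := S.filter (fun x => p x = a))
      (B := S.filter (fun x => ¬ p x = a)) ?_ ?_ ⟨a, hAn⟩ ⟨a', hBn⟩ hcd.ge ?_ (ht d) (hF d) ?_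
    · rw [Finset.ssubset_iff_of_subset (Finset.filter_subset _ _)]
      exact ⟨a', hTS a' ha', by simp [hpT a' ha', hne]⟩
    · rw [Finset.ssubset_iff_of_subset (Finset.filter_subset _ _)]
      exact ⟨a, hTS a ha, by simp [hpT a ha]⟩
    · intro x hx y hy
      rw [Finset.mem_filter] at hx hy
      have hxy : p x ≠ p y := by rw [hx.2]; exact fun h => hy.2 h.symm
      refine ⟨fun h => hxy (by rw [h]), ?_⟩
      rw [hp.hom x hx.1 y hy.1 hxy, hx.2]
      exact hd _ (Finset.mem_image_of_mem _ hy.1) hy.2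
    · intro Q hQ x' hx' hFx
      have := ih' Q hQ (Function.update t d x') (fun i => by
        by_cases h : i = d
        · subst h; simpa using hx'
        · simpa [Function.update_of_ne h] using ht i) (fun i => by
        by_cases h : i = d
        · subst h; simpa using hFx
        · simpa [Function.update_of_ne h] using (hF i).mono hQ.subset)
      rw [phi1 _ d, Function.update_self] at this
      have e : ∀ i ∈ Finset.univ.erase d, Function.update t d x' i = t i := fun i hi =>
        Function.update_of_ne (Finset.ne_of_mem_erase hi) _ _
      rwa [bf_congr e, wf_congr e] at this
  · push Not at hone
    obtain ⟨a0, ha0⟩ : (S.image p).Nonempty := Finset.card_pos.1 (by omega)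
    have hne : r ≠ b := by
      rintro rfl
      obtain ⟨a', ha', hn, hc⟩ := hone r a0 ha0
      rcases hrb a0 ha0 a' ha' hn.symm with h | h <;> exact hc h
    rw [phi2 t r b hne]
    have ctx : Ctx (cgd c hs r) (cgd c hs b) S p (bf ((Finset.univ.erase r).erase b) t)
        (wf ((Finset.univ.erase r).erase b) t) := by
      refine ⟨nm_bw _ _, hp.mem, hp.idem, ?_, ?_, ?_, ?_, ?_, ?_⟩
      · intro x hx y hy hn h
        exact ⟨fun e => hn (by rw [e]), (hp.hom x hx y hy hn).trans h.2⟩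
      · intro x hx y hy hn h
        exact ⟨fun e => hn (by rw [e]), (hp.hom x hx y hy hn).trans h.2⟩
      · intro x hx y hy hn
        rcases hrb x hx y hy hn with h | h
        · exact Or.inl ⟨hn, h⟩
        · exact Or.inr ⟨hn, h⟩
      · intro a ha
        obtain ⟨a', ha', hn, hc⟩ := hone b a ha
        exact ⟨a', ha', hn.symm, (hrb a ha a' ha' hn.symm).resolve_right hc⟩
      · intro a ha
        obtain ⟨a', ha', hn, hc⟩ := hone r a ha
        exact ⟨a', ha', hn.symm, (hrb a ha a' ha' hn.symm).resolve_left hc⟩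
      · intro Q hQ x y hx hy hFx hFy
        have := ih' Q hQ (Function.update (Function.update t r x) b y) (fun i => by
          by_cases h : i = b
          · subst h; simpa using hy
          · rw [Function.update_of_ne h]
            by_cases h : i = r
            · subst h; simpa using hx
            · rw [Function.update_of_ne h]; exact ht i) (fun i => by
          by_cases h : i = b
          · subst h; simpa using hFy
          · rw [Function.update_of_ne h]
            by_cases h : i = r
            · subst h; simpa using hFx
            · rw [Function.update_of_ne h]; exact (hF i).mono hQ.subset)
        have e : ∀ i ∈ (Finset.univ.erase r).erase b,
            Function.update (Function.update t r x) b y i = t i := fun i hi => by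
          rw [Finset.mem_erase, Finset.mem_erase] at hi
          rw [Function.update_of_ne hi.1, Function.update_of_ne hi.2.1]
        rw [phi2 _ r b hne, bf_congr e, wf_congr e, Function.update_self,
          Function.update_of_ne hne, Function.update_self] at this
        exact this
    exact ctx.two (Finset.card_pos.1 (by omega)) (ht r) (ht b) (hF r) (hF b)
end GRP

set_option linter.all false

namespace GRP
open scoped Classical

def rows21 : List ℕ := [952114, 887397, 757994, 500180, 1000329, 161351, 289966, 548188, 48793,
  96563, 1847777, 1631170, 1165220, 1249128, 1448688, 1448207, 1847838, 1630269, 1164379, 1248407,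
  1047552]
def A21 (x y : Fin 21) : Bool := (rows21.getD x.1 0).testBit y.1
def A17 (x y : Fin 17) : Bool := Nat.testBit 107286 ((x.1 + 17 - y.1) % 17)
def A5 (x y : Fin 5) : Bool := Nat.testBit 18 ((x.1 + 5 - y.1) % 5)

theorem A21s : ∀ x y, A21 x y = A21 y x := by decide +kernel
theorem A17s : ∀ x y, A17 x y = A17 y x := by decide +kernel
theorem A5s : ∀ x y, A5 x y = A5 y x := by decide +kernel

theorem A21a : ∀ x y, A21 x y = true → ∀ z, A21 x z = true → A21 y z = true →
    ∀ p, A21 x p = true → A21 y p = true → A21 z p = true →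
    ∀ q, A21 x q = true → A21 y q = true → A21 z q = true → p = q := by decide +kernel
theorem A21b : ∀ x y, x ≠ y → A21 x y = false → ∀ z, x ≠ z → A21 x z = false →
    y ≠ z → A21 y z = false →
    ∀ p, x ≠ p → A21 x p = false → y ≠ p → A21 y p = false → z ≠ p → A21 z p = false →
    ∀ q, x ≠ q → A21 x q = false → y ≠ q → A21 y q = false → z ≠ q → A21 z q = false → p = q := by
  decide +kernel
theorem A17a : ∀ x y, A17 x y = true → ∀ z, A17 x z = true → A17 y z = true →
    ∀ p, A17 x p = true → A17 y p = true → A17 z p = true → False := by decide +kernel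
theorem A17b : ∀ x y, x ≠ y → A17 x y = false → ∀ z, x ≠ z → A17 x z = false →
    y ≠ z → A17 y z = false →
    ∀ p, x ≠ p → A17 x p = false → y ≠ p → A17 y p = false → z ≠ p → A17 z p = false → False := by
  decide +kernel
theorem A5a : ∀ x y, A5 x y = true → ∀ z, A5 x z = true → A5 y z = true → False := by decide +kernel
theorem A5b : ∀ x y, x ≠ y → A5 x y = false → ∀ z, x ≠ z → A5 x z = false →
    y ≠ z → A5 y z = false → False := by
  decide +kernel

def LB (N k : ℕ) (t : ℕ → ℕ) : Prop := ∃ (V : Type) (_ : Fintype V), Fintype.card V = N ∧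
  ∃ (c : V → V → ℕ) (hs : ∀ x y, c x y = c y x), Gal c ∧ (∀ x y, x ≠ y → c x y < k) ∧
    ∀ i < k, Fr (t i) (cgd c hs i) Finset.univ

theorem LB_zero (t : ℕ → ℕ) : LB 1 0 t :=
  ⟨Unit, inferInstance, rfl, fun _ _ => 0, fun _ _ => rfl, fun _ _ _ h => absurd rfl h,
    fun _ _ h => absurd rfl h, by simp⟩

theorem LB_21 (t : ℕ → ℕ) (h0 : t 0 = 4) (h1 : t 1 = 4) : LB 21 2 t := by
  refine ⟨Fin 21, inferInstance, by simp, fun x y => if A21 x y then 0 else 1,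
    fun x y => by simp only [A21s x y], ?_, ?_, ?_⟩
  · intro u v w _ _ _
    dsimp only
    split_ifs <;> simp
  · intro x y _
    dsimp only
    split_ifs <;> simp
  · intro i hi
    have key0 : ∀ x y, (cgd (fun x y => if A21 x y then 0 else 1)
        (fun x y => by simp only [A21s x y]) 0).Adj x y → A21 x y = true := by
      intro x y h
      have := h.2
      simpa using this
    have key1 : ∀ x y, (cgd (fun x y => if A21 x y then 0 else 1)
        (fun x y => by simp only [A21s x y]) 1).Adj x y → x ≠ y ∧ A21 x y = false := by
      intro x y h
      have := h.2
      refine ⟨h.1, by simpa using this⟩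
    interval_cases i
    · rw [h0]
      intro x _ y _ z _ p _ q _ n a b c d e f g h i
      exact n (A21a x y (key0 _ _ a) z (key0 _ _ b) (key0 _ _ c) p (key0 _ _ d) (key0 _ _ e)
        (key0 _ _ f) q (key0 _ _ g) (key0 _ _ h) (key0 _ _ i))
    · rw [h1]
      intro x _ y _ z _ p _ q _ n a b c d e f g h i
      exact n (A21b x y (key1 _ _ a).1 (key1 _ _ a).2 z (key1 _ _ b).1 (key1 _ _ b).2
        (key1 _ _ c).1 (key1 _ _ c).2 p (key1 _ _ d).1 (key1 _ _ d).2 (key1 _ _ e).1 (key1 _ _ e).2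
        (key1 _ _ f).1 (key1 _ _ f).2 q (key1 _ _ g).1 (key1 _ _ g).2 (key1 _ _ h).1 (key1 _ _ h).2
        (key1 _ _ i).1 (key1 _ _ i).2)

/-- graphs mapping into the outer graph (or its complement) are free -/
def Outer {m : ℕ} (O : Fin m → Fin m → Bool) (τ : ℕ) : Prop :=
  ∀ (V : Type) (G : SimpleGraph V) (S : Finset V) (f : V → Fin m),
      ((∀ x y, G.Adj x y → O (f x) (f y) = true) ∨
       (∀ x y, G.Adj x y → f x ≠ f y ∧ O (f x) (f y) = false)) → Fr τ G S

theorem out5 : Outer A5 2 := by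
  rintro V G S f (h | h) x _ y _ z _ a b c
  · exact A5a _ _ (h _ _ a) _ (h _ _ b) (h _ _ c)
  · exact A5b _ _ (h _ _ a).1 (h _ _ a).2 _ (h _ _ b).1 (h _ _ b).2 (h _ _ c).1 (h _ _ c).2

theorem out17 : Outer A17 4 := by
  rintro V G S f (h | h) x _ y _ z _ p _ q _ n a b c d e g _ _ _
  · exact A17a _ _ (h _ _ a) _ (h _ _ b) (h _ _ c) _ (h _ _ d) (h _ _ e) (h _ _ g)
  · exact A17b _ _ (h _ _ a).1 (h _ _ a).2 _ (h _ _ b).1 (h _ _ b).2 (h _ _ c).1 (h _ _ c).2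
      _ (h _ _ d).1 (h _ _ d).2 (h _ _ e).1 (h _ _ e).2 (h _ _ g).1 (h _ _ g).2

theorem LB_step {N k m : ℕ} {t : ℕ → ℕ} (h : LB N k t) (ht : ∀ i, t i = 2 ∨ t i = 4)
    (O : Fin m → Fin m → Bool) (hO : ∀ x y, O x y = O y x)
    (hk : Outer O (t k)) (hk1 : Outer O (t (k+1))) :
    LB (N * m) (k + 2) t := by
  obtain ⟨V, iV, hV, c, hs, hg, hc, hF⟩ := h
  let c' : V × Fin m → V × Fin m → ℕ := fun x y =>
    if x.2 = y.2 then c x.1 y.1 else if O x.2 y.2 then k else k + 1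
  have e1 : ∀ x y, x.2 = y.2 → c' x y = c x.1 y.1 := fun x y h => if_pos h
  have e2 : ∀ x y, x.2 ≠ y.2 → c' x y = if O x.2 y.2 then k else k + 1 := fun x y h => if_neg h
  have hs' : ∀ x y, c' x y = c' y x := by
    intro x y
    by_cases h : x.2 = y.2
    · rw [e1 _ _ h, e1 _ _ h.symm, hs]
    · rw [e2 _ _ h, e2 _ _ (Ne.symm h), hO]
  have hfst : ∀ {x y : V × Fin m}, x ≠ y → x.2 = y.2 → x.1 ≠ y.1 := fun hn h1 h2 =>
    hn (Prod.ext h2 h1)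
  have hge : ∀ x y, x.2 ≠ y.2 → c' x y = k ∨ c' x y = k + 1 := by
    intro x y h
    rw [e2 _ _ h]
    split_ifs <;> simp
  have hin : ∀ i < k, ∀ x y, (cgd c' hs' i).Adj x y → x.2 = y.2 ∧ (cgd c hs i).Adj x.1 y.1 := by
    intro i hi x y h
    have h2 : c' x y = i := h.2
    have h3 : x.2 = y.2 := by
      by_contra hn
      rcases hge x y hn with h | h <;> omega
    rw [e1 _ _ h3] at h2
    exact ⟨h3, hfst h.1 h3, h2⟩
  have hout : ∀ i, k ≤ i → ∀ x y, (cgd c' hs' i).Adj x y → x.2 ≠ y.2 ∧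
      (if O x.2 y.2 then k else k + 1) = i := by
    intro i hi x y h
    have h2 : c' x y = i := h.2
    have h3 : x.2 ≠ y.2 := by
      intro hn
      rw [e1 _ _ hn] at h2
      have := hc _ _ (hfst h.1 hn)
      omega
    rw [e2 _ _ h3] at h2
    exact ⟨h3, h2⟩
  refine ⟨V × Fin m, inferInstance, by simp [hV], c', hs', ?_, ?_, ?_⟩
  · intro u v w uv uw vw
    by_cases h1 : u.2 = v.2
    · by_cases h2 : u.2 = w.2
      · rw [e1 _ _ h1, e1 _ _ h2, e1 _ _ (h1.symm.trans h2)]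
        exact hg _ _ _ (hfst uv h1) (hfst uw h2) (hfst vw (h1.symm.trans h2))
      · right; right
        rw [e2 _ _ h2, e2 _ _ (fun h => h2 (h1.trans h)), h1]
    · by_cases h2 : u.2 = w.2
      · right; left
        rw [e2 _ _ h1, hs' v w, e2 w v (fun h => h1 (h2.trans h)), h2]
      · by_cases h3 : v.2 = w.2
        · left
          rw [e2 _ _ h1, e2 _ _ h2, h3]
        · rcases hge u v h1 with a | a <;> rcases hge u w h2 with b | b <;>
            rcases hge v w h3 with d | d <;> rw [a, b, d] <;> simp
  · intro x y hn
    by_cases h : x.2 = y.2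
    · rw [e1 _ _ h]
      have := hc _ _ (hfst hn h)
      omega
    · rcases hge x y h with h | h <;> omega
  · intro i hi
    by_cases hik : i < k
    · have hFi := hF i hik
      rcases ht i with h2 | h4
      · rw [h2] at hFi ⊢
        intro x _ y _ z _ a b d
        exact hFi x.1 (Finset.mem_univ _) y.1 (Finset.mem_univ _) z.1 (Finset.mem_univ _)
          (hin i hik _ _ a).2 (hin i hik _ _ b).2 (hin i hik _ _ d).2
      · rw [h4] at hFi ⊢
        intro x _ y _ z _ p _ q _ n a b d e f g j l o
        refine hFi x.1 (Finset.mem_univ _) y.1 (Finset.mem_univ _) z.1 (Finset.mem_univ _)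
          p.1 (Finset.mem_univ _) q.1 (Finset.mem_univ _) (hfst n ?_)
          (hin i hik _ _ a).2 (hin i hik _ _ b).2 (hin i hik _ _ d).2 (hin i hik _ _ e).2
          (hin i hik _ _ f).2 (hin i hik _ _ g).2 (hin i hik _ _ j).2 (hin i hik _ _ l).2
          (hin i hik _ _ o).2
        rw [← (hin i hik _ _ e).1, ← (hin i hik _ _ j).1]
    · rcases (by omega : i = k ∨ i = k + 1) with rfl | rfl
      · refine hk _ _ _ Prod.snd (Or.inl fun x y h => ?_)
        have := (hout _ le_rfl x y h).2
        by_contra hf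
        rw [if_neg hf] at this
        omega
      · refine hk1 _ _ _ Prod.snd (Or.inr fun x y h => ?_)
        have h1 := hout _ (by omega) x y h
        refine ⟨h1.1, ?_⟩
        have := h1.2
        by_contra hf
        rw [if_pos (by simpa using hf)] at this
        omega

theorem LB_17 {N k : ℕ} {t : ℕ → ℕ} (h : LB N k t) (ht : ∀ i, t i = 2 ∨ t i = 4) (j : ℕ)
    (hj : ∀ i, k ≤ i → i < k + 2 * j → t i = 4) : LB (N * 17 ^ j) (k + 2 * j) t := by
  induction j with
  | zero => simpa using h
  | succ j ih =>
    have := LB_step (ih fun i h1 h2 => hj i h1 (by omega)) ht A17 A17s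
      (by rw [hj _ (by omega) (by omega)]; exact out17)
      (by rw [hj _ (by omega) (by omega)]; exact out17)
    rw [pow_succ, ← mul_assoc]
    exact this

theorem LB_5 {N k : ℕ} {t : ℕ → ℕ} (h : LB N k t) (ht : ∀ i, t i = 2 ∨ t i = 4) (j : ℕ)
    (hj : ∀ i, k ≤ i → i < k + 2 * j → t i = 2) : LB (N * 5 ^ j) (k + 2 * j) t := by
  induction j with
  | zero => simpa using h
  | succ j ih =>
    have := LB_step (ih fun i h1 h2 => hj i h1 (by omega)) ht A5 A5s
      (by rw [hj _ (by omega) (by omega)]; exact out5)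
      (by rw [hj _ (by omega) (by omega)]; exact out5)
    rw [pow_succ, ← mul_assoc]
    exact this
end GRP


set_option linter.all false
namespace GRP
open scoped Classical

def ty (r : ℕ) (i : ℕ) : ℕ := if i < r then 4 else 2
theorem ty_or (r i : ℕ) : ty r i = 2 ∨ ty r i = 4 := by unfold ty; split_ifs <;> simp

theorem bf_le {K : Type*} (s : Finset K) (t : K → ℕ) {b : ℝ} (hb : 1 ≤ b) (h : ∀ i ∈ s, bt (t i) ≤ b) :
    bf s t ≤ b := by
  unfold bf
  induction s using Finset.induction_on with
  | empty => simpa using hb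
  | insert a s ha ih =>
    rw [Finset.fold_insert ha]
    exact max_le (h a (by simp)) (ih fun i hi => h i (by simp [hi]))

theorem GH3_adj (a b : Fin 5) : GH3.Adj a b ↔ a ≠ b ∧ ¬ (a = 0 ∧ b = 1) ∧ ¬ (b = 0 ∧ a = 1) := by
  simp only [GH3, SimpleGraph.sdiff_adj, SimpleGraph.top_adj, SimpleGraph.fromRel_adj]
  tauto

theorem upper {k s r n : ℕ} (hsr : s + r = k) (c : Fin n → Fin n → Fin k) (hc : IsGallaiColoring c)
    (h : ¬ ∃ i : Fin k, HasMonoCopy (mixPKH k s r i).2 c i) :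
    (n : ℝ) ≤ Phi (fun i : Fin k => ty r i) := by
  obtain ⟨hs, hr⟩ := hc
  have hg : Gal c := by
    intro u v w uv uw vw
    by_contra hh
    push Not at hh
    exact hr ⟨u, v, w, uv, uw, vw, hh.1, hh.2.1, hh.2.2⟩
  push Not at h
  have := main_bound c hs hg n Finset.univ (by simp) (fun i : Fin k => ty r i)
    (fun i => by rcases ty_or r i with h | h <;> omega) (fun i => by
      have hi := h i
      by_cases hir : (i : ℕ) < r
      · have e : mixPKH k s r i = ⟨Fin 5, GH3⟩ := by simp [mixPKH, hir]
        rw [e] at hi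
        simp only [ty, hir, if_true]
        intro x _ y _ z _ p _ q _ n a b d e f g j l o
        refine hi ⟨![p, q, x, y, z], ?_, ?_⟩
        · intro u v huv
          have := a.1
          have := b.1
          have := d.1
          have := e.1
          have := f.1
          have := g.1
          have := j.1
          have := l.1
          have := o.1
          fin_cases u <;> fin_cases v <;> simp_all
        · intro u v huv
          have h1 := (GH3_adj u v).1 huv
          have a' := a.2
          have b' := b.2
          have d' := d.2
          have e' := e.2
          have f' := f.2
          have g' := g.2
          have j' := j.2
          have l' := l.2
          have o' := o.2
          have a'' := a.symm.2
          have b'' := b.symm.2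
          have d'' := d.symm.2
          have e'' := e.symm.2
          have f'' := f.symm.2
          have g'' := g.symm.2
          have j'' := j.symm.2
          have l'' := l.symm.2
          have o'' := o.symm.2
          fin_cases u <;> fin_cases v <;> first | assumption | (exfalso; revert h1; decide)
      · have hik : (i : ℕ) < r + s := by have := i.2; omega
        have e : mixPKH k s r i = ⟨Fin 3, GK3⟩ := by simp [mixPKH, hir, hik]
        rw [e] at hi
        simp only [ty, hir, if_false]
        intro x _ y _ z _ a b d
        refine hi ⟨![x, y, z], ?_, ?_⟩
        · intro u v huv
          have := a.1
          have := b.1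
          have := d.1
          fin_cases u <;> fin_cases v <;> simp_all
        · intro u v huv
          have h1 : u ≠ v := huv.ne
          have a' := a.2
          have b' := b.2
          have d' := d.2
          have a'' := a.symm.2
          have b'' := b.symm.2
          have d'' := d.symm.2
          fin_cases u <;> fin_cases v <;> first | assumption | (exfalso; revert h1; decide))
  simpa using this

theorem lower {k s r m N : ℕ} (hk : 1 ≤ k) (hsr : s + r = k) (h : LB N k (ty r)) (hm : m ≤ N) :
    ¬ ∀ c : Fin m → Fin m → Fin k, IsGallaiColoring c → ∃ i : Fin k, HasMonoCopy (mixPKH k s r i).2 c i := by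
  intro hall
  obtain ⟨V, iV, hV, c, hs, hg, hc, hF⟩ := h
  obtain ⟨φ⟩ : Nonempty (Fin m ↪ V) := by
    rw [Function.Embedding.nonempty_iff_card_le]
    simp [hV, hm]
  let c0 : Fin m → Fin m → Fin k := fun u v => if h : c (φ u) (φ v) < k then ⟨_, h⟩ else ⟨0, hk⟩
  have e : ∀ u v, u ≠ v → ((c0 u v : Fin k) : ℕ) = c (φ u) (φ v) := by
    intro u v huv
    have := hc (φ u) (φ v) (fun h => huv (φ.injective h))
    simp only [c0, this, dif_pos]
  obtain ⟨i, f, hf, hi⟩ := hall c0 ⟨fun u v => by simp only [c0, hs (φ u) (φ v)], by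
    rintro ⟨u, v, w, uv, uw, vw, h1, h2, h3⟩
    have n : ∀ {a b : Fin m}, a ≠ b → φ a ≠ φ b := fun h h' => h (φ.injective h')
    rcases hg (φ u) (φ v) (φ w) (n uv) (n uw) (n vw) with h | h | h
    · exact h1 (Fin.ext (by rw [e _ _ uv, e _ _ uw, h]))
    · exact h2 (Fin.ext (by rw [e _ _ uv, e _ _ vw, h]))
    · exact h3 (Fin.ext (by rw [e _ _ uw, e _ _ vw, h]))⟩
  have hFi := hF i i.2
  have adj : ∀ u v, u ≠ v → c0 u v = i → (cgd c hs i).Adj (φ u) (φ v) := by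
    intro u v huv h
    refine ⟨fun h' => huv (φ.injective h'), ?_⟩
    rw [← e _ _ huv, h]
  by_cases hir : (i : ℕ) < r
  · have eq : mixPKH k s r i = ⟨Fin 5, GH3⟩ := by simp [mixPKH, hir]
    revert f
    rw [eq]
    intro f hf hi
    simp only [ty, hir, if_true] at hFi
    have ad : ∀ a b : Fin 5, (a ≠ b ∧ ¬ (a = 0 ∧ b = 1) ∧ ¬ (b = 0 ∧ a = 1)) →
        (cgd c hs i).Adj (φ (f a)) (φ (f b)) := fun a b h =>
      adj _ _ (fun h' => h.1 (hf h')) (hi a b ((GH3_adj a b).2 h))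
    exact hFi (φ (f 2)) (Finset.mem_univ _) (φ (f 3)) (Finset.mem_univ _) (φ (f 4)) (Finset.mem_univ _)
      (φ (f 0)) (Finset.mem_univ _) (φ (f 1)) (Finset.mem_univ _)
      (fun h => absurd (hf (φ.injective h)) (by decide))
      (ad _ _ (by decide)) (ad _ _ (by decide)) (ad _ _ (by decide)) (ad _ _ (by decide))
      (ad _ _ (by decide)) (ad _ _ (by decide)) (ad _ _ (by decide)) (ad _ _ (by decide))
      (ad _ _ (by decide))
  · have hik : (i : ℕ) < r + s := by have := i.2; omega
    have eq : mixPKH k s r i = ⟨Fin 3, GK3⟩ := by simp [mixPKH, hir, hik]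
    revert f
    rw [eq]
    intro f hf hi
    simp only [ty, hir, if_false] at hFi
    have ad : ∀ a b : Fin 3, a ≠ b → (cgd c hs i).Adj (φ (f a)) (φ (f b)) := fun a b h =>
      adj _ _ (fun h' => h (hf h')) (hi a b h)
    exact hFi (φ (f 0)) (Finset.mem_univ _) (φ (f 1)) (Finset.mem_univ _) (φ (f 2)) (Finset.mem_univ _)
      (ad _ _ (by decide)) (ad _ _ (by decide)) (ad _ _ (by decide))

theorem prod_wt (k r : ℕ) (hr : r ≤ k) :
    wf Finset.univ (fun i : Fin k => ty r i) = √17 ^ r * √5 ^ (k - r) := by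
  unfold wf
  rw [Fin.prod_univ_eq_prod_range (fun i => wt (ty r i)) k, ← Finset.prod_range_mul_prod_Ico _ hr]
  congr 1
  · rw [Finset.prod_congr rfl (g := fun _ => √17)]
    · simp
    · intro i hi
      simp [ty, Finset.mem_range.1 hi, wt]
  · rw [Finset.prod_congr rfl (g := fun _ => √5)]
    · simp
    · intro i hi
      have := (Finset.mem_Ico.1 hi).1
      simp [ty, not_lt.2 this, wt]

theorem final_aux {k s r N : ℕ} (hk : 1 ≤ k) (hsr : s + r = k) (h : LB N k (ty r))
    (hP : Phi (fun i : Fin k => ty r i) ≤ N) : GR k (mixPKH k s r) = N + 1 := by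
  unfold GR
  have hmem : N + 1 ∈ {n : ℕ | ∀ c : Fin n → Fin n → Fin k, IsGallaiColoring c →
    ∃ i : Fin k, HasMonoCopy (mixPKH k s r i).2 c i} := by
    intro c hc
    by_contra hn
    have := (upper hsr c hc hn).trans hP
    push_cast at this
    linarith
  apply le_antisymm
  · exact Nat.sInf_le hmem
  · apply le_csInf ⟨_, hmem⟩
    intro m hm
    by_contra hlt
    exact lower hk hsr h (by omega) hm

end GRP

theorem GR_mixPKH_b1 (k s r : ℕ) (hk : 1 ≤ k) (hs : Even s) (hr : Even r)
    (hsr : s + r = k) :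
    GR k (mixPKH k s r) =
      5 ^ (s / 2) * ⌊21 * (17 : ℝ) ^ (((r : ℝ) - 2) / 2)⌋₊ + 1 := by
  obtain ⟨a, rfl⟩ := hs
  obtain ⟨b, rfl⟩ := hr
  have ha : (a + a) / 2 = a := by omega
  rw [ha]
  have h5 : √5 ^ (a + a) = (5 : ℝ) ^ a := by
    rw [← two_mul, pow_mul, Real.sq_sqrt (by norm_num)]
  have h17 : √17 ^ (b + b) = (17 : ℝ) ^ b := by
    rw [← two_mul, pow_mul, Real.sq_sqrt (by norm_num)]
  have hka : k - (b + b) = a + a := by omega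
  have hw := GRP.prod_wt k (b + b) (by omega)
  rw [hka, h5, h17] at hw
  have hpos : (0 : ℝ) ≤ 5 ^ a := by positivity
  rcases b with _ | b
  · have hfl : ⌊21 * (17 : ℝ) ^ (((((0 + 0 : ℕ)) : ℝ) - 2) / 2)⌋₊ = 1 := by
      have : (((((0 + 0 : ℕ)) : ℝ) - 2) / 2) = (-1 : ℝ) := by norm_num
      rw [this, Real.rpow_neg_one, Nat.floor_eq_iff (by norm_num)]
      norm_num
    rw [hfl]
    refine GRP.final_aux hk hsr ?_ ?_
    · have := GRP.LB_5 (GRP.LB_zero (GRP.ty (0 + 0))) (GRP.ty_or _) a (by intro i _ _; simp [GRP.ty])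
      have e1 : 0 + 2 * a = k := by omega
      rw [e1, one_mul] at this
      rw [mul_one]
      exact this
    · unfold GRP.Phi
      rw [hw]
      have hb := GRP.bf_le Finset.univ (fun i : Fin k => GRP.ty (0 + 0) i) (le_refl (1 : ℝ))
        (by intro i _; simp [GRP.ty, GRP.bt])
      push_cast
      nlinarith
  · have hfl : ⌊21 * (17 : ℝ) ^ (((((b + 1 + (b + 1) : ℕ)) : ℝ) - 2) / 2)⌋₊ = 21 * 17 ^ b := by
      have : (((((b + 1 + (b + 1) : ℕ)) : ℝ) - 2) / 2) = (b : ℝ) := by push_cast; ring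
      rw [this, Real.rpow_natCast]
      have : (21 * (17 : ℝ) ^ b) = ((21 * 17 ^ b : ℕ) : ℝ) := by push_cast; ring
      rw [this, Nat.floor_natCast]
    rw [hfl]
    refine GRP.final_aux hk hsr ?_ ?_
    · have h1 := GRP.LB_17 (GRP.LB_21 (GRP.ty (b + 1 + (b + 1))) (by simp [GRP.ty])
        (by simp only [GRP.ty]; rw [if_pos (by omega)])) (GRP.ty_or _) b
        (by intro i _ h; simp only [GRP.ty]; rw [if_pos (by omega)])
      have := GRP.LB_5 h1 (GRP.ty_or _) a
        (by intro i h _; simp only [GRP.ty]; rw [if_neg (by omega)])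
      have e1 : 2 + 2 * b + 2 * a = k := by omega
      rw [e1, mul_comm (21 * 17 ^ b)] at this
      exact this
    · unfold GRP.Phi
      rw [hw]
      have hb := GRP.bf_le Finset.univ (fun i : Fin k => GRP.ty (b + 1 + (b + 1)) i)
        (b := 21 / 17) (by norm_num)
        (by
          intro i _
          rcases GRP.ty_or (b + 1 + (b + 1)) i with h | h <;> simp only [h, GRP.bt] <;> norm_num)
      have hp : (0 : ℝ) ≤ 17 ^ (b + 1) * 5 ^ a := by positivity
      calc _ ≤ 21 / 17 * ((17 : ℝ) ^ (b + 1) * 5 ^ a) := mul_le_mul_of_nonneg_right hb hp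
        _ = _ := by push_cast; ring
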